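/- arXiv:1010.3778 — 3 statements merged into one kernel-verified Lean document; each statement's English description precedes it below -/
import Mathlib

section
/- Let n ≥ 2, let G = SL_n(ℝ) (the special linear group over ℝ with its standard topology and Borel σ-algebra), and let Λ ≤ G be a countable discrete subgroup such that the quotient G/Λ by right translation carries a G-invariant Borel probability measure (i.e. Λ is a lattice). Let Γ ≤ G be the image of a finite-index subgroup of SL_n(ℤ) under the entrywise inclusion SL_n(ℤ) → SL_n(ℝ), acting on G/Λ by left translation, and let η be a Γ-invariant Borel probability measure on G/Λ. Then for every sequence (ν_k) of Borel probability measures on (G/Λ) × (G/Λ) satisfying: (1) both marginals of ν_k equal η for every k; (2) ∫ f(x) g(y) dν_k(x,y) → ∫ f g dη for all bounded Borel functions f, g : G/Λ → ℝ; (3) ‖(γ×γ)_*ν_k − ν_k‖ → 0 for every γ ∈ Γ; one has ν_k(Δ) → 1, where Δ is the diagonal of (G/Λ) × (G/Λ). -/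
open MeasureTheory Filter Topology Matrix

/-- The special linear group inherits the standard topology from the space of matrices. -/
noncomputable instance SLtop (n : ℕ) : TopologicalSpace (SpecialLinearGroup (Fin n) ℝ) :=
  inferInstanceAs (TopologicalSpace {A : Matrix (Fin n) (Fin n) ℝ // A.det = 1})

/-- The special linear group carries the Borel σ-algebra of its standard topology
(the subtype σ-algebra coming from the Borel σ-algebra of the space of matrices). -/
noncomputable instance SLmeas (n : ℕ) : MeasurableSpace (SpecialLinearGroup (Fin n) ℝ) :=
  borel _

instance SLborel (n : ℕ) : BorelSpace (SpecialLinearGroup (Fin n) ℝ) := ⟨rfl⟩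

/-- The total variation distance `‖μ - ν‖` between two (finite) Borel measures:
for probability measures `μ, ν` this is exactly the total variation norm of the signed
measure `μ - ν`, namely `2 · sup_A |μ(A) - ν(A)|` over measurable sets `A`. -/
noncomputable def tvDist {Z : Type*} [MeasurableSpace Z] (μ ν : Measure Z) : ℝ :=
  2 * ⨆ A : {s : Set Z // MeasurableSet s}, |(μ A.1).toReal - (ν A.1).toReal|

/-- The differential of the determinant at the identity is the trace. -/
theorem abs_det_one_add_sub_trace_le (n : ℕ) :
    ∃ δ > 0, ∀ X : Fin n → Fin n → ℝ, ‖X‖ < δ →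
      |(1 + Matrix.of X).det - 1 - (Matrix.of X).trace| ≤ 1 / 2 * ‖X‖ := by
  have hd : DifferentiableAt ℝ (fun X : Fin n → Fin n → ℝ => (1 + Matrix.of X).det) 0 := by
    simp only [Matrix.det_apply, Matrix.add_apply, Matrix.of_apply]
    fun_prop
  have hf := hd.hasFDerivAt
  set L := fderiv ℝ (fun X : Fin n → Fin n → ℝ => (1 + Matrix.of X).det) 0 with hL
  have hLX : ∀ X, L X = (Matrix.of X).trace := by
    intro X
    have h1 : HasDerivAt (fun t : ℝ => (1 + t • Matrix.of X).det) (L X) 0 := by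
      have := HasFDerivAt.comp_hasDerivAt_of_eq (0 : ℝ) hf
        ((hasDerivAt_id (0 : ℝ)).smul_const X) (by simp)
      simpa [Function.comp_def] using this
    have h2 : HasDerivAt (fun t : ℝ => (1 + t • Matrix.of X).det) (Matrix.of X).trace 0 := by
      rw [show (fun t : ℝ => (1 + t • Matrix.of X).det) = _ from
        funext fun t => Matrix.det_one_add_smul t (Matrix.of X)]
      set p := (det (1 + (Polynomial.X : Polynomial ℝ) •
        (Matrix.of X).map Polynomial.C)).divX.divX
      have h3 := (((hasDerivAt_id (0 : ℝ)).const_mul (Matrix.of X).trace).const_add 1).add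
        ((p.hasDerivAt 0).mul ((hasDerivAt_id (0 : ℝ)).pow 2))
      exact h3.congr_deriv (by simp)
    exact h1.unique h2
  have h := hf.isLittleO.def (show (0 : ℝ) < 1 / 2 by norm_num)
  obtain ⟨δ, hδ, hball⟩ := Metric.eventually_nhds_iff.1 h
  refine ⟨δ, hδ, fun X hX => ?_⟩
  have := hball (y := X) (by simpa using hX)
  have e : (1 + Matrix.of (0 : Fin n → Fin n → ℝ)).det = 1 := by
    simp
  simpa [hLX, e] using this

theorem Pi.exists_norm_apply_eq {ι E : Type*} [Fintype ι] [Nonempty ι] [SeminormedAddCommGroup E]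
    (f : ι → E) : ∃ i, ‖f i‖ = ‖f‖ := by
  obtain ⟨i, hi⟩ := Finite.exists_max fun i => ‖f i‖
  exact ⟨i, le_antisymm (norm_le_pi_norm f i) ((pi_norm_le_iff_of_nonempty _).2 hi)⟩

/-- A small nonzero matrix `X` with `det (1 + X) = 1` is not close to a scalar matrix. -/
theorem eq_zero_of_nearly_scalar (n : ℕ) :
    ∃ δ > 0, ∀ X : Fin n → Fin n → ℝ, ‖X‖ < δ → (1 + Matrix.of X).det = 1 →
      (∀ i j, i ≠ j → |X j i| ≤ 1 / 2 * ‖X‖) →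
      (∀ i j, |X i i - X j j| ≤ 1 / 2 * ‖X‖) → X = 0 := by
  obtain ⟨δ, hδ, h⟩ := abs_det_one_add_sub_trace_le n
  refine ⟨δ, hδ, fun X hX hdet hoff hdiag => ?_⟩
  by_contra hne
  have hpos : 0 < ‖X‖ := norm_pos_iff.2 hne
  have h' := h X hX
  rw [hdet, sub_self, zero_sub, abs_neg] at h'
  have hmax : ∃ i j, |X i j| = ‖X‖ := by
    have : Nonempty (Fin n) := by
      by_contra hemp
      rw [not_nonempty_iff] at hemp
      exact hne (Subsingleton.elim _ _)
    obtain ⟨i, hi⟩ := Pi.exists_norm_apply_eq X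
    obtain ⟨j, hj⟩ := Pi.exists_norm_apply_eq (X i)
    exact ⟨i, j, by rw [← hi, ← hj, Real.norm_eq_abs]⟩
  obtain ⟨i, j, hij⟩ := hmax
  have hji : j = i := by
    by_contra hji
    have := hoff j i hji
    linarith
  subst hji
  have htr : (Matrix.of X).trace = ∑ a, X a a := rfl
  rw [htr] at h'
  have h0 := hdiag j
  rcases abs_cases (X j j) with ⟨e, -⟩ | ⟨e, -⟩
  · have : X j j ≤ ∑ a, X a a := Finset.single_le_sum (f := fun a => X a a)
      (fun a _ => by have := abs_le.1 (h0 a); linarith) (Finset.mem_univ j)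
    have := (abs_le.1 h').2
    linarith
  · have : -X j j ≤ ∑ a, -X a a := Finset.single_le_sum (f := fun a => -X a a)
      (fun a _ => by have := abs_le.1 (h0 a); linarith) (Finset.mem_univ j)
    have := (abs_le.1 h').1
    rw [Finset.sum_neg_distrib] at *
    linarith

section Displacement

variable {G : Type*} [Group G] (Λ : Subgroup G)

/-- The pairs of points of `G ⧸ Λ` of the form `(x, g • x)` with `g ∈ V`. -/
def translatePairs (V : Set G) : Set ((G ⧸ Λ) × (G ⧸ Λ)) := {p | ∃ g ∈ V, g • p.1 = p.2}

/-- The points of `G ⧸ Λ` that no nontrivial element of `W` fixes. -/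
def freePoints (W : Set G) : Set (G ⧸ Λ) := {x | ∀ g ∈ W, g • x = x → g = 1}

open Classical in
/-- An element of `V` moving `p.1` to `p.2`, if `p.1 ∈ K` and such an element exists. -/
noncomputable def displacement (K : Set (G ⧸ Λ)) (V : Set G) (p : (G ⧸ Λ) × (G ⧸ Λ)) : G :=
  if h : p.1 ∈ K ∧ p ∈ translatePairs Λ V then h.2.choose else 1

variable {Λ}

theorem displacement_spec {K : Set (G ⧸ Λ)} {V : Set G} {p : (G ⧸ Λ) × (G ⧸ Λ)}
    (h : p.1 ∈ K ∧ p ∈ translatePairs Λ V) :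
    displacement Λ K V p ∈ V ∧ displacement Λ K V p • p.1 = p.2 := by
  rw [displacement, dif_pos h]
  exact h.2.choose_spec

theorem displacement_eq {W V : Set G} (hVW : ∀ g ∈ V, ∀ h ∈ V, g⁻¹ * h ∈ W)
    {p : (G ⧸ Λ) × (G ⧸ Λ)} (hp : p.1 ∈ freePoints Λ W) {g : G} (hg : g ∈ V)
    (hgp : g • p.1 = p.2) : displacement Λ (freePoints Λ W) V p = g := by
  obtain ⟨h1, h2⟩ := displacement_spec ⟨hp, g, hg, hgp⟩
  refine (inv_mul_eq_one.1 (hp _ (hVW g hg _ h1) ?_)).symm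
  rw [mul_smul, h2, ← hgp, inv_smul_smul]

variable [TopologicalSpace G] [IsTopologicalGroup G]

theorem exists_mem_freePoints [DiscreteTopology Λ] (x : G ⧸ Λ) :
    ∃ W ∈ 𝓝 (1 : G), x ∈ freePoints Λ W := by
  obtain ⟨a, rfl⟩ := QuotientGroup.mk_surjective x
  obtain ⟨O, hO, hO1⟩ : ∃ O ∈ 𝓝 (1 : G), ∀ g ∈ O, g ∈ Λ → g = 1 := by
    have h : ({1} : Set Λ) ∈ 𝓝 (1 : Λ) := by simp
    rw [mem_nhds_subtype] at h
    obtain ⟨O, hO, h⟩ := h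
    exact ⟨O, hO, fun g hg hgΛ => congrArg Subtype.val (h (a := ⟨g, hgΛ⟩) hg)⟩
  have hc : Tendsto (fun g => a⁻¹ * g * a) (𝓝 1) (𝓝 (1 : G)) := by
    have : Continuous fun g => a⁻¹ * g * a := by fun_prop
    simpa using this.tendsto 1
  refine ⟨_, hc hO, fun g hg hgx => ?_⟩
  have hmem : a⁻¹ * g * a ∈ Λ := by
    have := QuotientGroup.eq.1 (show ((a : G) : G ⧸ Λ) = ((g * a : G) : G ⧸ Λ) from hgx.symm)
    rwa [← mul_assoc] at this
  have h1 := hO1 _ hg hmem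
  rw [mul_eq_one_iff_eq_inv, inv_mul_eq_iff_eq_mul, mul_inv_cancel] at h1
  exact h1

variable [PolishSpace G] [MeasurableSpace G] [BorelSpace G]

theorem measurableSet_of_preimage_prodMap_mk [DiscreteTopology Λ] {S : Set ((G ⧸ Λ) × (G ⧸ Λ))}
    (h : MeasurableSet (Prod.map (QuotientGroup.mk : G → G ⧸ Λ) QuotientGroup.mk ⁻¹' S)) :
    MeasurableSet S := by
  have : BorelSpace (G ⧸ Λ) :=
    ⟨QuotientGroup.continuous_mk.map_eq_borel QuotientGroup.mk_surjective⟩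
  have hc : Continuous (Prod.map (QuotientGroup.mk : G → G ⧸ Λ) (QuotientGroup.mk : G → G ⧸ Λ)) :=
    QuotientGroup.continuous_mk.prodMap QuotientGroup.continuous_mk
  have hs := (QuotientGroup.mk_surjective (s := Λ)).prodMap (QuotientGroup.mk_surjective (s := Λ))
  exact (hc.measurable.measurableSet_preimage_iff_of_surjective hs).1 h

theorem measurableSet_translatePairs [Countable Λ] [DiscreteTopology Λ] {V : Set G}
    (hV : MeasurableSet V) : MeasurableSet (translatePairs Λ V) := by
  apply measurableSet_of_preimage_prodMap_mk
  have : Prod.map (QuotientGroup.mk : G → G ⧸ Λ) QuotientGroup.mk ⁻¹' translatePairs Λ V =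
      ⋃ l : Λ, (fun q : G × G => q.2 * l * q.1⁻¹) ⁻¹' V := by
    ext ⟨a, b⟩
    simp only [translatePairs, Set.mem_preimage, Set.mem_ofPred_eq, Set.mem_iUnion, Prod.map]
    constructor
    · rintro ⟨g, hg, h⟩
      have h' := QuotientGroup.eq.1 (show ((b : G) : G ⧸ Λ) = ((g * a : G) : G ⧸ Λ) from h.symm)
      exact ⟨⟨_, h'⟩, by simpa [mul_assoc] using hg⟩
    · rintro ⟨l, hl⟩
      refine ⟨_, hl, ?_⟩
      change ((b * l * a⁻¹ * a : G) : G ⧸ Λ) = b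
      simp
  rw [this]
  refine .iUnion fun l => hV.preimage ?_
  have : Continuous fun q : G × G => q.2 * (l : G) * q.1⁻¹ := by fun_prop
  exact this.measurable

theorem measurableSet_freePoints [Countable Λ] [DiscreteTopology Λ] {W : Set G}
    (hW : MeasurableSet W) : MeasurableSet (freePoints Λ W) := by
  have h := (measurableSet_translatePairs (Λ := Λ) (hW.diff (measurableSet_singleton 1))).preimage
    (measurable_id.prodMk measurable_id)
  convert h.compl using 1
  ext x
  simp only [freePoints, translatePairs, Set.mem_ofPred_eq, Set.mem_compl_iff, Set.mem_preimage,
    Set.mem_sdiff, Set.mem_singleton_iff, id]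
  push Not
  exact ⟨fun h g hg hx => hg.2 (h g hg.1 hx), fun h g hg hx => by
    by_contra h1
    exact h g ⟨hg, h1⟩ hx⟩

theorem measurable_displacement [Countable Λ] [DiscreteTopology Λ] {W V : Set G}
    (hW : MeasurableSet W) (hV : MeasurableSet V) (hVW : ∀ g ∈ V, ∀ h ∈ V, g⁻¹ * h ∈ W) :
    Measurable (displacement Λ (freePoints Λ W) V) := by
  classical
  intro A hA
  have hD (B : Set G) (hB : MeasurableSet B) :
      MeasurableSet (Prod.fst ⁻¹' freePoints Λ W ∩ translatePairs Λ B) :=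
    ((measurableSet_freePoints hW).preimage measurable_fst).inter (measurableSet_translatePairs hB)
  have : displacement Λ (freePoints Λ W) V ⁻¹' A =
      (Prod.fst ⁻¹' freePoints Λ W ∩ translatePairs Λ (V ∩ A)) ∪
        ((Prod.fst ⁻¹' freePoints Λ W ∩ translatePairs Λ V)ᶜ ∩ {_p | (1 : G) ∈ A}) := by
    ext p
    by_cases hp : p.1 ∈ freePoints Λ W ∧ p ∈ translatePairs Λ V
    · constructor
      · intro h
        exact Or.inl ⟨hp.1, _, ⟨(displacement_spec hp).1, h⟩, (displacement_spec hp).2⟩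
      · rintro (⟨-, g, ⟨hg, hgA⟩, hgp⟩ | ⟨h, -⟩)
        · rwa [Set.mem_preimage, displacement_eq hVW hp.1 hg hgp]
        · exact absurd hp h
    · have hd : displacement Λ (freePoints Λ W) V p = 1 := dif_neg hp
      rw [Set.mem_preimage, hd]
      refine ⟨fun h => Or.inr ⟨hp, h⟩, fun h => h.elim (fun h => absurd ?_ hp) (·.2)⟩
      exact ⟨h.1, h.2.imp fun g hg => ⟨hg.1.1, hg.2⟩⟩
  rw [this]
  exact (hD _ (hV.inter hA)).union ((hD _ hV).compl.inter (.const _))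

theorem tendsto_curry_zero_of_le {f : ℕ × ℕ → ℝ} {a : ℕ → ℝ} {b : ℕ → ℕ → ℝ}
    (ha : Tendsto a atTop (𝓝 0)) (hb : ∀ᶠ i in atTop, Tendsto (b i) atTop (𝓝 0))
    (h0 : ∀ q, 0 ≤ f q) (hf : ∀ i k, f (i, k) ≤ a i + b i k) :
    Tendsto f (atTop.curry atTop) (𝓝 0) := by
  rw [Metric.tendsto_nhds]
  intro ε hε
  rw [eventually_curry_iff]
  filter_upwards [hb, ha.eventually_lt_const (half_pos hε)] with i hi hai
  filter_upwards [hi.eventually_lt_const (half_pos hε)] with k hk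
  rw [Real.dist_0_eq_abs, abs_of_nonneg (h0 _)]
  linarith [hf i k]

/-- A sequence of couplings of `η` with itself which converges to the diagonal coupling on products
of Borel sets gives asymptotically no mass to the pairs that are not close to each other. -/
theorem tendsto_measureReal_compl_translatePairs [Countable Λ] [DiscreteTopology Λ]
    {η : Measure (G ⧸ Λ)} [IsProbabilityMeasure η]
    {ν : ℕ → Measure ((G ⧸ Λ) × (G ⧸ Λ))} [∀ k, IsProbabilityMeasure (ν k)]
    (hfst : ∀ k, (ν k).map Prod.fst = η)
    (hdiag : ∀ A B, MeasurableSet A → MeasurableSet B →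
      Tendsto (fun k => (ν k).real (A ×ˢ B)) atTop (𝓝 (η.real (A ∩ B))))
    {V : Set G} (hV : V ∈ 𝓝 1) :
    Tendsto (fun k => (ν k).real (translatePairs Λ V)ᶜ) atTop (𝓝 0) := by
  obtain ⟨V', hV'o, hV'1, hV'⟩ : ∃ V' : Set G, IsOpen V' ∧ 1 ∈ V' ∧
      ∀ g ∈ V', ∀ h ∈ V', h * g⁻¹ ∈ V := by
    have hc : Continuous fun q : G × G => q.2 * q.1⁻¹ := by fun_prop
    have := hc.tendsto' (1, 1) 1 (by simp) hV
    rw [mem_map, nhds_prod_eq, mem_prod_self_iff] at this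
    obtain ⟨O, hO, h⟩ := this
    obtain ⟨V', hV'O, ho, h1⟩ := mem_nhds_iff.1 hO
    exact ⟨V', ho, h1, fun g hg k hk => h (Set.mk_mem_prod (hV'O hg) (hV'O hk))⟩
  have : Nonempty (G ⧸ Λ) := ⟨((1 : G) : G ⧸ Λ)⟩
  set d := TopologicalSpace.denseSeq G
  set A : ℕ → Set (G ⧸ Λ) := fun i => {x | ∃ g ∈ V', x = g • (d i : G ⧸ Λ)}
  have hAm : ∀ i, MeasurableSet (A i) := by
    intro i
    have : BorelSpace (G ⧸ Λ) :=
      ⟨QuotientGroup.continuous_mk.map_eq_borel QuotientGroup.mk_surjective⟩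
    have hA : A i = QuotientGroup.mk '' ((fun g => g * (d i)⁻¹) ⁻¹' V') := by
      ext x
      constructor
      · rintro ⟨g, hg, rfl⟩
        exact ⟨g * d i, by simpa using hg, rfl⟩
      · rintro ⟨g, hg, rfl⟩
        refine ⟨_, hg, ?_⟩
        change _ = ((g * (d i)⁻¹ * d i : G) : G ⧸ Λ)
        simp
    rw [hA]
    exact (QuotientGroup.isOpenMap_coe _ (hV'o.preimage (by fun_prop))).measurableSet
  have hAU : ∀ x, ∃ i, x ∈ A i := by
    intro x
    obtain ⟨a, rfl⟩ := QuotientGroup.mk_surjective x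
    have ho : IsOpen ((fun g => a * g⁻¹) ⁻¹' V') := hV'o.preimage (by fun_prop)
    obtain ⟨y, hy, i, rfl⟩ :=
      (TopologicalSpace.denseRange_denseSeq G).inter_open_nonempty _ ho ⟨a, by simpa using hV'1⟩
    refine ⟨i, _, hy, ?_⟩
    change _ = ((a * (d i)⁻¹ * d i : G) : G ⧸ Λ)
    simp
  have hacc : ∀ M, MeasurableSet (Set.accumulate A M) := fun M =>
    .biUnion (Set.to_countable _) fun i _ => hAm i
  have hη : Tendsto (fun M => η.real (Set.accumulate A M)ᶜ) atTop (𝓝 0) := by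
    have h := tendsto_measure_iUnion_accumulate (μ := η) (f := A)
    rw [Set.iUnion_eq_univ_iff.2 hAU, measure_univ] at h
    have h2 := (ENNReal.tendsto_toReal ENNReal.one_ne_top).comp h
    have h3 : Tendsto (fun M => 1 - η.real (Set.accumulate A M)) atTop (𝓝 (1 - 1)) :=
      tendsto_const_nhds.sub h2
    rw [sub_self] at h3
    refine h3.congr fun M => ?_
    rw [measureReal_compl (hacc M), probReal_univ]
  have hν : ∀ M, Tendsto (fun k => ∑ i ∈ Finset.range (M + 1), (ν k).real (A i ×ˢ (A i)ᶜ))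
      atTop (𝓝 0) := by
    intro M
    rw [← Finset.sum_const_zero (s := Finset.range (M + 1))]
    refine tendsto_finsetSum _ fun i _ => ?_
    simpa using hdiag _ _ (hAm i) (hAm i).compl
  have hle : ∀ M k, (ν k).real (translatePairs Λ V)ᶜ ≤ η.real (Set.accumulate A M)ᶜ +
      ∑ i ∈ Finset.range (M + 1), (ν k).real (A i ×ˢ (A i)ᶜ) := by
    intro M k
    have e : η.real (Set.accumulate A M)ᶜ = (ν k).real (Prod.fst ⁻¹' (Set.accumulate A M)ᶜ) := by
      rw [← hfst k, map_measureReal_apply measurable_fst (hacc M).compl]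
    rw [e]
    refine le_trans (measureReal_mono ?_) ((measureReal_union_le _ _).trans
      (add_le_add_right (measureReal_biUnion_finset_le _ _) _))
    intro p hp
    by_cases h : p.1 ∈ Set.accumulate A M
    · refine Or.inr ?_
      obtain ⟨i, hi, hpi⟩ := Set.mem_accumulate.1 h
      refine Set.mem_biUnion (show i ∈ Finset.range (M + 1) by simp; omega) ⟨hpi, fun hpi2 => hp ?_⟩
      obtain ⟨g, hg, hg'⟩ := hpi
      obtain ⟨h, hh, hh'⟩ := hpi2
      exact ⟨h * g⁻¹, hV' g hg h hh, by rw [mul_smul, hg', inv_smul_smul, hh']⟩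
    · exact Or.inl h
  have hcurry : Tendsto (fun q : ℕ × ℕ => (ν q.2).real (translatePairs Λ V)ᶜ)
      (atTop.curry atTop) (𝓝 0) :=
    tendsto_curry_zero_of_le hη (.of_forall hν) (fun _ => measureReal_nonneg) hle
  refine (tendsto_order.2 ⟨fun a ha => .of_forall fun k => ha.trans_le measureReal_nonneg,
    fun a ha => ?_⟩)
  exact (eventually_curry_iff.1 (hcurry.eventually_lt_const ha)).exists.choose_spec

/-- Couplings converging to the diagonal are asymptotically carried by pairs `(x, g • x)` where `g`
is a small element depending measurably on the pair, and equivariantly up to a small error. -/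
theorem exists_displacement [Countable Λ] [DiscreteTopology Λ]
    {η : Measure (G ⧸ Λ)} [IsProbabilityMeasure η]
    {ν : ℕ → Measure ((G ⧸ Λ) × (G ⧸ Λ))} [∀ k, IsProbabilityMeasure (ν k)]
    (hfst : ∀ k, (ν k).map Prod.fst = η)
    (hdiag : ∀ A B, MeasurableSet A → MeasurableSet B →
      Tendsto (fun k => (ν k).real (A ×ˢ B)) atTop (𝓝 (η.real (A ∩ B)))) :
    ∃ θ : ℕ → (G ⧸ Λ) × (G ⧸ Λ) → G, (∀ i, Measurable (θ i)) ∧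
      (∀ U ∈ 𝓝 (1 : G), Tendsto
        (fun q : ℕ × ℕ => (ν q.2).real {p | θ q.1 p ∈ U ∧ θ q.1 p • p.1 = p.2}ᶜ)
        (atTop.curry atTop) (𝓝 0)) ∧
      ∀ γ : G, η.map (γ • ·) = η → Tendsto
        (fun q : ℕ × ℕ => (ν q.2).real
          {p | θ q.1 (γ • p.1, γ • p.2) ≠ γ * θ q.1 p * γ⁻¹})
        (atTop.curry atTop) (𝓝 0) := by
  obtain ⟨W, hWo, hW⟩ := (nhds_basis_opens (1 : G)).exists_antitone_subbasis
  have hV : ∀ i, ∃ V : Set G, IsOpen V ∧ 1 ∈ V ∧ V ⊆ W i ∧ ∀ g ∈ V, ∀ h ∈ V, g⁻¹ * h ∈ W i := by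
    intro i
    have hc : Continuous fun q : G × G => q.1⁻¹ * q.2 := by fun_prop
    have := hc.tendsto' (1, 1) 1 (by simp) (hW.1.mem_of_mem (i := i) trivial)
    rw [mem_map, nhds_prod_eq, mem_prod_self_iff] at this
    obtain ⟨O, hO, h⟩ := this
    obtain ⟨V', hV'O, ho, h1⟩ := mem_nhds_iff.1 hO
    exact ⟨V' ∩ W i, ho.inter (hWo i).2, ⟨h1, (hWo i).1⟩, Set.inter_subset_right,
      fun g hg k hk => h (Set.mk_mem_prod (hV'O hg.1) (hV'O hk.1))⟩
  choose V hVo hV1 hVW hVm using hV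
  have hVn : ∀ i, V i ∈ 𝓝 1 := fun i => (hVo i).mem_nhds (hV1 i)
  have hKm : ∀ i, MeasurableSet (freePoints Λ (W i)) :=
    fun i => measurableSet_freePoints (hWo i).2.measurableSet
  have hK : Tendsto (fun i => η.real (freePoints Λ (W i))ᶜ) atTop (𝓝 0) := by
    have h := tendsto_measure_iInter_atTop (μ := η) (s := fun i => (freePoints Λ (W i))ᶜ)
      (fun i => (hKm i).compl.nullMeasurableSet)
      (fun i j hij => Set.compl_subset_compl.2 fun x hx g hg => hx g (hW.2 hij hg))
      ⟨0, measure_ne_top _ _⟩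
    have h0 : ⋂ i, (freePoints Λ (W i))ᶜ = ∅ := by
      rw [← Set.compl_iUnion, Set.compl_empty_iff, Set.iUnion_eq_univ_iff]
      intro x
      obtain ⟨O, hO, hx⟩ := exists_mem_freePoints x
      obtain ⟨i, -, hi⟩ := hW.1.mem_iff.1 hO
      exact ⟨i, fun g hg => hx g (hi hg)⟩
    rw [h0, measure_empty] at h
    exact (ENNReal.tendsto_toReal ENNReal.zero_ne_top).comp h
  have hνK : ∀ i k, (ν k).real (Prod.fst ⁻¹' (freePoints Λ (W i))ᶜ) =
      η.real (freePoints Λ (W i))ᶜ := by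
    intro i k
    rw [← hfst k, map_measureReal_apply measurable_fst (hKm i).compl]
  refine ⟨fun i => displacement Λ (freePoints Λ (W i)) (V i), fun i =>
    measurable_displacement (hWo i).2.measurableSet (hVo i).measurableSet (hVm i), ?_, ?_⟩
  · intro U hU
    obtain ⟨i₀, -, hi₀⟩ := hW.1.mem_iff.1 hU
    refine tendsto_curry_zero_of_le (a := fun i => η.real (freePoints Λ (W i))ᶜ +
      if i₀ ≤ i then 0 else 1) (b := fun i k => (ν k).real (translatePairs Λ (V i))ᶜ) ?_
      (.of_forall fun i => tendsto_measureReal_compl_translatePairs hfst hdiag (hVn i))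
      (fun _ => measureReal_nonneg) ?_
    · rw [← add_zero (0 : ℝ)]
      refine hK.add (tendsto_const_nhds.congr' ?_)
      filter_upwards [eventually_ge_atTop i₀] with i hi
      simp [hi]
    · intro i k
      by_cases hi : i₀ ≤ i
      · simp only [hi, if_true, add_zero]
        rw [← hνK i k]
        refine le_trans (measureReal_mono ?_) (measureReal_union_le _ _)
        intro p hp
        by_contra hcon
        simp only [Set.mem_union, Set.mem_preimage, Set.mem_compl_iff, not_or, not_not] at hcon
        have hs := displacement_spec hcon
        exact hp ⟨hi₀ (hW.2 hi (hVW i hs.1)), hs.2⟩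
      · simp only [hi, if_false]
        have h1 : (0 : ℝ) ≤ η.real (freePoints Λ (W i))ᶜ := measureReal_nonneg
        have h2 : (0 : ℝ) ≤ (ν k).real (translatePairs Λ (V i))ᶜ := measureReal_nonneg
        have h3 := measureReal_le_one (μ := ν k)
          (s := {p | displacement Λ (freePoints Λ (W i)) (V i) p ∈ U ∧
            displacement Λ (freePoints Λ (W i)) (V i) p • p.1 = p.2}ᶜ)
        linarith
  · intro γ hγ
    have hγm : Measurable fun x : G ⧸ Λ => γ • x := by
      rw [QuotientGroup.measurable_from_quotient]
      exact QuotientGroup.measurable_coe.comp (continuous_const_mul γ).measurable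
    have hνK' : ∀ i k, (ν k).real {p | γ • p.1 ∉ freePoints Λ (W i)} =
        η.real (freePoints Λ (W i))ᶜ := by
      intro i k
      conv_rhs => rw [← hγ, map_measureReal_apply hγm (hKm i).compl, ← hfst k,
        map_measureReal_apply measurable_fst (hγm (hKm i).compl)]
      rfl
    have hconj : Tendsto (fun g => γ * g * γ⁻¹) (𝓝 1) (𝓝 (1 : G)) := by
      have : Continuous fun g => γ * g * γ⁻¹ := by fun_prop
      simpa using this.tendsto 1
    refine tendsto_curry_zero_of_le (a := fun i => η.real (freePoints Λ (W i))ᶜ +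
      η.real (freePoints Λ (W i))ᶜ)
      (b := fun i k => (ν k).real
        (translatePairs Λ (V i ∩ (fun g => γ * g * γ⁻¹) ⁻¹' V i))ᶜ)
      (by simpa using hK.add hK)
      (.of_forall fun i => tendsto_measureReal_compl_translatePairs hfst hdiag
        (inter_mem (hVn i) (hconj (hVn i))))
      (fun _ => measureReal_nonneg) fun i k => ?_
    conv_rhs => enter [1]; rw [← hνK i k]; enter [2]; rw [hνK i k, ← hνK' i k]
    refine le_trans (measureReal_mono ?_) ((measureReal_union_le _ _).trans
      (add_le_add_left (measureReal_union_le _ _) _))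
    intro p hp
    by_contra hcon
    simp only [Set.mem_union, Set.mem_preimage, Set.mem_compl_iff, Set.mem_ofPred_eq, not_or,
      not_not] at hcon
    obtain ⟨⟨h1, h2⟩, g, ⟨hg, hg'⟩, hgp⟩ := hcon
    refine hp ?_
    change displacement Λ _ (V i) _ = γ * displacement Λ _ (V i) p * γ⁻¹
    rw [displacement_eq (hVm i) h1 hg hgp]
    exact displacement_eq (p := (γ • p.1, γ • p.2)) (hVm i) h2 hg' (by simp [mul_smul, hgp])

end Displacement

theorem measureReal_preimage_le_add_tvDist {P : Type*} [MeasurableSpace P] (μ : Measure P)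
    [IsProbabilityMeasure μ] {T : P → P} (hT : Measurable T) {S : Set P} (hS : MeasurableSet S) :
    μ.real (T ⁻¹' S) ≤ μ.real S + tvDist (μ.map T) μ := by
  have : IsProbabilityMeasure (μ.map T) := Measure.isProbabilityMeasure_map hT.aemeasurable
  have hb : BddAbove (Set.range fun A : {s : Set P // MeasurableSet s} =>
      |((μ.map T) A.1).toReal - (μ A.1).toReal|) := by
    refine ⟨1, ?_⟩
    rintro _ ⟨A, rfl⟩
    exact abs_sub_le_of_nonneg_of_le measureReal_nonneg measureReal_le_one
      measureReal_nonneg measureReal_le_one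
  have h := le_ciSup hb ⟨S, hS⟩
  have h1 := (le_abs_self _).trans h
  have h0 := (abs_nonneg _).trans h
  have e : ((μ.map T) S).toReal = μ.real (T ⁻¹' S) := map_measureReal_apply hT hS
  have e' : (μ S).toReal = μ.real S := rfl
  simp only [e, e'] at h1
  rw [tvDist]
  linarith

section AsympNull

variable {ι P G : Type*} [MeasurableSpace P]

/-- The distributions of the random variables `φ q` asymptotically give no mass to `S`. -/
def AsympNull (l : Filter ι) (μ : ι → Measure P) (φ : ι → P → G) (S : Set G) : Prop :=
  Tendsto (fun q => (μ q).real (φ q ⁻¹' S)) l (𝓝 0)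

variable {l : Filter ι} {μ : ι → Measure P} {φ : ι → P → G}

theorem AsympNull.biUnion {κ : Type*} (F : Finset κ) {S : κ → Set G}
    (h : ∀ i ∈ F, AsympNull l μ φ (S i)) : AsympNull l μ φ (⋃ i ∈ F, S i) := by
  have hs := tendsto_finsetSum F h
  rw [Finset.sum_const_zero] at hs
  refine squeeze_zero (fun _ => measureReal_nonneg) (fun q => ?_) hs
  simp only [Set.preimage_iUnion]
  exact measureReal_biUnion_finset_le _ _

theorem AsympNull.union {S S' : Set G} (h : AsympNull l μ φ S) (h' : AsympNull l μ φ S') :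
    AsympNull l μ φ (S ∪ S') := by
  refine squeeze_zero (fun _ => measureReal_nonneg) (fun q => ?_) (by simpa using h.add h')
  rw [Set.preimage_union]
  exact measureReal_union_le _ _

variable [∀ q, IsProbabilityMeasure (μ q)]

theorem AsympNull.mono {S S' : Set G} (h : AsympNull l μ φ S') (hS : S ⊆ S') :
    AsympNull l μ φ S :=
  squeeze_zero (fun _ => measureReal_nonneg)
    (fun _ => measureReal_mono (Set.preimage_mono hS)) h

variable [Group G] [MeasurableSpace G]

/-- If `φ q` is asymptotically equivariant and `μ q` is asymptotically invariant, then conjugation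
by `γ` asymptotically does not increase the mass given to a set by the distribution of `φ q`. -/
theorem exists_measureReal_conj_le (hφ : ∀ q, Measurable (φ q)) {T : P → P} (hT : Measurable T)
    (htv : Tendsto (fun q => tvDist ((μ q).map T) (μ q)) l (𝓝 0)) {γ : G}
    (hγ : Tendsto (fun q => (μ q).real {p | φ q (T p) ≠ γ * φ q p * γ⁻¹}) l (𝓝 0)) :
    ∃ e : ι → ℝ, Tendsto e l (𝓝 0) ∧ ∀ q S, MeasurableSet S →
      (μ q).real (φ q ⁻¹' ((fun g => γ * g * γ⁻¹) ⁻¹' S)) ≤ (μ q).real (φ q ⁻¹' S) + e q := by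
  refine ⟨_, by simpa using htv.add hγ, fun q S hS => ?_⟩
  have h1 := measureReal_preimage_le_add_tvDist (μ q) hT (hφ q hS)
  have h2 : (μ q).real (φ q ⁻¹' ((fun g => γ * g * γ⁻¹) ⁻¹' S)) ≤
      (μ q).real (T ⁻¹' (φ q ⁻¹' S)) + (μ q).real {p | φ q (T p) ≠ γ * φ q p * γ⁻¹} := by
    refine le_trans (measureReal_mono fun p hp => ?_) (measureReal_union_le _ _)
    by_cases h : φ q (T p) = γ * φ q p * γ⁻¹
    · left
      change φ q (T p) ∈ S
      rw [h]
      exact hp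
    · exact Or.inr h
  linarith

theorem AsympNull.conj (hφ : ∀ q, Measurable (φ q)) {T : P → P} (hT : Measurable T)
    (htv : Tendsto (fun q => tvDist ((μ q).map T) (μ q)) l (𝓝 0)) {γ : G}
    (hγ : Tendsto (fun q => (μ q).real {p | φ q (T p) ≠ γ * φ q p * γ⁻¹}) l (𝓝 0))
    {S : Set G} (hSm : MeasurableSet S) (hS : AsympNull l μ φ S) :
    AsympNull l μ φ ((fun g => γ * g * γ⁻¹) ⁻¹' S) := by
  obtain ⟨e, he, h⟩ := exists_measureReal_conj_le hφ hT htv hγ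
  exact squeeze_zero (fun _ => measureReal_nonneg) (fun q => h q S hSm) (by simpa using hS.add he)

/-- If `S` is contained in its preimage under conjugation by `γ`, then the difference is
asymptotically null. -/
theorem asympNull_conj_sdiff (hφ : ∀ q, Measurable (φ q)) {T : P → P} (hT : Measurable T)
    (htv : Tendsto (fun q => tvDist ((μ q).map T) (μ q)) l (𝓝 0)) {γ : G}
    (hγ : Tendsto (fun q => (μ q).real {p | φ q (T p) ≠ γ * φ q p * γ⁻¹}) l (𝓝 0))
    {S : Set G} (hSm : MeasurableSet S) (hS : S ⊆ (fun g => γ * g * γ⁻¹) ⁻¹' S) :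
    AsympNull l μ φ ((fun g => γ * g * γ⁻¹) ⁻¹' S \ S) := by
  obtain ⟨e, he, h⟩ := exists_measureReal_conj_le hφ hT htv hγ
  refine squeeze_zero (fun _ => measureReal_nonneg) (fun q => ?_) he
  rw [Set.preimage_sdiff, measureReal_sdiff (Set.preimage_mono hS) (hφ q hSm)]
  linarith [h q S hSm]

end AsympNull

section SpecialLinear

variable {n : ℕ}

instance : PolishSpace (SpecialLinearGroup (Fin n) ℝ) := by
  have : PolishSpace (Matrix (Fin n) (Fin n) ℝ) :=
    inferInstanceAs (PolishSpace (Fin n → Fin n → ℝ))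
  have h : IsClosed {A : Matrix (Fin n) (Fin n) ℝ | A.det = 1} :=
    isClosed_singleton.preimage continuous_id.matrix_det
  exact h.polishSpace

instance : IsTopologicalGroup (SpecialLinearGroup (Fin n) ℝ) :=
  Matrix.SpecialLinearGroup.topologicalGroup

theorem continuous_specialLinearGroup_apply (i j : Fin n) :
    Continuous fun g : SpecialLinearGroup (Fin n) ℝ => g i j := by
  have h : Continuous fun g : SpecialLinearGroup (Fin n) ℝ => (g : Matrix (Fin n) (Fin n) ℝ) :=
    continuous_subtype_val
  exact h.matrix_elem i j

/-- The difference between an element of the special linear group and the identity. -/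
def offset (g : SpecialLinearGroup (Fin n) ℝ) : Fin n → Fin n → ℝ :=
  fun i j => g i j - (1 : Matrix (Fin n) (Fin n) ℝ) i j

theorem continuous_offset : Continuous (offset (n := n)) :=
  continuous_pi fun i => continuous_pi fun j =>
    (continuous_specialLinearGroup_apply i j).sub continuous_const

theorem measurable_offset (i j : Fin n) : Measurable fun g => offset (n := n) g i j :=
  ((continuous_apply_apply i j).comp continuous_offset).measurable

theorem offset_conj_transvection {i j : Fin n} (hij : i ≠ j) (m : ℝ)
    (g : SpecialLinearGroup (Fin n) ℝ) :
    offset (.transvection hij m * g * (.transvection hij m)⁻¹) =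
      (Matrix.transvection i j m * Matrix.of (offset g) * Matrix.transvection i j (-m) :
        Matrix (Fin n) (Fin n) ℝ) := by
  have h1 : (Matrix.transvection i j m * Matrix.transvection i j (-m) :
      Matrix (Fin n) (Fin n) ℝ) = 1 := by
    rw [Matrix.transvection_mul_transvection_same _ _ hij, add_neg_cancel, Matrix.transvection_zero]
  have hinv : (SpecialLinearGroup.transvection hij m)⁻¹ =
      SpecialLinearGroup.transvection hij (-m) := by
    rw [inv_eq_iff_mul_eq_one]
    exact Subtype.ext h1
  rw [hinv]
  change Matrix.transvection i j m * (g : Matrix (Fin n) (Fin n) ℝ) *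
    Matrix.transvection i j (-m) - 1 = Matrix.transvection i j m *
    ((g : Matrix (Fin n) (Fin n) ℝ) - 1) * Matrix.transvection i j (-m)
  rw [mul_sub, sub_mul, mul_one, h1]

section conj

variable {i j : Fin n} (hij : i ≠ j) (m : ℝ) (g : SpecialLinearGroup (Fin n) ℝ)

theorem offset_conj_transvection_apply_swap :
    offset (.transvection hij m * g * (.transvection hij m)⁻¹) j i = offset g j i := by
  rw [offset_conj_transvection, Matrix.mul_transvection_apply_of_ne _ _ _ _ hij,
    Matrix.transvection_mul_apply_of_ne _ _ _ _ hij.symm, Matrix.of_apply]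

theorem offset_conj_transvection_apply_left :
    offset (.transvection hij m * g * (.transvection hij m)⁻¹) i i =
      offset g i i + m * offset g j i := by
  rw [offset_conj_transvection, Matrix.mul_transvection_apply_of_ne _ _ _ _ hij,
    Matrix.transvection_mul_apply_same, Matrix.of_apply, Matrix.of_apply]

theorem offset_conj_transvection_apply_right :
    offset (.transvection hij m * g * (.transvection hij m)⁻¹) j j =
      offset g j j - m * offset g j i := by
  rw [offset_conj_transvection, Matrix.mul_transvection_apply_same,
    Matrix.transvection_mul_apply_of_ne _ _ _ _ hij.symm,
    Matrix.transvection_mul_apply_of_ne _ _ _ _ hij.symm, Matrix.of_apply, Matrix.of_apply]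
  ring

theorem offset_conj_transvection_apply :
    offset (.transvection hij m * g * (.transvection hij m)⁻¹) i j =
      offset g i j + m * offset g j j - m * (offset g i i + m * offset g j i) := by
  rw [offset_conj_transvection, Matrix.mul_transvection_apply_same,
    Matrix.transvection_mul_apply_same, Matrix.transvection_mul_apply_same]
  simp only [Matrix.of_apply]
  ring

end conj

/-- The elements `g` such that the `(j, i)` entry of `g - 1` is not small compared to the `(i, i)`
entry. -/
def offDiagDominated (R : ℝ) (i j : Fin n) : Set (SpecialLinearGroup (Fin n) ℝ) :=
  {g | offset g j i ≠ 0 ∧ |offset g i i| ≤ R * |offset g j i|}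

theorem measurableSet_offDiagDominated (R : ℝ) (i j : Fin n) :
    MeasurableSet (offDiagDominated R i j) :=
  (measurable_offset j i (measurableSet_singleton 0)).compl.inter
    (measurableSet_le (continuous_abs.measurable.comp (measurable_offset i i))
      ((continuous_abs.measurable.comp (measurable_offset j i)).const_mul R))

theorem mul_abs_le_of_notMem_offDiagDominated {R : ℝ} {i j : Fin n}
    {g : SpecialLinearGroup (Fin n) ℝ} (h : g ∉ offDiagDominated R i j) :
    R * |offset g j i| ≤ |offset g i i| := by
  by_cases h0 : offset g j i = 0
  · simp [h0]
  · by_contra h1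
    exact h ⟨h0, (not_le.1 h1).le⟩

/-- Near the identity, every nontrivial element of the special linear group, or its conjugate by
a transvection, has a large off-diagonal entry. -/
theorem exists_nhds_offDiagDominated (n : ℕ) {m : ℝ} (hm : 1 ≤ m) :
    ∃ U ∈ 𝓝 (1 : SpecialLinearGroup (Fin n) ℝ), ∀ g ∈ U, g ≠ 1 →
      ∃ (i j : Fin n) (hij : i ≠ j), g ∈ offDiagDominated (8 * m) i j ∨
        .transvection hij m * g * (.transvection hij m)⁻¹ ∈ offDiagDominated (8 * m) j i := by
  obtain ⟨δ, hδ, h⟩ := eq_zero_of_nearly_scalar n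
  refine ⟨{g | ‖offset g‖ < δ}, ?_, fun g hg hg1 => ?_⟩
  · refine (isOpen_lt continuous_offset.norm continuous_const).mem_nhds ?_
    have h1 : offset (1 : SpecialLinearGroup (Fin n) ℝ) = 0 := by
      funext i j
      exact sub_self _
    simpa [h1] using hδ
  by_contra hcon
  push Not at hcon
  have hs : ∀ i j, |offset g i j| ≤ ‖offset g‖ := fun i j =>
    (norm_le_pi_norm (offset g i) j).trans (norm_le_pi_norm (offset g) i)
  have hoff : ∀ i j, i ≠ j → m * |offset g j i| ≤ 1 / 8 * ‖offset g‖ := fun i j hij => by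
    linarith [mul_abs_le_of_notMem_offDiagDominated (hcon i j hij).1, hs i i]
  have hoff' : ∀ i j, i ≠ j → |offset g j i| ≤ 1 / 8 * ‖offset g‖ := fun i j hij =>
    (le_mul_of_one_le_left (abs_nonneg _) hm).trans (hoff i j hij)
  refine hg1 ?_
  have hzero : offset g = 0 := by
    refine h _ hg ?_ (fun i j hij => ?_) fun i j => ?_
    · have e : (1 : Matrix (Fin n) (Fin n) ℝ) + Matrix.of (offset g) = g :=
        add_sub_cancel (1 : Matrix (Fin n) (Fin n) ℝ) (g : Matrix (Fin n) (Fin n) ℝ)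
      rw [e, g.det_coe]
    · linarith [hoff' i j hij, norm_nonneg (offset g)]
    · rcases eq_or_ne i j with rfl | hij
      · simp
      have hc := mul_abs_le_of_notMem_offDiagDominated (hcon i j hij).2
      rw [offset_conj_transvection_apply_right, offset_conj_transvection_apply] at hc
      have hji := hoff i j hij
      have hij' := hoff' j i hij.symm
      have hjj := hs j j
      set s := ‖offset g‖
      have hs0 : 0 ≤ s := norm_nonneg _
      set x := offset g j i
      set y := offset g i j
      set a := offset g i i
      set b := offset g j j
      have hmx : |m * x| ≤ 1 / 8 * s := by rwa [abs_mul, abs_of_nonneg (by linarith)]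
      have hb : |b - m * x| ≤ 9 / 8 * s := by
        linarith [abs_sub b (m * x)]
      have hY : |y + m * b - m * (a + m * x)| ≤ 9 / 64 * s := by
        have := le_mul_of_one_le_left (abs_nonneg (y + m * b - m * (a + m * x))) hm
        linarith
      have hd : m * |a - b| ≤ 9 / 64 * s + 1 / 8 * s + m * (1 / 8 * s) := by
        have e : m * (a - b) = -(y + m * b - m * (a + m * x)) + y + -(m * (m * x)) := by ring
        have hmm : |m * (m * x)| ≤ m * (1 / 8 * s) := by
          rw [abs_mul, abs_of_nonneg (by linarith : 0 ≤ m)]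
          gcongr
        calc m * |a - b| = |m * (a - b)| := by rw [abs_mul, abs_of_nonneg (by linarith : 0 ≤ m)]
          _ ≤ _ := by
            rw [e]
            refine (abs_add_three _ _ _).trans ?_
            rw [abs_neg, abs_neg]
            linarith
      have hms : s ≤ m * s := le_mul_of_one_le_left hs0 hm
      have : m * |a - b| ≤ m * (1 / 2 * s) := by linarith
      exact le_of_mul_le_mul_left this (by linarith)
  ext i j
  exact sub_eq_zero.1 (congrFun (congrFun hzero i) j)

theorem asympNull_offDiagDominated {ι P : Type*} [MeasurableSpace P] {l : Filter ι}
    {μ : ι → Measure P} [∀ q, IsProbabilityMeasure (μ q)]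
    {φ : ι → P → SpecialLinearGroup (Fin n) ℝ} (hφ : ∀ q, Measurable (φ q))
    {T : P → P} (hT : Measurable T)
    (htv : Tendsto (fun q => tvDist ((μ q).map T) (μ q)) l (𝓝 0)) {i j : Fin n} (hij : i ≠ j)
    {m : ℝ} (hm : 0 < m)
    (hγ : Tendsto (fun q => (μ q).real {p | φ q (T p) ≠
      .transvection hij m * φ q p * (.transvection hij m)⁻¹}) l (𝓝 0)) :
    AsympNull l μ φ (offDiagDominated (8 * m) i j) := by
  set S : ℝ → Set (SpecialLinearGroup (Fin n) ℝ) := fun t =>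
    {g | offset g j i ≠ 0 ∧ t ≤ offset g i i / offset g j i}
  have hSm : ∀ t, MeasurableSet (S t) := fun t =>
    (measurable_offset j i (measurableSet_singleton 0)).compl.inter
      (measurableSet_le measurable_const ((measurable_offset i i).div (measurable_offset j i)))
  have hconj : ∀ t, (fun g => .transvection hij m * g * (.transvection hij m)⁻¹) ⁻¹' S t =
      S (t - m) := by
    intro t
    ext g
    simp only [S, Set.mem_preimage, Set.mem_ofPred_eq, offset_conj_transvection_apply_swap,
      offset_conj_transvection_apply_left]
    refine and_congr_right fun h0 => ?_
    rw [add_div, mul_div_cancel_right₀ _ h0, sub_le_iff_le_add]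
  have hnull : ∀ t, AsympNull l μ φ (S (t - m) \ S t) := by
    intro t
    rw [← hconj]
    refine asympNull_conj_sdiff hφ hT htv hγ (hSm t) ?_
    rw [hconj]
    exact fun g hg => ⟨hg.1, by linarith [hg.2]⟩
  refine (AsympNull.biUnion (Finset.Icc (-7 : ℤ) 9) (S := fun a => S (a * m - m) \ S (a * m))
    fun a _ => hnull _).mono ?_
  rintro g ⟨h0, hR⟩
  have hr : |offset g i i / offset g j i / m| ≤ 8 := by
    rw [abs_div, abs_div, abs_of_pos hm, div_le_iff₀ hm, div_le_iff₀ (abs_pos.2 h0)]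
    exact hR
  set r := offset g i i / offset g j i / m with hrdef
  have hrm : offset g i i / offset g j i = r * m := by rw [hrdef, div_mul_cancel₀ _ hm.ne']
  have h8 := abs_le.1 hr
  refine Set.mem_biUnion (x := ⌊r⌋ + 1) ?_ ⟨⟨h0, ?_⟩, fun hg => ?_⟩
  · have h1 : (-8 : ℤ) ≤ ⌊r⌋ := Int.le_floor.2 (by simpa using h8.1)
    have h2 : ⌊r⌋ ≤ 8 := by
      exact_mod_cast (Int.floor_le r).trans h8.2
    simp only [Finset.coe_Icc, Set.mem_Icc]
    omega
  · rw [hrm]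
    push_cast
    have := mul_le_mul_of_nonneg_right (Int.floor_le r) hm.le
    linarith
  · have h3 := hg.2
    rw [hrm] at h3
    have h4 := le_of_mul_le_mul_right h3 hm
    push_cast at h4
    linarith [Int.lt_floor_add_one r]

theorem exists_transvection_mem_map (Γ₀ : Subgroup (SpecialLinearGroup (Fin n) ℤ))
    [Γ₀.FiniteIndex] : ∃ m : ℝ, 1 ≤ m ∧ ∀ (i j : Fin n) (hij : i ≠ j),
      SpecialLinearGroup.transvection hij m ∈
        Γ₀.map (SpecialLinearGroup.map (Int.castRingHom ℝ)) := by
  refine ⟨(Γ₀.index.factorial : ℕ), by exact_mod_cast Nat.factorial_pos _, fun i j hij => ?_⟩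
  refine ⟨_, Subgroup.pow_mem_of_index_ne_zero_of_dvd Subgroup.FiniteIndex.index_ne_zero
    (SpecialLinearGroup.transvection hij (1 : ℤ)) fun k hk hk' => Nat.dvd_factorial hk hk', ?_⟩
  have hmap : SpecialLinearGroup.map (Int.castRingHom ℝ)
      (SpecialLinearGroup.transvection hij (1 : ℤ)) =
        SpecialLinearGroup.transvection hij (1 : ℝ) := by
    refine Subtype.ext (Matrix.ext fun a b => ?_)
    change ((Matrix.transvection i j (1 : ℤ) a b : ℤ) : ℝ) = Matrix.transvection i j (1 : ℝ) a b
    simp only [Matrix.transvection, Matrix.add_apply, Matrix.one_apply, Matrix.single_apply]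
    push_cast
    rfl
  have hpow : ∀ k : ℕ, SpecialLinearGroup.transvection hij (1 : ℝ) ^ k =
      SpecialLinearGroup.transvection hij (k : ℝ) := by
    intro k
    induction k with
    | zero => simp [SpecialLinearGroup.transvection_coeff_zero]
    | succ k ih =>
      rw [pow_succ, ih]
      apply Subtype.ext
      change Matrix.transvection i j (k : ℝ) * Matrix.transvection i j 1 =
        Matrix.transvection i j ((k + 1 : ℕ) : ℝ)
      rw [Matrix.transvection_mul_transvection_same _ _ hij]
      push_cast
      rfl
  rw [map_pow, hmap, hpow]

end SpecialLinear

theorem rigidity_SLn_real (n : ℕ) (hn : 2 ≤ n)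
    (Λ : Subgroup (SpecialLinearGroup (Fin n) ℝ))
    (hΛcount : Countable Λ) (hΛdisc : DiscreteTopology Λ)
    -- Λ is a lattice: the quotient carries a G-invariant Borel probability measure
    (m : Measure (SpecialLinearGroup (Fin n) ℝ ⧸ Λ)) (hm : IsProbabilityMeasure m)
    (hminv : ∀ g : SpecialLinearGroup (Fin n) ℝ, Measure.map (fun z => g • z) m = m)
    -- Γ is the image of a finite index subgroup of SL_n(ℤ)
    (Γ₀ : Subgroup (SpecialLinearGroup (Fin n) ℤ)) (hΓ₀ : Γ₀.FiniteIndex)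
    (Γ : Subgroup (SpecialLinearGroup (Fin n) ℝ))
    (hΓ : Γ = Γ₀.map (SpecialLinearGroup.map (Int.castRingHom ℝ)))
    -- η is a Γ-invariant Borel probability measure on G/Λ
    (η : Measure (SpecialLinearGroup (Fin n) ℝ ⧸ Λ)) (hη : IsProbabilityMeasure η)
    (hηinv : ∀ γ ∈ Γ, Measure.map (fun z => γ • z) η = η)
    -- a sequence of Borel probability measures on (G/Λ) × (G/Λ)
    (ν : ℕ → Measure ((SpecialLinearGroup (Fin n) ℝ ⧸ Λ) × (SpecialLinearGroup (Fin n) ℝ ⧸ Λ)))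
    (hνprob : ∀ k, IsProbabilityMeasure (ν k))
    -- (1) both marginals equal η
    (h1 : ∀ k, (ν k).map Prod.fst = η ∧ (ν k).map Prod.snd = η)
    -- (2) the measures converge to the diagonal against products of bounded Borel functions
    (h2 : ∀ f g : (SpecialLinearGroup (Fin n) ℝ ⧸ Λ) → ℝ,
      Measurable f → Measurable g → (∃ C, ∀ z, |f z| ≤ C) → (∃ C, ∀ z, |g z| ≤ C) →
      Tendsto (fun k => ∫ p, f p.1 * g p.2 ∂(ν k)) atTop (𝓝 (∫ z, f z * g z ∂η)))
    -- (3) the measures are asymptotically invariant under the diagonal Γ-action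
    (h3 : ∀ γ ∈ Γ,
      Tendsto (fun k => tvDist ((ν k).map (Prod.map (fun z => γ • z) (fun z => γ • z))) (ν k))
        atTop (𝓝 0)) :
    Tendsto (fun k => ((ν k) (Set.diagonal (SpecialLinearGroup (Fin n) ℝ ⧸ Λ))).toReal)
      atTop (𝓝 1) := by
  subst hΓ
  have hdiag : ∀ A B, MeasurableSet A → MeasurableSet B →
      Tendsto (fun k => (ν k).real (A ×ˢ B)) atTop (𝓝 (η.real (A ∩ B))) := by
    intro A B hA hB
    have hbdd : ∀ C : Set (SpecialLinearGroup (Fin n) ℝ ⧸ Λ), ∃ c : ℝ, ∀ z,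
        |C.indicator (fun _ => (1 : ℝ)) z| ≤ c := by
      refine fun C => ⟨1, fun z => ?_⟩
      by_cases hz : z ∈ C <;> simp [hz]
    have h := h2 (A.indicator fun _ => 1) (B.indicator fun _ => 1)
      (measurable_const.indicator hA) (measurable_const.indicator hB) (hbdd A) (hbdd B)
    have e1 : ∀ z, A.indicator (fun _ => (1 : ℝ)) z * B.indicator (fun _ => 1) z =
        (A ∩ B).indicator 1 z := by
      intro z
      by_cases h1 : z ∈ A <;> by_cases h2 : z ∈ B <;> simp [h1, h2]
    have e2 : ∀ p : (SpecialLinearGroup (Fin n) ℝ ⧸ Λ) × (SpecialLinearGroup (Fin n) ℝ ⧸ Λ),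
        A.indicator (fun _ => (1 : ℝ)) p.1 * B.indicator (fun _ => 1) p.2 =
        (A ×ˢ B).indicator 1 p := by
      intro p
      by_cases h1 : p.1 ∈ A <;> by_cases h2 : p.2 ∈ B <;> simp [Set.indicator, h1, h2]
    simpa only [e1, e2, integral_indicator_one (hA.inter hB),
      integral_indicator_one (hA.prod hB)] using h
  obtain ⟨θ, hθm, hθU, hθγ⟩ := exists_displacement (fun k => (h1 k).1) hdiag
  obtain ⟨m, hm, hmΓ⟩ := exists_transvection_mem_map Γ₀
  obtain ⟨U, hU, hUg⟩ := exists_nhds_offDiagDominated n hm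
  have hsnd : Tendsto Prod.snd ((atTop : Filter ℕ).curry (atTop : Filter ℕ)) atTop := fun s hs =>
    eventually_curry_iff.2 (.of_forall fun _ => hs)
  have hT (γ : SpecialLinearGroup (Fin n) ℝ) :
      Measurable fun z : SpecialLinearGroup (Fin n) ℝ ⧸ Λ => γ • z := by
    rw [QuotientGroup.measurable_from_quotient]
    exact QuotientGroup.measurable_coe.comp (continuous_const_mul γ).measurable
  have hTm (γ : SpecialLinearGroup (Fin n) ℝ) :
      Measurable (Prod.map (fun z : SpecialLinearGroup (Fin n) ℝ ⧸ Λ => γ • z)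
        (fun z : SpecialLinearGroup (Fin n) ℝ ⧸ Λ => γ • z)) :=
    (hT γ).prodMap (hT γ)
  have htv := fun γ hγ => (h3 γ hγ).comp hsnd
  have hnull : ∀ (i j : Fin n) (hij : i ≠ j), AsympNull (atTop.curry atTop)
      (fun q : ℕ × ℕ => ν q.2) (fun q => θ q.1) (offDiagDominated (8 * m) i j) := by
    intro i j hij
    have hm0 : 0 < m := by linarith
    have h := asympNull_offDiagDominated (l := (atTop : Filter ℕ).curry (atTop : Filter ℕ))
      (μ := fun q : ℕ × ℕ => ν q.2) (φ := fun q => θ q.1) (fun q => hθm q.1)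
      (hTm (.transvection hij m)) (htv _ (hmΓ i j hij)) hij hm0
    exact h (hθγ _ (hηinv _ (hmΓ i j hij)))
  have hnull' : ∀ (i j : Fin n) (hij : i ≠ j), AsympNull (atTop.curry atTop)
      (fun q : ℕ × ℕ => ν q.2) (fun q => θ q.1)
      ((fun g => .transvection hij m * g * (.transvection hij m)⁻¹) ⁻¹'
        offDiagDominated (8 * m) j i) := by
    intro i j hij
    have h := AsympNull.conj (l := (atTop : Filter ℕ).curry (atTop : Filter ℕ))
      (μ := fun q : ℕ × ℕ => ν q.2) (φ := fun q => θ q.1) (S := offDiagDominated (8 * m) j i)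
      (fun q => hθm q.1) (hTm (.transvection hij m)) (htv _ (hmΓ i j hij))
      (hθγ _ (hηinv _ (hmΓ i j hij)))
    exact h (measurableSet_offDiagDominated _ _ _) (hnull j i hij.symm)
  have hbad : AsympNull (atTop.curry atTop) (fun q : ℕ × ℕ => ν q.2) (fun q => θ q.1)
      (U \ {1}) := by
    refine (AsympNull.biUnion (Finset.univ : Finset {x : Fin n × Fin n // x.1 ≠ x.2})
      fun x _ => (hnull _ _ x.2).union (hnull' _ _ x.2)).mono ?_
    rintro g ⟨hgU, hg1⟩
    obtain ⟨i, j, hij, h⟩ := hUg g hgU hg1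
    refine Set.mem_biUnion (x := ⟨(i, j), hij⟩) (Finset.mem_coe.2 (Finset.mem_univ _)) ?_
    exact h
  have hcurry : Tendsto (fun q : ℕ × ℕ =>
      (ν q.2).real (Set.diagonal (SpecialLinearGroup (Fin n) ℝ ⧸ Λ))ᶜ)
      (atTop.curry atTop) (𝓝 0) := by
    refine squeeze_zero (fun _ => measureReal_nonneg) (fun q => ?_)
      (by simpa using (hθU U hU).add hbad)
    refine le_trans (measureReal_mono fun p hp => ?_) (measureReal_union_le _ _)
    by_cases h : θ q.1 p ∈ U ∧ θ q.1 p • p.1 = p.2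
    · refine Or.inr ⟨h.1, fun h' => hp ?_⟩
      have e : θ q.1 p = 1 := h'
      have he := h.2
      rwa [e, one_smul] at he
    · exact Or.inl h
  rw [tendsto_order]
  refine ⟨fun a ha => ?_, fun a ha => .of_forall fun k => measureReal_le_one.trans_lt ha⟩
  have hev := (eventually_curry_iff.1 (hcurry.eventually_lt_const (sub_pos.2 ha))).exists
  filter_upwards [hev.choose_spec] with k hk
  have := measureReal_union_le (μ := ν k) (Set.diagonal (SpecialLinearGroup (Fin n) ℝ ⧸ Λ))
    (Set.diagonal (SpecialLinearGroup (Fin n) ℝ ⧸ Λ))ᶜ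
  rw [Set.union_compl_self, probReal_univ] at this
  change a < (ν k).real _
  linarith
end

section
/- Let G = SL_2(ℂ) (the special linear group of 2×2 complex matrices of determinant one, with its standard topology and Borel σ-algebra), and let Λ ≤ G be a countable discrete subgroup such that the quotient G/Λ by right translation carries a G-invariant Borel probability measure (i.e. Λ is a lattice). Let Γ ≤ G be the image of a finite-index subgroup of SL_2(ℤ[i]) (2×2 matrices over the Gaussian integers of determinant one) under the entrywise inclusion into SL_2(ℂ), acting on G/Λ by left translation, and let η be a Γ-invariant Borel probability measure on G/Λ. Then for every sequence (ν_k) of Borel probability measures on (G/Λ) × (G/Λ) satisfying: (1) both marginals of ν_k equal η for every k; (2) ∫ f(x) g(y) dν_k(x,y) → ∫ f g dη for all bounded Borel functions f, g : G/Λ → ℝ; (3) ‖(γ×γ)_*ν_k − ν_k‖ → 0 for every γ ∈ Γ; one has ν_k(Δ) → 1, where Δ is the diagonal of (G/Λ) × (G/Λ). -/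
open MeasureTheory Filter Topology Matrix

/-- `SL₂(ℂ)` inherits the standard topology from the space of matrices. -/
noncomputable instance SL2Ctop : TopologicalSpace (SpecialLinearGroup (Fin 2) ℂ) :=
  inferInstanceAs (TopologicalSpace {A : Matrix (Fin 2) (Fin 2) ℂ // A.det = 1})

/-- `SL₂(ℂ)` carries the Borel σ-algebra of its standard topology. -/
noncomputable instance SL2Cmeas : MeasurableSpace (SpecialLinearGroup (Fin 2) ℂ) :=
  borel _

instance SL2Cborel : BorelSpace (SpecialLinearGroup (Fin 2) ℂ) := ⟨rfl⟩

open scoped ENNReal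

namespace HomogeneousRigidity

section TotalVariation

variable {Z : Type*} [MeasurableSpace Z]

lemma abs_measureReal_sub_le_tvDist (μ ν : Measure Z) [IsProbabilityMeasure μ]
    [IsProbabilityMeasure ν] {A : Set Z} (hA : MeasurableSet A) :
    |μ.real A - ν.real A| ≤ tvDist μ ν := by
  have hbdd : BddAbove (Set.range fun A : {s : Set Z // MeasurableSet s} =>
      |(μ A.1).toReal - (ν A.1).toReal|) := by
    refine ⟨1, ?_⟩
    rintro _ ⟨B, rfl⟩
    have h1 : μ.real B.1 ≤ 1 := measureReal_le_one
    have h2 : ν.real B.1 ≤ 1 := measureReal_le_one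
    have h3 : 0 ≤ μ.real B.1 := measureReal_nonneg
    have h4 : 0 ≤ ν.real B.1 := measureReal_nonneg
    change |μ.real B.1 - ν.real B.1| ≤ 1
    rw [abs_le]
    constructor <;> linarith
  have hle := le_ciSup hbdd ⟨A, hA⟩
  have h0 : 0 ≤ |(μ A).toReal - (ν A).toReal| := abs_nonneg _
  rw [tvDist]
  simp only [measureReal_def] at hle ⊢
  linarith

/-- A set whose preimages under the maps `T 0, …, T (J - 1)` cover no point more than `c` times
has measure at most `c / J`, up to the defect of invariance. -/
lemma natCast_mul_measureReal_le (μ : Measure Z) [IsProbabilityMeasure μ] {T : ℕ → Z → Z}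
    (hT : ∀ j, Measurable (T j)) {A : Set Z} (hA : MeasurableSet A) {c J : ℕ}
    (hc : ∀ z, ∀ s ⊆ Finset.range J, (∀ j ∈ s, T j z ∈ A) → s.card ≤ c) {δ : ℝ}
    (hδ : ∀ j < J, |(μ.map (T j)).real A - μ.real A| ≤ δ) :
    J * μ.real A ≤ c + J * δ := by
  classical
  have hsum : ∑ j ∈ Finset.range J, μ.real (T j ⁻¹' A) ≤ c := by
    have hint : ∀ j ∈ Finset.range J,
        Integrable (fun z => (T j ⁻¹' A).indicator (1 : Z → ℝ) z) μ := fun j _ =>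
      (integrable_const (1 : ℝ)).indicator (hT j hA)
    calc ∑ j ∈ Finset.range J, μ.real (T j ⁻¹' A)
        = ∫ z, ∑ j ∈ Finset.range J, (T j ⁻¹' A).indicator (1 : Z → ℝ) z ∂μ := by
          rw [integral_finsetSum _ hint]
          exact Finset.sum_congr rfl fun j _ => (integral_indicator_one (hT j hA)).symm
      _ ≤ ∫ _, (c : ℝ) ∂μ := by
          refine integral_mono (integrable_finsetSum _ hint) (integrable_const _) fun z => ?_
          have hcard := hc z ((Finset.range J).filter fun j => T j z ∈ A)
            (Finset.filter_subset _ _) (by simp)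
          simp only [Set.indicator_apply, Set.mem_preimage, Pi.one_apply, Finset.sum_boole]
          exact_mod_cast hcard
      _ = c := by simp
  have hle : ∑ j ∈ Finset.range J, μ.real A ≤ ∑ j ∈ Finset.range J, (μ.real (T j ⁻¹' A) + δ) := by
    refine Finset.sum_le_sum fun j hj => ?_
    have h := hδ j (Finset.mem_range.1 hj)
    rw [map_measureReal_apply (hT j) hA, abs_le] at h
    linarith [h.1]
  rw [Finset.sum_add_distrib] at hle
  simp only [Finset.sum_const, Finset.card_range, nsmul_eq_mul] at hle
  linarith

end TotalVariation

section HomogeneousSpace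

variable {G : Type*} [Group G] {Λ : Subgroup G}

/-- The pairs `(z, g • z)` with `z` in the image of `C` and `g ∈ V`. -/
def translatePairs (Λ : Subgroup G) (C V : Set G) : Set ((G ⧸ Λ) × (G ⧸ Λ)) :=
  {p | p.1 ∈ ((↑) : G → G ⧸ Λ) '' C ∧ ∃ g ∈ V, p.2 = g • p.1}

lemma translatePairs_mono {C V W : Set G} (h : V ⊆ W) :
    translatePairs Λ C V ⊆ translatePairs Λ C W :=
  fun _ ⟨hz, g, hg, hp⟩ => ⟨hz, g, h hg, hp⟩

variable [TopologicalSpace G] [IsTopologicalGroup G]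

lemma isCompact_translatePairs {C V : Set G} (hC : IsCompact C) (hV : IsCompact V) :
    IsCompact (translatePairs Λ C V) := by
  have h : translatePairs Λ C V =
      (fun q : (G ⧸ Λ) × G => (q.1, q.2 • q.1)) '' ((((↑) : G → G ⧸ Λ) '' C) ×ˢ V) := by
    ext ⟨z, y⟩
    constructor
    · rintro ⟨hz, g, hg, h⟩
      exact ⟨(z, g), ⟨hz, hg⟩, Prod.ext rfl h.symm⟩
    · rintro ⟨⟨z', g⟩, ⟨hz, hg⟩, h⟩
      obtain ⟨rfl, rfl⟩ := Prod.mk.inj h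
      exact ⟨hz, g, hg, rfl⟩
  rw [h]
  exact ((hC.image QuotientGroup.continuous_mk).prod hV).image (by fun_prop)

/-- A discrete subgroup acts on the homogeneous space with no small stabilizers over a compact
set. -/
lemma eventually_smul_eq_imp_eq_one [T2Space G] [DiscreteTopology Λ] {C : Set G}
    (hC : IsCompact C) :
    ∀ᶠ w in 𝓝 (1 : G), ∀ h ∈ C, w • (h : G ⧸ Λ) = h → w = 1 := by
  refine hC.eventually_forall_of_forall_eventually fun h _ => ?_
  have hdisc : ∀ᶠ x in 𝓝 (1 : G), x ∈ Λ → x = 1 := by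
    have h1 : {(1 : Λ)} ∈ 𝓝 (1 : Λ) := by simp
    rw [nhds_subtype, mem_comap] at h1
    obtain ⟨t, ht, hts⟩ := h1
    filter_upwards [ht] with x hx hxΛ
    simpa using @hts ⟨x, hxΛ⟩ hx
  have hcont : Tendsto (fun z : G × G => z.2⁻¹ * z.1 * z.2) (𝓝 (1, h)) (𝓝 1) := by
    have : Continuous fun z : G × G => z.2⁻¹ * z.1 * z.2 := by fun_prop
    simpa using this.tendsto (1, h)
  filter_upwards [hcont.eventually hdisc] with z hz hfix
  have hmem : z.2⁻¹ * z.1 * z.2 ∈ Λ := by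
    rw [MulAction.Quotient.smul_coe, smul_eq_mul, eq_comm, QuotientGroup.eq, ← mul_assoc] at hfix
    exact hfix
  have h1 := hz hmem
  have h2 : z.1 = z.2 * (z.2⁻¹ * z.1 * z.2) * z.2⁻¹ := by group
  rw [h2, h1]
  group

/-- If conjugation by the `γ j` moves every nontrivial element near `1` into `S` for at most `c`
indices, then the diagonal action of the `γ j` moves every off-diagonal pair into
`translatePairs Λ C (V ∩ S)` for at most `c` of the indices `j < J`. -/
lemma exists_nhds_card_le [T2Space G] [DiscreteTopology Λ] {C S N : Set G} (hC : IsCompact C)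
    (hN : N ∈ 𝓝 1) (γ : ℕ → G) {c : ℕ}
    (hγ : ∀ g ∈ N, g ≠ 1 → ∀ s : Finset ℕ, (∀ j ∈ s, γ j * g * (γ j)⁻¹ ∈ S) → s.card ≤ c)
    (J : ℕ) :
    ∃ V ∈ 𝓝 (1 : G), ∀ p : (G ⧸ Λ) × (G ⧸ Λ), p.1 ≠ p.2 → ∀ s ⊆ Finset.range J,
      (∀ j ∈ s, (γ j • p.1, γ j • p.2) ∈ translatePairs Λ C (V ∩ S)) → s.card ≤ c := by
  have hinj : ∀ᶠ q : G × G in 𝓝 1 ×ˢ 𝓝 1, ∀ i ∈ Finset.range J, ∀ j ∈ Finset.range J,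
      ∀ h ∈ C, (q.1⁻¹ * (γ j * (γ i)⁻¹) * q.2 * (γ j * (γ i)⁻¹)⁻¹) • (h : G ⧸ Λ) = h →
        q.1⁻¹ * (γ j * (γ i)⁻¹) * q.2 * (γ j * (γ i)⁻¹)⁻¹ = 1 := by
    rw [Finset.eventually_all]
    intro i _
    rw [Finset.eventually_all]
    intro j _
    have hcont : Continuous fun q : G × G =>
      q.1⁻¹ * (γ j * (γ i)⁻¹) * q.2 * (γ j * (γ i)⁻¹)⁻¹ := by fun_prop
    have ht := hcont.tendsto (1, 1)
    rw [nhds_prod_eq] at ht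
    refine (ht.mono_right (le_of_eq ?_)).eventually (eventually_smul_eq_imp_eq_one hC)
    congr 1
    group
  have hconj : ∀ᶠ g in 𝓝 (1 : G), ∀ i ∈ Finset.range J, (γ i)⁻¹ * g * γ i ∈ N := by
    rw [Finset.eventually_all]
    intro i _
    have hcont : Continuous fun g : G => (γ i)⁻¹ * g * γ i := by fun_prop
    have ht := hcont.tendsto 1
    simp only [mul_one, inv_mul_cancel] at ht
    exact ht hN
  obtain ⟨t, ht, hts⟩ := eventually_prod_self_iff'.1 hinj
  refine ⟨t ∩ _, inter_mem ht hconj, ?_⟩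
  rintro ⟨z, y⟩ hzy s hs hmem
  obtain rfl | ⟨i, hi⟩ := s.eq_empty_or_nonempty
  · simp
  obtain ⟨-, g, ⟨⟨hgt, hgN⟩, hgS⟩, hy⟩ := hmem i hi
  simp only at hy hzy
  have hy' : y = ((γ i)⁻¹ * g * γ i) • z := by
    rw [mul_smul, mul_smul, ← hy, inv_smul_smul]
  refine hγ ((γ i)⁻¹ * g * γ i) (hgN i (hs hi)) ?_ s fun j hj => ?_
  · intro h1
    rw [h1, one_smul] at hy'
    exact hzy hy'.symm
  obtain ⟨⟨h, hhC, hh⟩, g', ⟨⟨hgt', -⟩, hgS'⟩, hyj⟩ := hmem j hj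
  simp only at hh hyj
  have hone := hts g' hgt' g hgt i (hs hi) j (hs hj) h hhC (by
    rw [hh, smul_smul, eq_comm, ← smul_left_cancel_iff g', ← hyj, hy', smul_smul, smul_smul]
    congr 1
    group)
  have : γ j * ((γ i)⁻¹ * g * γ i) * (γ j)⁻¹ = g' := by
    rw [mul_assoc, mul_assoc, inv_mul_eq_one] at hone
    change g' = _ at hone
    rw [hone]
    group
  rwa [this]

variable [MeasurableSpace G] [BorelSpace G]

instance opensMeasurableSpace_quotient : OpensMeasurableSpace (G ⧸ Λ) where
  borel_le := MeasurableSpace.generateFrom_le fun _ hU =>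
    measurableSet_quotient.2 (hU.preimage QuotientGroup.continuous_mk).measurableSet

lemma measurable_quotient_smul (γ : G) : Measurable fun z : G ⧸ Λ => γ • z :=
  QuotientGroup.measurable_from_quotient.2
    (QuotientGroup.measurable_coe.comp (measurable_const_mul γ))

lemma exists_isCompact_measure_compl_le [T2Space G] [SigmaCompactSpace G] [DiscreteTopology Λ]
    (η : Measure (G ⧸ Λ)) [IsFiniteMeasure η] {ε : ℝ≥0∞} (hε : 0 < ε) :
    ∃ C : Set G, IsCompact C ∧ MeasurableSet (((↑) : G → G ⧸ Λ) '' C) ∧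
      η (((↑) : G → G ⧸ Λ) '' C)ᶜ ≤ ε := by
  have hmeas : ∀ n, MeasurableSet (((↑) : G → G ⧸ Λ) '' compactCovering G n) := fun n =>
    ((isCompact_compactCovering G n).image QuotientGroup.continuous_mk).isClosed.measurableSet
  have hlim := tendsto_measure_iInter_atTop (μ := η)
    (s := fun n => (((↑) : G → G ⧸ Λ) '' compactCovering G n)ᶜ)
    (fun n => (hmeas n).compl.nullMeasurableSet)
    (fun m n hmn => Set.compl_subset_compl.2 (Set.image_mono (compactCovering_subset G hmn)))
    ⟨0, measure_ne_top _ _⟩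
  have hempty : ⋂ n, (((↑) : G → G ⧸ Λ) '' compactCovering G n)ᶜ = ∅ := by
    rw [← Set.compl_iUnion, ← Set.image_iUnion, iUnion_compactCovering, Set.image_univ,
      QuotientGroup.range_mk, Set.compl_univ]
  rw [hempty, measure_empty] at hlim
  obtain ⟨n, hn⟩ := (hlim.eventually (Iic_mem_nhds hε)).exists
  exact ⟨_, isCompact_compactCovering G n, hmeas n, hn⟩

/-- Measures converging to the diagonal measure on products of bounded Borel functions
concentrate on pairs of nearby points over every compact set. -/
lemma tendsto_measure_not_near {η : Measure (G ⧸ Λ)}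
    {ν : ℕ → Measure ((G ⧸ Λ) × (G ⧸ Λ))} (hν : ∀ k, IsProbabilityMeasure (ν k))
    (h2 : ∀ f g : (G ⧸ Λ) → ℝ, Measurable f → Measurable g →
      (∃ C, ∀ z, |f z| ≤ C) → (∃ C, ∀ z, |g z| ≤ C) →
      Tendsto (fun k => ∫ p, f p.1 * g p.2 ∂(ν k)) atTop (𝓝 (∫ z, f z * g z ∂η)))
    {C V : Set G} (hC : IsCompact C) (hV : V ∈ 𝓝 1) :
    Tendsto (fun k => ν k {p | p.1 ∈ ((↑) : G → G ⧸ Λ) '' C ∧ ¬ ∃ g ∈ V, p.2 = g • p.1})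
      atTop (𝓝 0) := by
  refine hC.induction_on
    (p := fun C => Tendsto (fun k => ν k {p | p.1 ∈ ((↑) : G → G ⧸ Λ) '' C ∧
      ¬ ∃ g ∈ V, p.2 = g • p.1}) atTop (𝓝 0)) ?_ ?_ ?_ ?_
  · simp
  · intro s t hst ht
    refine tendsto_of_tendsto_of_tendsto_of_le_of_le tendsto_const_nhds ht (fun _ => zero_le)
      fun k => measure_mono ?_
    rintro p ⟨hp, hp'⟩
    exact ⟨Set.image_mono hst hp, hp'⟩
  · intro s t hs ht
    have hst := hs.add ht
    rw [add_zero] at hst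
    refine tendsto_of_tendsto_of_tendsto_of_le_of_le tendsto_const_nhds hst (fun _ => zero_le)
      fun k => (measure_mono ?_).trans (measure_union_le _ _)
    rintro p ⟨hp, hp'⟩
    rw [Set.image_union] at hp
    exact hp.imp (fun h => ⟨h, hp'⟩) (fun h => ⟨h, hp'⟩)
  · intro h _
    have hdiv : Tendsto (fun q : G × G => q.2 * q.1⁻¹) (𝓝 h ×ˢ 𝓝 h) (𝓝 1) := by
      have : Continuous fun q : G × G => q.2 * q.1⁻¹ := by fun_prop
      simpa [nhds_prod_eq] using this.tendsto (h, h)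
    obtain ⟨t, ht, hts⟩ := eventually_prod_self_iff'.1 (hdiv.eventually hV)
    obtain ⟨U, hUt, hU, hhU⟩ := mem_nhds_iff.1 ht
    refine ⟨U, mem_nhdsWithin_of_mem_nhds (hU.mem_nhds hhU), ?_⟩
    set P : Set (G ⧸ Λ) := ((↑) : G → G ⧸ Λ) '' U with hP
    have hPm : MeasurableSet P := (QuotientGroup.isOpenMap_coe U hU).measurableSet
    have hb : ∀ s : Set (G ⧸ Λ), ∃ C : ℝ, ∀ z, |s.indicator (1 : (G ⧸ Λ) → ℝ) z| ≤ C :=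
      fun s => ⟨1, fun z => by by_cases hz : z ∈ s <;> simp [hz]⟩
    have hlim := h2 (P.indicator 1) (Pᶜ.indicator 1) (measurable_one.indicator hPm)
      (measurable_one.indicator hPm.compl) (hb _) (hb _)
    have hzero : ∫ z, P.indicator (1 : (G ⧸ Λ) → ℝ) z * Pᶜ.indicator (1 : (G ⧸ Λ) → ℝ) z ∂η
        = 0 := by
      have : ∀ z, P.indicator (1 : (G ⧸ Λ) → ℝ) z * Pᶜ.indicator (1 : (G ⧸ Λ) → ℝ) z = 0 :=
        fun z => by by_cases hz : z ∈ P <;> simp [hz]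
      simp [this]
    have hprod : ∀ k, ∫ p, P.indicator (1 : (G ⧸ Λ) → ℝ) p.1 *
        Pᶜ.indicator (1 : (G ⧸ Λ) → ℝ) p.2 ∂(ν k) = (ν k).real (P ×ˢ Pᶜ) := fun k => by
      rw [← integral_indicator_one (hPm.prod hPm.compl)]
      congr 1
      ext p
      by_cases h1 : p.1 ∈ P <;> by_cases h2 : p.2 ∈ P <;> simp [h1, h2]
    rw [hzero] at hlim
    simp only [hprod] at hlim
    have hlim' : Tendsto (fun k => ν k (P ×ˢ Pᶜ)) atTop (𝓝 0) := by
      have := ENNReal.tendsto_ofReal hlim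
      simpa [measureReal_def] using this
    refine tendsto_of_tendsto_of_tendsto_of_le_of_le tendsto_const_nhds hlim' (fun _ => zero_le)
      fun k => measure_mono ?_
    rintro ⟨z, y⟩ ⟨hz, hy⟩
    refine ⟨hz, fun hyP => hy ?_⟩
    obtain ⟨a, haU, rfl⟩ := hz
    obtain ⟨b, hbU, rfl⟩ := hyP
    refine ⟨b * a⁻¹, hts a (hUt haU) b (hUt hbU), ?_⟩
    simp

variable [T2Space G] [LocallyCompactSpace G] [SecondCountableTopology G]
  [DiscreteTopology Λ]

/-- Asymptotically invariant measures give asymptotically no mass to off-diagonal pairs whose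
small displacement lies in a closed set that conjugation displaces. -/
lemma exists_nhds_eventually_measure_le {ν : ℕ → Measure ((G ⧸ Λ) × (G ⧸ Λ))}
    (hν : ∀ k, IsProbabilityMeasure (ν k)) (γ : ℕ → G)
    (h3 : ∀ j, Tendsto (fun k => tvDist ((ν k).map (Prod.map (fun z => γ j • z)
      (fun z => γ j • z))) (ν k)) atTop (𝓝 0))
    {C S N : Set G} (hC : IsCompact C) (hS : IsClosed S) (hN : N ∈ 𝓝 1) {c : ℕ}
    (hγ : ∀ g ∈ N, g ≠ 1 → ∀ s : Finset ℕ, (∀ j ∈ s, γ j * g * (γ j)⁻¹ ∈ S) → s.card ≤ c)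
    {ε : ℝ} (hε : 0 < ε) :
    ∃ V ∈ 𝓝 (1 : G), ∀ᶠ k in atTop,
      ν k (translatePairs Λ C (V ∩ S) \ Set.diagonal (G ⧸ Λ)) ≤ ENNReal.ofReal ε := by
  obtain ⟨J, hJ⟩ := exists_nat_gt (2 * c / ε)
  have hJ0 : (0 : ℝ) < J := lt_of_le_of_lt (by positivity) hJ
  obtain ⟨V₀, hV₀, hcard⟩ := exists_nhds_card_le (Λ := Λ) hC hN γ hγ J
  obtain ⟨V, hV, hVV₀, hVc⟩ := local_compact_nhds hV₀
  refine ⟨V, hV, ?_⟩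
  have hA : MeasurableSet (translatePairs Λ C (V ∩ S) \ Set.diagonal (G ⧸ Λ)) :=
    (isCompact_translatePairs hC (hVc.inter_right hS)).isClosed.measurableSet.diff
      isClosed_diagonal.measurableSet
  have hT : ∀ j, Measurable (Prod.map (fun z : G ⧸ Λ => γ j • z) (fun z : G ⧸ Λ => γ j • z)) :=
    fun j => (measurable_quotient_smul _).prodMap (measurable_quotient_smul _)
  have hsmall : ∀ᶠ k in atTop, ∀ j ∈ Finset.range J, tvDist ((ν k).map (Prod.map
      (fun z => γ j • z) (fun z => γ j • z))) (ν k) ≤ ε / 2 := by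
    rw [Finset.eventually_all]
    exact fun j _ => (h3 j).eventually (Iic_mem_nhds (by positivity))
  filter_upwards [hsmall] with k hk
  have hle := natCast_mul_measureReal_le (ν k) hT hA (c := c) (J := J) (δ := ε / 2) ?_ ?_
  · rw [← ofReal_measureReal]
    refine ENNReal.ofReal_le_ofReal ?_
    rw [div_lt_iff₀ hε] at hJ
    nlinarith
  · intro p s hs hmem
    obtain rfl | ⟨i, hi⟩ := s.eq_empty_or_nonempty
    · simp
    refine hcard p (fun h => (hmem i hi).2 ?_) s hs fun j hj =>
      translatePairs_mono (Set.inter_subset_inter_left _ hVV₀) (hmem j hj).1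
    simp [h]
  · intro j hj
    have := Measure.isProbabilityMeasure_map (μ := ν k) (hT j).aemeasurable
    exact (abs_measureReal_sub_le_tvDist _ _ hA).trans (hk j (Finset.mem_range.2 hj))

/-- Rigidity criterion: if `G` is the union of two closed sets, each displaced by conjugation by
a sequence in the acting group, then measures that converge to the diagonal measure and are
asymptotically invariant concentrate on the diagonal. -/
theorem tendsto_measure_diagonal [SigmaCompactSpace G] {η : Measure (G ⧸ Λ)}
    [IsProbabilityMeasure η]
    {ν : ℕ → Measure ((G ⧸ Λ) × (G ⧸ Λ))} (hν : ∀ k, IsProbabilityMeasure (ν k))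
    (h1 : ∀ k, (ν k).map Prod.fst = η)
    (h2 : ∀ f g : (G ⧸ Λ) → ℝ, Measurable f → Measurable g →
      (∃ C, ∀ z, |f z| ≤ C) → (∃ C, ∀ z, |g z| ≤ C) →
      Tendsto (fun k => ∫ p, f p.1 * g p.2 ∂(ν k)) atTop (𝓝 (∫ z, f z * g z ∂η)))
    {S S' N : Set G} (hS : IsClosed S) (hS' : IsClosed S') (hSS' : S ∪ S' = Set.univ)
    (hN : N ∈ 𝓝 1) (γ γ' : ℕ → G)
    (h3 : ∀ j, Tendsto (fun k => tvDist ((ν k).map (Prod.map (fun z => γ j • z)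
      (fun z => γ j • z))) (ν k)) atTop (𝓝 0))
    (h3' : ∀ j, Tendsto (fun k => tvDist ((ν k).map (Prod.map (fun z => γ' j • z)
      (fun z => γ' j • z))) (ν k)) atTop (𝓝 0))
    {c : ℕ}
    (hγ : ∀ g ∈ N, g ≠ 1 → ∀ s : Finset ℕ, (∀ j ∈ s, γ j * g * (γ j)⁻¹ ∈ S) → s.card ≤ c)
    (hγ' : ∀ g ∈ N, g ≠ 1 → ∀ s : Finset ℕ, (∀ j ∈ s, γ' j * g * (γ' j)⁻¹ ∈ S') → s.card ≤ c) :
    Tendsto (fun k => (ν k (Set.diagonal (G ⧸ Λ))).toReal) atTop (𝓝 1) := by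
  suffices hcompl : Tendsto (fun k => (ν k).real (Set.diagonal (G ⧸ Λ))ᶜ) atTop (𝓝 0) by
    have hlim := (tendsto_const_nhds (x := (1 : ℝ))).sub hcompl
    rw [sub_zero] at hlim
    refine hlim.congr fun k => ?_
    rw [probReal_compl_eq_one_sub isClosed_diagonal.measurableSet, sub_sub_cancel, measureReal_def]
  rw [tendsto_order]
  refine ⟨fun a ha => Eventually.of_forall fun k => ha.trans_le measureReal_nonneg, fun ε hε => ?_⟩
  have hε5 : 0 < ε / 5 := by positivity
  obtain ⟨C, hC, hCm, hηC⟩ := exists_isCompact_measure_compl_le η (ENNReal.ofReal_pos.2 hε5)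
  obtain ⟨V, hV, hνV⟩ := exists_nhds_eventually_measure_le hν γ h3 hC hS hN hγ hε5
  obtain ⟨V', hV', hνV'⟩ := exists_nhds_eventually_measure_le hν γ' h3' hC hS' hN hγ' hε5
  have hnear := (tendsto_measure_not_near hν h2 hC (inter_mem hV hV')).eventually
    (Iic_mem_nhds (ENNReal.ofReal_pos.2 hε5))
  filter_upwards [hνV, hνV', hnear] with k hk hk' hk''
  have hfst : ν k (Prod.fst ⁻¹' (((↑) : G → G ⧸ Λ) '' C)ᶜ) ≤ ENNReal.ofReal (ε / 5) := by
    rwa [← Measure.map_apply measurable_fst hCm.compl, h1]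
  have hcover : (Set.diagonal (G ⧸ Λ))ᶜ ⊆
      Prod.fst ⁻¹' (((↑) : G → G ⧸ Λ) '' C)ᶜ ∪
      {p | p.1 ∈ ((↑) : G → G ⧸ Λ) '' C ∧ ¬ ∃ g ∈ V ∩ V', p.2 = g • p.1} ∪
      (translatePairs Λ C (V ∩ S) \ Set.diagonal (G ⧸ Λ)) ∪
      (translatePairs Λ C (V' ∩ S') \ Set.diagonal (G ⧸ Λ)) := by
    intro p hp
    by_cases hpC : p.1 ∈ ((↑) : G → G ⧸ Λ) '' C
    · by_cases hpV : ∃ g ∈ V ∩ V', p.2 = g • p.1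
      · obtain ⟨g, ⟨hgV, hgV'⟩, hg⟩ := hpV
        rcases (hSS' ▸ Set.mem_univ g : g ∈ S ∪ S') with hgS | hgS
        · exact Or.inl (Or.inr ⟨⟨hpC, g, ⟨hgV, hgS⟩, hg⟩, hp⟩)
        · exact Or.inr ⟨⟨hpC, g, ⟨hgV', hgS⟩, hg⟩, hp⟩
      · exact Or.inl (Or.inl (Or.inr ⟨hpC, hpV⟩))
    · exact Or.inl (Or.inl (Or.inl hpC))
  have htotal : ν k (Set.diagonal (G ⧸ Λ))ᶜ ≤ ENNReal.ofReal (ε / 5 + ε / 5 + ε / 5 + ε / 5) := by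
    rw [ENNReal.ofReal_add (by positivity) hε5.le, ENNReal.ofReal_add (by positivity) hε5.le,
      ENNReal.ofReal_add hε5.le hε5.le]
    exact (measure_mono hcover).trans <| (measure_union_le _ _).trans <|
      add_le_add ((measure_union_le _ _).trans <|
        add_le_add ((measure_union_le _ _).trans <| add_le_add hfst hk'') hk) hk'
  have hreal : (ν k).real (Set.diagonal (G ⧸ Λ))ᶜ ≤ ε / 5 + ε / 5 + ε / 5 + ε / 5 :=
    ENNReal.toReal_le_of_le_ofReal (by positivity) htotal
  linarith

end HomogeneousSpace

section SpecialLinearGroup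

instance : IsTopologicalGroup (SpecialLinearGroup (Fin 2) ℂ) :=
  SpecialLinearGroup.topologicalGroup

lemma isClosedEmbedding_coe :
    IsClosedEmbedding ((↑) : SpecialLinearGroup (Fin 2) ℂ → Matrix (Fin 2) (Fin 2) ℂ) :=
  SpecialLinearGroup.isClosedEmbedding_val

instance : T2Space (SpecialLinearGroup (Fin 2) ℂ) := isClosedEmbedding_coe.isEmbedding.t2Space

instance : SecondCountableTopology (SpecialLinearGroup (Fin 2) ℂ) :=
  have : SecondCountableTopology (Matrix (Fin 2) (Fin 2) ℂ) :=
    inferInstanceAs (SecondCountableTopology (Fin 2 → Fin 2 → ℂ))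
  isClosedEmbedding_coe.isEmbedding.isInducing.secondCountableTopology

instance : LocallyCompactSpace (SpecialLinearGroup (Fin 2) ℂ) :=
  have : LocallyCompactSpace (Matrix (Fin 2) (Fin 2) ℂ) :=
    inferInstanceAs (LocallyCompactSpace (Fin 2 → Fin 2 → ℂ))
  isClosedEmbedding_coe.locallyCompactSpace

lemma continuous_entry (i j : Fin 2) :
    Continuous fun g : SpecialLinearGroup (Fin 2) ℂ => g i j :=
  isClosedEmbedding_coe.continuous.matrix_elem i j

variable {R : Type*} [CommRing R]

/-- The upper triangular unipotent matrix with off-diagonal entry `t`. -/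
def upperUnipotent (t : R) : SpecialLinearGroup (Fin 2) R :=
  ⟨!![1, t; 0, 1], by simp⟩

/-- The lower triangular unipotent matrix with off-diagonal entry `t`. -/
def lowerUnipotent (t : R) : SpecialLinearGroup (Fin 2) R :=
  ⟨!![1, 0; t, 1], by simp⟩

@[simp]
lemma coe_upperUnipotent (t : R) :
    (upperUnipotent t : Matrix (Fin 2) (Fin 2) R) = !![1, t; 0, 1] :=
  rfl

lemma upperUnipotent_mul (s t : R) :
    upperUnipotent s * upperUnipotent t = upperUnipotent (s + t) := by
  ext i j
  fin_cases i <;> fin_cases j <;> simp [add_comm]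

@[simp]
lemma coe_lowerUnipotent (t : R) :
    (lowerUnipotent t : Matrix (Fin 2) (Fin 2) R) = !![1, 0; t, 1] :=
  rfl

lemma lowerUnipotent_mul (s t : R) :
    lowerUnipotent s * lowerUnipotent t = lowerUnipotent (s + t) := by
  ext i j
  fin_cases i <;> fin_cases j <;> simp

lemma upperUnipotent_pow (t : R) (n : ℕ) : upperUnipotent t ^ n = upperUnipotent (n * t) := by
  induction n with
  | zero => ext i j; fin_cases i <;> fin_cases j <;> simp
  | succ n ih => rw [pow_succ, ih, upperUnipotent_mul]; push_cast; ring_nf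

lemma lowerUnipotent_pow (t : R) (n : ℕ) : lowerUnipotent t ^ n = lowerUnipotent (n * t) := by
  induction n with
  | zero => ext i j; fin_cases i <;> fin_cases j <;> simp
  | succ n ih => rw [pow_succ, ih, lowerUnipotent_mul]; push_cast; ring_nf

lemma map_upperUnipotent {R' : Type*} [CommRing R'] (f : R →+* R') (t : R) :
    SpecialLinearGroup.map f (upperUnipotent t) = upperUnipotent (f t) := by
  ext i j
  fin_cases i <;> fin_cases j <;> simp

lemma map_lowerUnipotent {R' : Type*} [CommRing R'] (f : R →+* R') (t : R) :
    SpecialLinearGroup.map f (lowerUnipotent t) = lowerUnipotent (f t) := by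
  ext i j
  fin_cases i <;> fin_cases j <;> simp

lemma upperUnipotent_conj_zero_one (g : SpecialLinearGroup (Fin 2) R) (t : R) :
    (upperUnipotent t * g * (upperUnipotent t)⁻¹) 0 1 =
      g 0 1 + t * (g 1 1 - g 0 0) - t ^ 2 * g 1 0 := by
  simp only [Matrix.SpecialLinearGroup.coe_mul, Matrix.SpecialLinearGroup.coe_inv,
    coe_upperUnipotent, adjugate_fin_two, Matrix.mul_apply, Fin.sum_univ_two]
  simp
  ring

lemma upperUnipotent_conj_one_zero (g : SpecialLinearGroup (Fin 2) R) (t : R) :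
    (upperUnipotent t * g * (upperUnipotent t)⁻¹) 1 0 = g 1 0 := by
  simp only [Matrix.SpecialLinearGroup.coe_mul, Matrix.SpecialLinearGroup.coe_inv,
    coe_upperUnipotent, adjugate_fin_two, Matrix.mul_apply, Fin.sum_univ_two]
  simp

lemma lowerUnipotent_conj_one_zero (g : SpecialLinearGroup (Fin 2) R) (t : R) :
    (lowerUnipotent t * g * (lowerUnipotent t)⁻¹) 1 0 =
      g 1 0 + t * (g 0 0 - g 1 1) - t ^ 2 * g 0 1 := by
  simp only [Matrix.SpecialLinearGroup.coe_mul, Matrix.SpecialLinearGroup.coe_inv,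
    coe_lowerUnipotent, adjugate_fin_two, Matrix.mul_apply, Fin.sum_univ_two]
  simp
  ring

lemma lowerUnipotent_conj_zero_one (g : SpecialLinearGroup (Fin 2) R) (t : R) :
    (lowerUnipotent t * g * (lowerUnipotent t)⁻¹) 0 1 = g 0 1 := by
  simp only [Matrix.SpecialLinearGroup.coe_mul, Matrix.SpecialLinearGroup.coe_inv,
    coe_lowerUnipotent, adjugate_fin_two, Matrix.mul_apply, Fin.sum_univ_two]
  simp

/-- A quadratic polynomial is bounded by its leading coefficient at no three points that
are `5`-separated, unless it vanishes. -/
lemma quadratic_eq_zero_of_norm_le {p q r x y z : ℂ} (hxy : 5 ≤ ‖x - y‖) (hxz : 5 ≤ ‖x - z‖)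
    (hyz : 5 ≤ ‖y - z‖) (hx : ‖p + x * q - x ^ 2 * r‖ ≤ ‖r‖)
    (hy : ‖p + y * q - y ^ 2 * r‖ ≤ ‖r‖) (hz : ‖p + z * q - z ^ 2 * r‖ ≤ ‖r‖) :
    p = 0 ∧ q = 0 ∧ r = 0 := by
  have hslope : ∀ w : ℂ, 5 ≤ ‖x - w‖ → ‖p + w * q - w ^ 2 * r‖ ≤ ‖r‖ →
      5 * ‖q - (x + w) * r‖ ≤ 2 * ‖r‖ := fun w hxw hw => by
    have h1 : (p + x * q - x ^ 2 * r) - (p + w * q - w ^ 2 * r) =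
        (x - w) * (q - (x + w) * r) := by ring
    have h2 := norm_sub_le (p + x * q - x ^ 2 * r) (p + w * q - w ^ 2 * r)
    rw [h1, norm_mul] at h2
    nlinarith [norm_nonneg (q - (x + w) * r)]
  have h1 := hslope y hxy hy
  have h2 := hslope z hxz hz
  have h3 := norm_sub_le (q - (x + z) * r) (q - (x + y) * r)
  have h4 : (q - (x + z) * r) - (q - (x + y) * r) = (y - z) * r := by ring
  rw [h4, norm_mul] at h3
  have hr : r = 0 := by
    rw [← norm_le_zero_iff]
    nlinarith [norm_nonneg r]
  subst hr
  have hq : q = 0 := by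
    rw [← norm_le_zero_iff]
    simp only [norm_zero, mul_zero, sub_zero] at h1
    linarith
  subst hq
  simpa using hx

lemma five_le_norm_sub {n : ℕ} (hn : 0 < n) {i j : ℕ} (hij : i ≠ j) :
    5 ≤ ‖((5 * j * n : ℕ) : ℂ) - ((5 * i * n : ℕ) : ℂ)‖ := by
  have h1 : ((5 * j * n : ℕ) : ℂ) - ((5 * i * n : ℕ) : ℂ) = ((5 * n * ((j : ℤ) - i) : ℤ) : ℂ) := by
    push_cast
    ring
  rw [h1, Complex.norm_intCast]
  have h2 : 1 ≤ |(j : ℤ) - i| := Int.one_le_abs (by omega)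
  have h3 : (5 : ℤ) ≤ |5 * n * ((j : ℤ) - i)| := by
    rw [abs_mul, abs_of_nonneg (by positivity)]
    have : (1 : ℤ) ≤ n := by exact_mod_cast hn
    nlinarith
  exact_mod_cast h3

lemma eq_one_of_scalar {g : SpecialLinearGroup (Fin 2) ℂ} (hg : g 0 0 ≠ -1)
    (h01 : g 0 1 = 0) (h10 : g 1 0 = 0) (hdiag : g 0 0 = g 1 1) : g = 1 := by
  have hdet := g.det_coe
  rw [det_fin_two, h01, ← hdiag] at hdet
  have h00 : g 0 0 = 1 := by
    have : (g 0 0 - 1) * (g 0 0 + 1) = 0 := by linear_combination hdet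
    rcases mul_eq_zero.1 this with h | h
    · exact sub_eq_zero.1 h
    · exact absurd (eq_neg_of_add_eq_zero_left h) hg
  ext i j
  fin_cases i <;> fin_cases j <;> simp [h01, h10, h00, ← hdiag]

lemma card_le_two_of_upperUnipotent_conj {n : ℕ} (hn : 0 < n)
    {g : SpecialLinearGroup (Fin 2) ℂ} (hg : g 0 0 ≠ -1) (hg1 : g ≠ 1) (s : Finset ℕ)
    (hs : ∀ j ∈ s, upperUnipotent ((5 * j * n : ℕ) : ℂ) * g *
      (upperUnipotent ((5 * j * n : ℕ) : ℂ))⁻¹ ∈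
        {g : SpecialLinearGroup (Fin 2) ℂ | ‖g 0 1‖ ≤ ‖g 1 0‖}) : s.card ≤ 2 := by
  by_contra! hcard
  obtain ⟨i, hi, j, hj, k, hk, hij, hik, hjk⟩ := Finset.two_lt_card.1 hcard
  simp only [Set.mem_ofPred_eq, upperUnipotent_conj_zero_one, upperUnipotent_conj_one_zero] at hs
  obtain ⟨h01, hq, h10⟩ := quadratic_eq_zero_of_norm_le (five_le_norm_sub hn hij.symm)
    (five_le_norm_sub hn hik.symm) (five_le_norm_sub hn hjk.symm) (hs i hi) (hs j hj) (hs k hk)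
  exact hg1 (eq_one_of_scalar hg h01 h10 (sub_eq_zero.1 hq).symm)

lemma card_le_two_of_lowerUnipotent_conj {n : ℕ} (hn : 0 < n)
    {g : SpecialLinearGroup (Fin 2) ℂ} (hg : g 0 0 ≠ -1) (hg1 : g ≠ 1) (s : Finset ℕ)
    (hs : ∀ j ∈ s, lowerUnipotent ((5 * j * n : ℕ) : ℂ) * g *
      (lowerUnipotent ((5 * j * n : ℕ) : ℂ))⁻¹ ∈
        {g : SpecialLinearGroup (Fin 2) ℂ | ‖g 1 0‖ ≤ ‖g 0 1‖}) : s.card ≤ 2 := by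
  by_contra! hcard
  obtain ⟨i, hi, j, hj, k, hk, hij, hik, hjk⟩ := Finset.two_lt_card.1 hcard
  simp only [Set.mem_ofPred_eq, lowerUnipotent_conj_zero_one, lowerUnipotent_conj_one_zero] at hs
  obtain ⟨h10, hq, h01⟩ := quadratic_eq_zero_of_norm_le (five_le_norm_sub hn hij.symm)
    (five_le_norm_sub hn hik.symm) (five_le_norm_sub hn hjk.symm) (hs i hi) (hs j hj) (hs k hk)
  exact hg1 (eq_one_of_scalar hg h01 h10 (sub_eq_zero.1 hq))

lemma exists_upperUnipotent_mem_map {Γ₀ : Subgroup (SpecialLinearGroup (Fin 2) GaussianInt)}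
    (hΓ₀ : Γ₀.FiniteIndex) :
    ∃ n : ℕ, 0 < n ∧ ∀ j : ℕ, upperUnipotent ((5 * j * n : ℕ) : ℂ) ∈
      Γ₀.map (SpecialLinearGroup.map GaussianInt.toComplex) := by
  obtain ⟨n, hn, -, hmem⟩ :=
    Subgroup.exists_pow_mem_of_index_ne_zero hΓ₀.index_ne_zero (upperUnipotent 1)
  refine ⟨n, hn, fun j => ⟨_, Γ₀.pow_mem hmem (5 * j), ?_⟩⟩
  rw [upperUnipotent_pow, upperUnipotent_pow, map_upperUnipotent]
  simp [map_ofNat]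

lemma exists_lowerUnipotent_mem_map {Γ₀ : Subgroup (SpecialLinearGroup (Fin 2) GaussianInt)}
    (hΓ₀ : Γ₀.FiniteIndex) :
    ∃ n : ℕ, 0 < n ∧ ∀ j : ℕ, lowerUnipotent ((5 * j * n : ℕ) : ℂ) ∈
      Γ₀.map (SpecialLinearGroup.map GaussianInt.toComplex) := by
  obtain ⟨n, hn, -, hmem⟩ :=
    Subgroup.exists_pow_mem_of_index_ne_zero hΓ₀.index_ne_zero (lowerUnipotent 1)
  refine ⟨n, hn, fun j => ⟨_, Γ₀.pow_mem hmem (5 * j), ?_⟩⟩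
  rw [lowerUnipotent_pow, lowerUnipotent_pow, map_lowerUnipotent]
  simp [map_ofNat]

end SpecialLinearGroup

end HomogeneousRigidity

theorem rigidity_SL2_complex
    (Λ : Subgroup (SpecialLinearGroup (Fin 2) ℂ))
    (hΛcount : Countable Λ) (hΛdisc : DiscreteTopology Λ)
    -- Λ is a lattice: the quotient carries a G-invariant Borel probability measure
    (m : Measure (SpecialLinearGroup (Fin 2) ℂ ⧸ Λ)) (hm : IsProbabilityMeasure m)
    (hminv : ∀ g : SpecialLinearGroup (Fin 2) ℂ, Measure.map (fun z => g • z) m = m)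
    -- Γ is the image of a finite index subgroup of SL₂(ℤ[i])
    (Γ₀ : Subgroup (SpecialLinearGroup (Fin 2) GaussianInt)) (hΓ₀ : Γ₀.FiniteIndex)
    (Γ : Subgroup (SpecialLinearGroup (Fin 2) ℂ))
    (hΓ : Γ = Γ₀.map (SpecialLinearGroup.map GaussianInt.toComplex))
    -- η is a Γ-invariant Borel probability measure on G/Λ
    (η : Measure (SpecialLinearGroup (Fin 2) ℂ ⧸ Λ)) (hη : IsProbabilityMeasure η)
    (hηinv : ∀ γ ∈ Γ, Measure.map (fun z => γ • z) η = η)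
    -- a sequence of Borel probability measures on (G/Λ) × (G/Λ)
    (ν : ℕ → Measure ((SpecialLinearGroup (Fin 2) ℂ ⧸ Λ) × (SpecialLinearGroup (Fin 2) ℂ ⧸ Λ)))
    (hνprob : ∀ k, IsProbabilityMeasure (ν k))
    -- (1) both marginals equal η
    (h1 : ∀ k, (ν k).map Prod.fst = η ∧ (ν k).map Prod.snd = η)
    -- (2) the measures converge to the diagonal against products of bounded Borel functions
    (h2 : ∀ f g : (SpecialLinearGroup (Fin 2) ℂ ⧸ Λ) → ℝ,
      Measurable f → Measurable g → (∃ C, ∀ z, |f z| ≤ C) → (∃ C, ∀ z, |g z| ≤ C) →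
      Tendsto (fun k => ∫ p, f p.1 * g p.2 ∂(ν k)) atTop (𝓝 (∫ z, f z * g z ∂η)))
    -- (3) the measures are asymptotically invariant under the diagonal Γ-action
    (h3 : ∀ γ ∈ Γ,
      Tendsto (fun k => tvDist ((ν k).map (Prod.map (fun z => γ • z) (fun z => γ • z))) (ν k))
        atTop (𝓝 0)) :
    Tendsto (fun k => ((ν k) (Set.diagonal (SpecialLinearGroup (Fin 2) ℂ ⧸ Λ))).toReal)
      atTop (𝓝 1) := by
  subst hΓ
  obtain ⟨n, hn, hu⟩ := HomogeneousRigidity.exists_upperUnipotent_mem_map hΓ₀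
  obtain ⟨n', hn', hl⟩ := HomogeneousRigidity.exists_lowerUnipotent_mem_map hΓ₀
  have hc := HomogeneousRigidity.continuous_entry
  refine HomogeneousRigidity.tendsto_measure_diagonal hνprob (fun k => (h1 k).1) h2
    (isClosed_le (hc 0 1).norm (hc 1 0).norm) (isClosed_le (hc 1 0).norm (hc 0 1).norm)
    (Set.eq_univ_of_forall fun g => le_total ‖g 0 1‖ ‖g 1 0‖)
    ((isOpen_ne_fun (hc 0 0) (continuous_const (y := (-1 : ℂ)))).mem_nhds ?_)
    _ _ (fun j => h3 _ (hu j)) (fun j => h3 _ (hl j))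
    (fun g hg hg1 => HomogeneousRigidity.card_le_two_of_upperUnipotent_conj hn hg hg1)
    (fun g hg hg1 => HomogeneousRigidity.card_le_two_of_lowerUnipotent_conj hn' hg hg1)
  norm_num
end

section
/- Let n ≥ 2, G = SL_n(ℝ), Λ the image of SL_n(ℤ) in G under the entrywise inclusion, and Γ = SL_n(ℤ) acting on the quotient G/Λ by left translation. Let η be a Borel probability measure on G/Λ invariant under left translation by every element of G. Let I be a countable set equipped with an action of Γ all of whose orbits are infinite, let (X₀, μ₀) be a probability space, and let X = X₀^I be endowed with the product probability measure μ = μ₀^{⊗I} and the generalized Bernoulli Γ-action (γ·x)_i = x_{γ⁻¹·i}. Let (Y, ν) be a probability space with a measure-preserving Γ-action. Suppose p : X × Y → G/Λ is a measurable map such that p_*(μ ⊗ ν) = η and, for every γ ∈ Γ, p(γ·x, γ·y) = γ • p(x,y) for μ⊗ν-almost every (x,y). Then p(x₁, y) = p(x₂, y) for μ⊗μ⊗ν-almost every (x₁, x₂, y); that is, p depends almost everywhere only on the second coordinate. -/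
open MeasureTheory Filter Topology Matrix

section Quotient

variable {G : Type*} [Group G] (Λ : Subgroup G)

/-- Pairs of points of `G ⧸ Λ` that differ by left translation by an element of `V`. -/
def nearPairs (V : Set G) : Set ((G ⧸ Λ) × (G ⧸ Λ)) :=
  {q | ∃ h ∈ V, q.2 = h • q.1}

theorem opensMeasurableSpace_quotient [TopologicalSpace G] [MeasurableSpace G] [BorelSpace G] :
    OpensMeasurableSpace (G ⧸ Λ) := by
  refine ⟨MeasurableSpace.generateFrom_le fun s hs => ?_⟩
  have : IsOpen ((QuotientGroup.mk : G → G ⧸ Λ) ⁻¹' s) :=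
    IsOpen.preimage QuotientGroup.continuous_mk hs
  exact this.measurableSet

variable [TopologicalSpace G] [IsTopologicalGroup G]

theorem isOpen_nearPairs {V : Set G} (hV : IsOpen V) : IsOpen (nearPairs Λ V) := by
  have h1 : IsOpen {q : G × G | q.2 * q.1⁻¹ ∈ V} :=
    hV.preimage (continuous_snd.mul continuous_fst.inv)
  have h2 : nearPairs Λ V = Prod.map (QuotientGroup.mk : G → G ⧸ Λ) (QuotientGroup.mk : G → G ⧸ Λ)
      '' {q : G × G | q.2 * q.1⁻¹ ∈ V} := by
    ext ⟨a, b⟩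
    constructor
    · rintro ⟨h, hh, e⟩
      obtain ⟨g, rfl⟩ := QuotientGroup.mk_surjective a
      refine ⟨(g, h * g), by simpa using hh, ?_⟩
      simp only at e
      rw [e]
      rfl
    · rintro ⟨⟨g, g'⟩, hg, e⟩
      simp only [Prod.map_apply, Prod.mk.injEq] at e
      refine ⟨g' * g⁻¹, hg, ?_⟩
      rw [← e.1, ← e.2]
      simp only [MulAction.Quotient.smul_mk, smul_eq_mul, inv_mul_cancel_right]
  rw [h2]
  exact (QuotientGroup.isOpenMap_coe.prodMap QuotientGroup.isOpenMap_coe) _ h1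

variable [MeasurableSpace G] [BorelSpace G]

theorem measurable_smul_quotient (g : G) : Measurable (fun z : G ⧸ Λ => g • z) := by
  have h : Measurable (fun x : G => g * x) := (continuous_const_mul g).measurable
  refine measurable_from_quotient.2 ?_
  have h2 : Measurable (QuotientGroup.mk : G → G ⧸ Λ) := measurable_quotient_mk''
  exact h2.comp h

/-- The diagonal of `G ⧸ Λ` is measurable as soon as the orbit maps are locally injective. -/
theorem measurableSet_diagonal_quotient [SecondCountableTopology G] [T1Space G]
    (hloc : ∀ z : G ⧸ Λ, ∃ V ∈ 𝓝 (1 : G), ∀ h₁ ∈ V, ∀ h₂ ∈ V, h₁ • z = h₂ • z → h₁ = h₂) :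
    MeasurableSet {q : (G ⧸ Λ) × (G ⧸ Λ) | q.1 = q.2} := by
  have := opensMeasurableSpace_quotient Λ
  obtain ⟨B, hB⟩ := (𝓝 (1 : G)).exists_antitone_basis
  have hBo : ∀ k, (1 : G) ∈ interior (B k) := fun k =>
    mem_interior_iff_mem_nhds.2 (hB.1.mem_of_mem trivial)
  have : {q : (G ⧸ Λ) × (G ⧸ Λ) | q.1 = q.2} = ⋂ k, nearPairs Λ (interior (B k)) := by
    ext ⟨a, b⟩
    simp only [Set.mem_ofPred_eq, Set.mem_iInter]
    constructor
    · rintro rfl k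
      exact ⟨1, hBo k, by simp⟩
    · intro H
      obtain ⟨V, hV, hinj⟩ := hloc a
      obtain ⟨k₀, -, hk₀⟩ := hB.1.mem_iff.1 hV
      obtain ⟨h, hh, e⟩ := H k₀
      have h1 : h = 1 := by
        by_contra hne
        have : {x : G | x ≠ h} ∈ 𝓝 (1 : G) := isOpen_ne.mem_nhds (Ne.symm hne)
        obtain ⟨k₁, -, hk₁⟩ := hB.1.mem_iff.1 this
        obtain ⟨h', hh', e'⟩ := H (max k₀ k₁)
        have m0 := hk₀ (interior_subset hh)
        have m1 := hk₀ (hB.2 (le_max_left k₀ k₁) (interior_subset hh'))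
        have m2 := hk₁ (hB.2 (le_max_right k₀ k₁) (interior_subset hh'))
        exact m2 (hinj _ m1 _ m0 (e'.symm.trans e))
      simp only at e
      rw [e, h1, one_smul]
  rw [this]
  exact MeasurableSet.iInter fun k => (isOpen_nearPairs Λ isOpen_interior).measurableSet

end Quotient

/-- If a set `A` is visited at most once, outside of a set `B`, under `K` measure-preserving maps,
then its measure is at most `1 / K` up to the measure of `B`. -/
theorem measureReal_le_of_visited_once {α : Type*} [MeasurableSpace α] (θ : Measure α)
    [IsProbabilityMeasure θ] {A B : Set α} (hA : MeasurableSet A) (hB : MeasurableSet B) (K : ℕ)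
    (T : ℕ → α → α) (hT : ∀ k, MeasurePreserving (T k) θ θ)
    (hdisj : ∀ k < K, ∀ l < K, k ≠ l → ∀ x ∉ B, T k x ∈ A → T l x ∉ A) :
    K * θ.real A ≤ 1 + K * θ.real B := by
  have h1 : ∀ k, θ.real A ≤ θ.real (T k ⁻¹' A \ B) + θ.real B := fun k => by
    rw [← (hT k).measureReal_preimage hA.nullMeasurableSet]
    calc θ.real (T k ⁻¹' A) ≤ θ.real ((T k ⁻¹' A \ B) ∪ B) := measureReal_mono (by
          intro x hx; by_cases h : x ∈ B <;> simp_all)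
      _ ≤ _ := measureReal_union_le _ _
  have h2 : ∑ k ∈ Finset.range K, θ.real (T k ⁻¹' A \ B) ≤ 1 := by
    rw [← measureReal_biUnion_finset]
    · exact measureReal_le_one
    · intro k hk l hl hkl
      refine Set.disjoint_left.2 fun x hx hx' => ?_
      exact hdisj k (by simpa using hk) l (by simpa using hl) hkl x hx.2 hx.1 hx'.1
    · exact fun k _ => ((hT k).measurable hA).diff hB
  calc K * θ.real A = ∑ k ∈ Finset.range K, θ.real A := by simp
    _ ≤ ∑ k ∈ Finset.range K, (θ.real (T k ⁻¹' A \ B) + θ.real B) :=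
        Finset.sum_le_sum fun k _ => h1 k
    _ ≤ 1 + K * θ.real B := by
        rw [Finset.sum_add_distrib]; simpa using h2

section Transvection

variable {n : ℕ}

/-- Deviation of the `i`-th diagonal entry of a matrix from the mean of the diagonal entries. -/
noncomputable def diagDev (M : Matrix (Fin n) (Fin n) ℝ) (i : Fin n) : ℝ := M i i - M.trace / n

theorem sum_diagDev (hn : n ≠ 0) (M : Matrix (Fin n) (Fin n) ℝ) : ∑ i, diagDev M i = 0 := by
  have : (n : ℝ) ≠ 0 := by exact_mod_cast hn
  simp only [diagDev, Finset.sum_sub_distrib, Finset.sum_const, Finset.card_univ, Fintype.card_fin,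
    nsmul_eq_mul, Matrix.trace, Matrix.diag]
  field_simp
  ring

theorem trace_conj (g h : SpecialLinearGroup (Fin n) ℝ) :
    ((g * h * g⁻¹ : SpecialLinearGroup (Fin n) ℝ) : Matrix (Fin n) (Fin n) ℝ).trace =
      (h : Matrix (Fin n) (Fin n) ℝ).trace := by
  change ((g * h).1 * g⁻¹.1).trace = h.1.trace
  rw [Matrix.trace_mul_comm]
  change (g⁻¹ * (g * h)).1.trace = h.1.trace
  rw [inv_mul_cancel_left]

variable {i j : Fin n} (hij : i ≠ j) (c : ℝ) (h : SpecialLinearGroup (Fin n) ℝ)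

theorem conj_transvection_coe :
    ((SpecialLinearGroup.transvection hij c * h *
      (SpecialLinearGroup.transvection hij c)⁻¹ : SpecialLinearGroup (Fin n) ℝ) :
      Matrix (Fin n) (Fin n) ℝ) =
      Matrix.transvection i j c * (h : Matrix (Fin n) (Fin n) ℝ) * Matrix.transvection i j (-c) := by
  rw [SpecialLinearGroup.transvection_inv]
  simp [SpecialLinearGroup.transvection_coe]
  rfl

theorem conj_transvection_apply_ji :
    (SpecialLinearGroup.transvection hij c * h *
      (SpecialLinearGroup.transvection hij c)⁻¹) j i = h j i := by
  rw [conj_transvection_coe, mul_transvection_apply_of_ne _ _ _ _ hij,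
    transvection_mul_apply_of_ne _ _ _ _ hij.symm]

theorem conj_transvection_apply_ii :
    (SpecialLinearGroup.transvection hij c * h *
      (SpecialLinearGroup.transvection hij c)⁻¹) i i = h i i + c * h j i := by
  rw [conj_transvection_coe, mul_transvection_apply_of_ne _ _ _ _ hij, transvection_mul_apply_same]

theorem conj_transvection_apply_jj :
    (SpecialLinearGroup.transvection hij c * h *
      (SpecialLinearGroup.transvection hij c)⁻¹) j j = h j j - c * h j i := by
  rw [conj_transvection_coe, mul_transvection_apply_same,
    transvection_mul_apply_of_ne _ _ _ _ hij.symm, transvection_mul_apply_of_ne _ _ _ _ hij.symm]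
  ring

theorem conj_transvection_apply_ij :
    (SpecialLinearGroup.transvection hij c * h *
      (SpecialLinearGroup.transvection hij c)⁻¹) i j =
      h i j + c * (h j j - h i i) - c ^ 2 * h j i := by
  rw [conj_transvection_coe, mul_transvection_apply_same, transvection_mul_apply_same,
    transvection_mul_apply_same]
  ring

theorem diagDev_conj_transvection_left :
    diagDev (SpecialLinearGroup.transvection hij c * h *
      (SpecialLinearGroup.transvection hij c)⁻¹) i = diagDev h i + c * h j i := by
  rw [diagDev, diagDev, trace_conj, conj_transvection_apply_ii]; ring

theorem diagDev_conj_transvection_right :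
    diagDev (SpecialLinearGroup.transvection hij c * h *
      (SpecialLinearGroup.transvection hij c)⁻¹) j = diagDev h j - c * h j i := by
  rw [diagDev, diagDev, trace_conj, conj_transvection_apply_jj]; ring

end Transvection

/-- An element of `SLₙ(ℝ)` close to `1` whose off-diagonal entries are dominated by the deviations
of its diagonal entries, and stay so after conjugation by elementary matrices, is trivial. -/
theorem eq_one_of_diagDev_dominates {n : ℕ} (hn : 2 ≤ n) (h : SpecialLinearGroup (Fin n) ℝ)
    (hpos : ∀ i, 0 < h i i)
    (h1 : ∀ i j : Fin n, i ≠ j → 5 * |h j i| ≤ |diagDev h i|)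
    (h2 : ∀ (i j : Fin n) (hij : i ≠ j),
      5 * |(SpecialLinearGroup.transvection hij 1 * h *
        (SpecialLinearGroup.transvection hij (1 : ℝ))⁻¹ : SpecialLinearGroup (Fin n) ℝ) i j| ≤
      |diagDev (SpecialLinearGroup.transvection hij 1 * h *
        (SpecialLinearGroup.transvection hij (1 : ℝ))⁻¹ : SpecialLinearGroup (Fin n) ℝ) j|) :
    h = 1 := by
  have : Nonempty (Fin n) := ⟨⟨0, by omega⟩⟩
  obtain ⟨m, -, hm⟩ := Finset.exists_max_image Finset.univ (fun i => |diagDev h.1 i|)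
    Finset.univ_nonempty
  replace hm : ∀ i, |diagDev h i| ≤ |diagDev h m| := fun i => hm i (Finset.mem_univ _)
  set M := |diagDev h m| with hM
  have hM0 : 0 ≤ M := abs_nonneg _
  have hoff : ∀ i j : Fin n, i ≠ j → 5 * |h j i| ≤ M := fun i j hij => (h1 i j hij).trans (hm i)
  have hdiff : ∀ i j : Fin n, |diagDev h i - diagDev h j| ≤ 4 / 5 * M := by
    intro i j
    by_cases hij : i = j
    · rw [hij]; simpa using by positivity
    have e1 := h2 i j hij
    rw [diagDev_conj_transvection_right, conj_transvection_apply_ij, one_pow, one_mul,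
      one_mul] at e1
    have e2 := hoff i j hij
    have e3 := hoff j i (Ne.symm hij)
    have e4 := hm j
    have e5 : diagDev h i - diagDev h j = h i i - h j j := by simp [diagDev]
    rw [e5]
    rw [← abs_sub_comm]
    have e6 : |diagDev h j - h j i| ≤ M + M / 5 := by
      refine (abs_sub _ _).trans ?_
      linarith
    have e7 := abs_le.1 (show |h i j + (h j j - h i i) - h j i| ≤ (M + M / 5) / 5 by
      linarith)
    have e8 := abs_le.1 (show |h j i| ≤ M / 5 by linarith)
    have e9 := abs_le.1 (show |h i j| ≤ M / 5 by linarith)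
    exact abs_le.2 ⟨by linarith, by linarith⟩
  have hnR : (0 : ℝ) < n := by exact_mod_cast (by omega : 0 < n)
  have hMz : M = 0 := by
    have e1 : (n : ℝ) * diagDev h m = ∑ j, (diagDev h.1 m - diagDev h.1 j) := by
      rw [Finset.sum_sub_distrib, sum_diagDev (by omega)]; simp
    have e2 : (n : ℝ) * M ≤ n * (4 / 5 * M) := by
      calc (n : ℝ) * M = |(n : ℝ) * diagDev h m| := by rw [abs_mul, abs_of_pos hnR]
        _ ≤ ∑ j, |diagDev h m - diagDev h j| := by rw [e1]; exact Finset.abs_sum_le_sum_abs _ _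
        _ ≤ ∑ j : Fin n, (4 / 5 * M) := Finset.sum_le_sum fun j _ => hdiff m j
        _ = _ := by simp
    have := le_of_mul_le_mul_left e2 hnR
    linarith
  have hd : ∀ i, diagDev h i = 0 := fun i => abs_eq_zero.1 (le_antisymm (hMz ▸ hm i) (abs_nonneg _))
  have ho : ∀ i j, i ≠ j → h i j = 0 := fun i j hij => by
    have := hoff j i (Ne.symm hij)
    rw [hMz] at this
    exact abs_eq_zero.1 (le_antisymm (by linarith) (abs_nonneg _))
  set t := (h : Matrix (Fin n) (Fin n) ℝ).trace / n with ht
  have hdt : ∀ i, h i i = t := fun i => by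
    have := hd i
    rw [diagDev] at this
    linarith
  have hmat : (h : Matrix (Fin n) (Fin n) ℝ) = Matrix.diagonal fun _ => t := by
    ext i j
    by_cases hij : i = j
    · subst hij; simp [hdt]
    · simp [hij, ho i j hij]
  have hdet := h.2
  rw [hmat, Matrix.det_diagonal] at hdet
  simp only [Finset.prod_const, Finset.card_univ, Fintype.card_fin] at hdet
  have ht0 : 0 < t := by
    have i0 : Fin n := Classical.arbitrary _
    rw [← hdt i0]; exact hpos i0
  have ht1 : t = 1 := (pow_eq_one_iff_of_nonneg ht0.le (by omega)).1 hdet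
  apply Subtype.ext
  rw [hmat, ht1]
  simp

theorem isTopologicalGroup_SL (n : ℕ) : IsTopologicalGroup (SpecialLinearGroup (Fin n) ℝ) :=
  Matrix.SpecialLinearGroup.topologicalGroup

theorem t1Space_SL (n : ℕ) : T1Space (SpecialLinearGroup (Fin n) ℝ) :=
  Matrix.SpecialLinearGroup.instT1Space

theorem secondCountableTopology_SL (n : ℕ) :
    SecondCountableTopology (SpecialLinearGroup (Fin n) ℝ) :=
  inferInstanceAs (SecondCountableTopology
    {A : Fin n → Fin n → ℝ // Matrix.det (Matrix.of A) = 1})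

theorem continuous_SL_apply {n : ℕ} (i j : Fin n) :
    Continuous fun h : SpecialLinearGroup (Fin n) ℝ => h i j :=
  (continuous_apply j).comp ((continuous_apply i).comp
    (continuous_subtype_val : Continuous
      (fun A : {A : Matrix (Fin n) (Fin n) ℝ // A.det = 1} => A.1)))

theorem continuous_diagDev {n : ℕ} (i : Fin n) :
    Continuous fun h : SpecialLinearGroup (Fin n) ℝ => diagDev h i :=
  (continuous_SL_apply i i).sub
    ((continuous_finsetSum _ fun k _ => continuous_SL_apply k k).div_const _)

theorem eventually_SL_near_one {n : ℕ} {ε : ℝ} (hε : 0 < ε) :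
    ∀ᶠ h : SpecialLinearGroup (Fin n) ℝ in 𝓝 1,
      ∀ i j, |h i j - (1 : SpecialLinearGroup (Fin n) ℝ) i j| < ε := by
  refine eventually_all.2 fun i => eventually_all.2 fun j => ?_
  have := (continuous_SL_apply i j).tendsto 1
  simpa [Real.dist_eq] using this.eventually (Metric.ball_mem_nhds _ hε)

section Lattice

variable {n : ℕ} {Λ : Subgroup (SpecialLinearGroup (Fin n) ℝ)}

/-- Matrices of determinant one which, together with their inverses, have entries less than `C`. -/
def boundedSL (n : ℕ) (C : ℝ) : Set (SpecialLinearGroup (Fin n) ℝ) :=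
  {g | ∀ i j, |g i j| < C ∧ |g⁻¹ i j| < C}

theorem isOpen_boundedSL (n : ℕ) (C : ℝ) : IsOpen (boundedSL n C) := by
  have := isTopologicalGroup_SL n
  simp only [boundedSL, Set.ofPred_forall]
  refine isOpen_iInter_of_finite fun i => isOpen_iInter_of_finite fun j => ?_
  exact (isOpen_lt (continuous_SL_apply i j).abs continuous_const).inter
    (isOpen_lt ((continuous_SL_apply i j).comp continuous_inv).abs continuous_const)

theorem boundedSL_mono (n : ℕ) {C D : ℝ} (h : C ≤ D) : boundedSL n C ⊆ boundedSL n D :=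
  fun _ hg i j => ⟨(hg i j).1.trans_le h, (hg i j).2.trans_le h⟩

theorem exists_mem_boundedSL (g : SpecialLinearGroup (Fin n) ℝ) :
    ∃ C : ℕ, g ∈ boundedSL n C := by
  have h : ∀ᶠ C : ℕ in atTop, ∀ i j, |g i j| < (C : ℝ) ∧ |g⁻¹ i j| < (C : ℝ) := by
    refine eventually_all.2 fun i => eventually_all.2 fun j => ?_
    exact (tendsto_natCast_atTop_atTop.eventually_gt_atTop _).and
      (tendsto_natCast_atTop_atTop.eventually_gt_atTop _)
  exact h.exists

theorem eq_one_of_conj_mem_lattice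
    (hΛ : Λ = (SpecialLinearGroup.map (Int.castRingHom ℝ) :
      SpecialLinearGroup (Fin n) ℤ →* SpecialLinearGroup (Fin n) ℝ).range)
    {C ε : ℝ} (hε : n * (n * (C * ε * C)) < 1) (hε0 : 0 ≤ ε)
    {g h : SpecialLinearGroup (Fin n) ℝ} (hg : g ∈ boundedSL n C)
    (hh : ∀ i j, |h i j - (1 : SpecialLinearGroup (Fin n) ℝ) i j| ≤ ε)
    (hmem : g⁻¹ * h * g ∈ Λ) : h = 1 := by
  rw [hΛ] at hmem
  obtain ⟨γ, hγ⟩ := hmem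
  have key : (g⁻¹ * h * g).1 - 1 = g⁻¹.1 * (h.1 - 1) * g.1 := by
    rw [Matrix.mul_sub, Matrix.sub_mul, Matrix.mul_one]
    have : (g⁻¹.1 * g.1 : Matrix (Fin n) (Fin n) ℝ) = 1 := congrArg Subtype.val (inv_mul_cancel g)
    rw [this]
    rfl
  have hγ1 : γ = 1 := by
    apply Subtype.ext
    ext i j
    have hC : 0 ≤ C := (abs_nonneg _).trans (hg i j).1.le
    have e1 : |((g⁻¹ * h * g).1 - 1) i j| < 1 := by
      rw [key]
      refine lt_of_le_of_lt ?_ hε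
      rw [Matrix.mul_apply]
      refine (Finset.abs_sum_le_sum_abs _ _).trans ?_
      refine (Finset.sum_le_card_nsmul _ _ (n * (C * ε * C)) fun k _ => ?_).trans (by simp)
      rw [abs_mul, Matrix.mul_apply]
      have : |∑ l, g⁻¹.1 i l * (h.1 - 1) l k| ≤ n * (C * ε) := by
        refine (Finset.abs_sum_le_sum_abs _ _).trans ?_
        refine (Finset.sum_le_card_nsmul _ _ (C * ε) fun l _ => ?_).trans (by simp)
        rw [abs_mul]
        exact mul_le_mul (hg i l).2.le (hh l k) (abs_nonneg _) hC
      calc _ ≤ n * (C * ε) * C := mul_le_mul this (hg k j).1.le (abs_nonneg _) (by positivity)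
        _ = _ := by ring
    have e2 : ((g⁻¹ * h * g).1 - 1) i j =
        ((γ.1 i j - (1 : Matrix (Fin n) (Fin n) ℤ) i j : ℤ) : ℝ) := by
      rw [← hγ, Matrix.sub_apply]
      push_cast
      congr 1
      by_cases hij : i = j <;> simp [Matrix.one_apply, hij]
    rw [e2, ← Int.cast_abs] at e1
    have e3 : |γ.1 i j - (1 : Matrix (Fin n) (Fin n) ℤ) i j| < 1 := by exact_mod_cast e1
    have e4 := Int.abs_lt_one_iff.1 e3
    have e5 : γ.1 i j = (1 : Matrix (Fin n) (Fin n) ℤ) i j := by linarith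
    exact e5
  rw [hγ1, map_one] at hγ
  have : h = g * (g⁻¹ * h * g) * g⁻¹ := by group
  rw [this, ← hγ]
  group

/-- Orbit maps are injective near `1`, uniformly over a bounded part of `SLₙ(ℝ) ⧸ SLₙ(ℤ)`. -/
theorem exists_nhds_smul_injOn
    (hΛ : Λ = (SpecialLinearGroup.map (Int.castRingHom ℝ) :
      SpecialLinearGroup (Fin n) ℤ →* SpecialLinearGroup (Fin n) ℝ).range)
    (C : ℝ) :
    ∃ V ∈ 𝓝 (1 : SpecialLinearGroup (Fin n) ℝ),
      ∀ g ∈ boundedSL n C, ∀ h₁ ∈ V, ∀ h₂ ∈ V,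
        h₁ • (QuotientGroup.mk g : SpecialLinearGroup (Fin n) ℝ ⧸ Λ) = h₂ • QuotientGroup.mk g →
          h₁ = h₂ := by
  have := isTopologicalGroup_SL n
  obtain ⟨ε, hε0, hε⟩ : ∃ ε : ℝ, 0 < ε ∧ n * (n * (C * ε * C)) < 1 := by
    refine ⟨1 / (n * n * C ^ 2 + 1), by positivity, ?_⟩
    have : (n : ℝ) * (n * (C * (1 / (n * n * C ^ 2 + 1)) * C)) =
        (n * n * C ^ 2) / (n * n * C ^ 2 + 1) := by ring
    rw [this, div_lt_one (by positivity)]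
    linarith
  have hev := eventually_SL_near_one (n := n) hε0
  have hc : Continuous fun q : SpecialLinearGroup (Fin n) ℝ × SpecialLinearGroup (Fin n) ℝ =>
    q.1⁻¹ * q.2 := continuous_fst.inv.mul continuous_snd
  have ht := hc.tendsto (1, 1)
  simp only [inv_one, one_mul] at ht
  have h2 := ht.eventually hev
  rw [nhds_prod_eq] at h2
  obtain ⟨V, hV, hVV⟩ := Filter.mem_prod_self_iff.1 h2
  refine ⟨V, hV, fun g hg h₁ hh₁ h₂ hh₂ e => ?_⟩
  have hs := hVV (Set.mk_mem_prod hh₁ hh₂)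
  have hm : g⁻¹ * (h₁⁻¹ * h₂) * g ∈ Λ := by
    have := QuotientGroup.eq.1 (show (QuotientGroup.mk (h₁ * g) :
      SpecialLinearGroup (Fin n) ℝ ⧸ Λ) = QuotientGroup.mk (h₂ * g) from e)
    have e' : g⁻¹ * (h₁⁻¹ * h₂) * g = (h₁ * g)⁻¹ * (h₂ * g) := by group
    rwa [e']
  have := eq_one_of_conj_mem_lattice hΛ hε hε0.le hg (fun i j => (hs i j).le) hm
  exact inv_mul_eq_one.1 this

theorem measurableSet_diagonal_SL_quotient
    (hΛ : Λ = (SpecialLinearGroup.map (Int.castRingHom ℝ) :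
      SpecialLinearGroup (Fin n) ℤ →* SpecialLinearGroup (Fin n) ℝ).range) :
    MeasurableSet {q : (SpecialLinearGroup (Fin n) ℝ ⧸ Λ) × (SpecialLinearGroup (Fin n) ℝ ⧸ Λ) |
      q.1 = q.2} := by
  have := isTopologicalGroup_SL n
  have := t1Space_SL n
  have := secondCountableTopology_SL n
  refine measurableSet_diagonal_quotient Λ fun z => ?_
  obtain ⟨g, rfl⟩ := QuotientGroup.mk_surjective z
  obtain ⟨C, hC⟩ := exists_mem_boundedSL g
  obtain ⟨V, hV, h⟩ := exists_nhds_smul_injOn hΛ (C : ℝ)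
  exact ⟨V, hV, h g hC⟩

end Lattice

section Rigidity

variable {n : ℕ} {Λ : Subgroup (SpecialLinearGroup (Fin n) ℝ)}

/-- Pairs `(z, h • z)` with `h ∈ V` whose `(j, i)` entry is not small relative to the deviation of
its `i`-th diagonal entry. -/
def skewPairs (Λ : Subgroup (SpecialLinearGroup (Fin n) ℝ))
    (V : Set (SpecialLinearGroup (Fin n) ℝ)) (i j : Fin n) :
    Set ((SpecialLinearGroup (Fin n) ℝ ⧸ Λ) × (SpecialLinearGroup (Fin n) ℝ ⧸ Λ)) :=
  nearPairs Λ (V ∩ {h | |diagDev h i| < 5 * |h j i|})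

theorem isOpen_skewPairs {V : Set (SpecialLinearGroup (Fin n) ℝ)} (hV : IsOpen V) (i j : Fin n) :
    IsOpen (skewPairs Λ V i j) := by
  have := isTopologicalGroup_SL n
  exact isOpen_nearPairs Λ (hV.inter (isOpen_lt (continuous_diagDev i).abs
    (continuous_const.mul (continuous_SL_apply j i).abs)))

theorem map_transvection {i j : Fin n} (hij : i ≠ j) (k : ℤ) :
    SpecialLinearGroup.map (Int.castRingHom ℝ) (SpecialLinearGroup.transvection hij k) =
      SpecialLinearGroup.transvection hij (k : ℝ) := by
  apply Subtype.ext
  ext a b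
  simp [SpecialLinearGroup.transvection_coe, Matrix.single_apply, Matrix.one_apply]

/-- The image in `SLₙ(ℝ) ⧸ Λ` of the bounded part of `SLₙ(ℝ)`. -/
def boundedQuotient (Λ : Subgroup (SpecialLinearGroup (Fin n) ℝ)) (C : ℝ) :
    Set (SpecialLinearGroup (Fin n) ℝ ⧸ Λ) :=
  QuotientGroup.mk '' boundedSL n C

theorem isOpen_boundedQuotient (C : ℝ) : IsOpen (boundedQuotient Λ C) := by
  have := isTopologicalGroup_SL n
  exact QuotientGroup.isOpenMap_coe _ (isOpen_boundedSL n C)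

theorem exists_measureReal_compl_boundedQuotient_le (η : Measure (SpecialLinearGroup (Fin n) ℝ ⧸ Λ))
    [IsProbabilityMeasure η] {δ : ℝ} (hδ : 0 < δ) :
    ∃ C : ℝ, η.real (boundedQuotient Λ C)ᶜ ≤ δ := by
  have := isTopologicalGroup_SL n
  have := opensMeasurableSpace_quotient Λ
  have hmono : Monotone fun C : ℕ => boundedQuotient Λ (C : ℝ) := fun C D h =>
    Set.image_mono (boundedSL_mono n (by exact_mod_cast h))
  have hunion : ⋃ C : ℕ, boundedQuotient Λ (C : ℝ) = Set.univ := by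
    refine Set.eq_univ_of_forall fun z => ?_
    obtain ⟨g, rfl⟩ := QuotientGroup.mk_surjective z
    obtain ⟨C, hC⟩ := exists_mem_boundedSL g
    exact Set.mem_iUnion.2 ⟨C, g, hC, rfl⟩
  have ht := tendsto_measure_iUnion_atTop (μ := η) hmono
  rw [hunion, measure_univ] at ht
  have ht' := (ENNReal.tendsto_toReal ENNReal.one_ne_top).comp ht
  obtain ⟨C, hC⟩ := (ht'.eventually (lt_mem_nhds
    (show 1 - δ < ENNReal.toReal 1 by simpa using hδ))).exists
  refine ⟨C, ?_⟩
  rw [measureReal_compl (isOpen_boundedQuotient _).measurableSet]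
  simp only [probReal_univ]
  change 1 - δ < η.real (boundedQuotient Λ (C : ℝ)) at hC
  linarith

/-- If a self-joining of `SLₙ(ℝ) ⧸ SLₙ(ℤ)`, invariant under the diagonal action of `SLₙ(ℤ)`, is
concentrated near the diagonal, then almost all its mass lies on the diagonal. -/
theorem exists_nhds_measureReal_offDiagonal_le
    (hΛ : Λ = (SpecialLinearGroup.map (Int.castRingHom ℝ) :
      SpecialLinearGroup (Fin n) ℤ →* SpecialLinearGroup (Fin n) ℝ).range)
    (hn : 2 ≤ n)
    (η : Measure (SpecialLinearGroup (Fin n) ℝ ⧸ Λ)) [IsProbabilityMeasure η]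
    {c : ℝ} (hc : 0 < c) :
    ∃ V : Set (SpecialLinearGroup (Fin n) ℝ), IsOpen V ∧ 1 ∈ V ∧ ∃ δ > 0,
      ∀ θ : Measure ((SpecialLinearGroup (Fin n) ℝ ⧸ Λ) × (SpecialLinearGroup (Fin n) ℝ ⧸ Λ)),
        IsProbabilityMeasure θ →
        (∀ γ : SpecialLinearGroup (Fin n) ℤ, MeasurePreserving
          (fun q => (SpecialLinearGroup.map (Int.castRingHom ℝ) γ • q.1,
            SpecialLinearGroup.map (Int.castRingHom ℝ) γ • q.2)) θ θ) →
        θ.map Prod.fst = η → θ.real (nearPairs Λ V)ᶜ ≤ δ → θ.real {q | q.1 ≠ q.2} ≤ c := by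
  have := isTopologicalGroup_SL n
  have := secondCountableTopology_SL n
  have := opensMeasurableSpace_quotient Λ
  obtain ⟨K, hK0, hK⟩ : ∃ K : ℕ, 0 < K ∧ 2 * (n * n : ℝ) / K ≤ c / 2 := by
    obtain ⟨K, hK⟩ := exists_nat_gt (2 * (n * n : ℝ) / (c / 2))
    have h0 : (0 : ℝ) < K := lt_of_le_of_lt (by positivity) hK
    refine ⟨K, by exact_mod_cast h0, ?_⟩
    rw [div_le_iff₀ h0]
    rw [div_lt_iff₀ (by positivity)] at hK
    linarith
  set δ : ℝ := c / (4 * (2 * (n * n) + 1)) with hδ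
  have hδ0 : 0 < δ := by positivity
  obtain ⟨C, hC⟩ := exists_measureReal_compl_boundedQuotient_le η hδ0
  obtain ⟨W, hW, hinj⟩ := exists_nhds_smul_injOn hΛ C
  have hconj : ∀ (g : SpecialLinearGroup (Fin n) ℝ) {U : Set (SpecialLinearGroup (Fin n) ℝ)},
      U ∈ 𝓝 1 → ∀ᶠ h in 𝓝 (1 : SpecialLinearGroup (Fin n) ℝ), g * h * g⁻¹ ∈ U := by
    intro g U hU
    have hcont : Continuous fun h : SpecialLinearGroup (Fin n) ℝ => g * h * g⁻¹ :=
      (continuous_const.mul continuous_id).mul continuous_const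
    have := hcont.tendsto 1
    simp only [mul_one, mul_inv_cancel] at this
    exact this.eventually hU
  obtain ⟨V₂, hV₂, hV₂o, hV₂1⟩ := eventually_nhds_iff.1
    (show ∀ᶠ h in 𝓝 (1 : SpecialLinearGroup (Fin n) ℝ), h ∈ W ∧ (∀ i, 0 < h i i) ∧
        ∀ (i j : Fin n) (hij : i ≠ j) (k : Fin K),
          (SpecialLinearGroup.transvection hij (10 * (k : ℕ) : ℝ))⁻¹ * h *
            ((SpecialLinearGroup.transvection hij (10 * (k : ℕ) : ℝ))⁻¹)⁻¹ ∈ W by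
      refine (eventually_mem_nhds_iff.2 hW |>.mono fun _ h => mem_of_mem_nhds h).and
        (Eventually.and ?_ ?_)
      · filter_upwards [eventually_SL_near_one (n := n) one_pos] with h hh i
        have := (abs_lt.1 (hh i i)).1
        simp at this
        linarith
      · exact eventually_all.2 fun i => eventually_all.2 fun j => eventually_all.2 fun hij =>
          eventually_all.2 fun k => hconj _ hW)
  obtain ⟨V, hV, hVo, hV1⟩ := eventually_nhds_iff.1
    (show ∀ᶠ h in 𝓝 (1 : SpecialLinearGroup (Fin n) ℝ), h ∈ V₂ ∧
        ∀ (i j : Fin n) (hij : i ≠ j), SpecialLinearGroup.transvection hij 1 * h *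
            (SpecialLinearGroup.transvection hij (1 : ℝ))⁻¹ ∈ V₂ from
      Filter.Eventually.and
        (show ∀ᶠ h in 𝓝 (1 : SpecialLinearGroup (Fin n) ℝ), h ∈ V₂ from hV₂o.mem_nhds hV₂1)
        (eventually_all.2 fun i => eventually_all.2 fun j =>
        eventually_all.2 fun hij => hconj _ (hV₂o.mem_nhds hV₂1)))
  refine ⟨V, hVo, hV1, δ, hδ0, fun θ _ hθ hfst hnear => ?_⟩
  set B : Set ((SpecialLinearGroup (Fin n) ℝ ⧸ Λ) × (SpecialLinearGroup (Fin n) ℝ ⧸ Λ)) :=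
    Prod.fst ⁻¹' (boundedQuotient Λ C)ᶜ ∪ (nearPairs Λ V)ᶜ with hBdef
  have hKm : MeasurableSet (boundedQuotient Λ C)ᶜ := (isOpen_boundedQuotient C).measurableSet.compl
  have hBm : MeasurableSet B :=
    (measurable_fst hKm).union (isOpen_nearPairs Λ hVo).measurableSet.compl
  have hB : θ.real B ≤ 2 * δ := by
    refine (measureReal_union_le _ _).trans ?_
    rw [← hfst, map_measureReal_apply measurable_fst hKm] at hC
    linarith
  -- off `B`, the pair is `(z, h • z)` with a unique small `h`
  have hgood : ∀ q ∉ B, ∃ h ∈ V, q.2 = h • q.1 ∧ ∀ h' ∈ W, q.2 = h' • q.1 → h' = h := by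
    intro q hq
    simp only [hBdef, Set.mem_union, Set.mem_preimage, Set.mem_compl_iff, not_or, not_not] at hq
    obtain ⟨⟨g, hg, e⟩, h, hh, e'⟩ := hq
    refine ⟨h, hh, e', fun h' hh' e'' => ?_⟩
    refine hinj g hg _ hh' _ (hV₂ _ (hV _ hh).1).1 ?_
    rw [e, ← e', ← e'']
  have hskew : ∀ i j : Fin n, i ≠ j → θ.real (skewPairs Λ V₂ i j) ≤ 1 / K + 2 * δ := by
    intro i j hij
    have key := measureReal_le_of_visited_once θ (isOpen_skewPairs hV₂o i j).measurableSet hBm K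
      (fun k q => (SpecialLinearGroup.map (Int.castRingHom ℝ)
        (SpecialLinearGroup.transvection hij (10 * (k : ℕ) : ℤ)) • q.1,
        SpecialLinearGroup.map (Int.castRingHom ℝ)
        (SpecialLinearGroup.transvection hij (10 * (k : ℕ) : ℤ)) • q.2)) (fun k => hθ _) ?_
    · have hK0' : (0 : ℝ) < K := by exact_mod_cast hK0
      have : θ.real (skewPairs Λ V₂ i j) ≤ 1 / K + θ.real B := by
        rw [← mul_le_mul_iff_right₀ hK0', mul_add, mul_one_div_cancel hK0'.ne']
        exact key
      linarith
    · intro k hk l hl hkl q hq hqk hql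
      obtain ⟨h, hh, e, huniq⟩ := hgood q hq
      have hval : ∀ m < K, (SpecialLinearGroup.map (Int.castRingHom ℝ)
          (SpecialLinearGroup.transvection hij (10 * (m : ℕ) : ℤ)) • q.1,
          SpecialLinearGroup.map (Int.castRingHom ℝ)
          (SpecialLinearGroup.transvection hij (10 * (m : ℕ) : ℤ)) • q.2) ∈ skewPairs Λ V₂ i j →
          |diagDev h i + (10 * m) * h j i| < 5 * |h j i| := by
        intro m hm hmem
        rw [map_transvection] at hmem
        push_cast at hmem
        obtain ⟨h', ⟨hh', hlt⟩, e'⟩ := hmem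
        set t := SpecialLinearGroup.transvection hij (10 * (m : ℝ)) with ht
        have hW' := (hV₂ _ hh').2.2 i j hij ⟨m, hm⟩
        have e1 : t⁻¹ * h' * t⁻¹⁻¹ = h := by
          refine huniq _ hW' ?_
          simp only at e'
          rw [mul_smul, mul_smul, inv_inv, ← e', inv_smul_smul]
        have e2 : h' = t * h * t⁻¹ := by rw [← e1]; group
        rw [e2, Set.mem_ofPred_eq, ht, diagDev_conj_transvection_left,
          conj_transvection_apply_ji] at hlt
        exact hlt
      have h1 := abs_lt.1 (hval k hk hqk)
      have h2 := abs_lt.1 (hval l hl hql)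
      have h3 : |(10 * ((k : ℝ) - l)) * h j i| < 10 * |h j i| :=
        abs_lt.2 ⟨by linarith, by linarith⟩
      have h4 : (1 : ℝ) ≤ |(k : ℝ) - l| := by
        have : (1 : ℤ) ≤ |(k : ℤ) - l| := Int.one_le_abs (by omega)
        exact_mod_cast this
      rw [abs_mul, abs_mul, abs_of_pos (by norm_num : (0 : ℝ) < 10)] at h3
      nlinarith [abs_nonneg (h j i)]
  set P := {p : Fin n × Fin n // p.1 ≠ p.2}
  set T : P → (SpecialLinearGroup (Fin n) ℝ ⧸ Λ) × (SpecialLinearGroup (Fin n) ℝ ⧸ Λ) →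
      (SpecialLinearGroup (Fin n) ℝ ⧸ Λ) × (SpecialLinearGroup (Fin n) ℝ ⧸ Λ) := fun p q =>
    (SpecialLinearGroup.map (Int.castRingHom ℝ) (SpecialLinearGroup.transvection p.2 (1 : ℤ)) • q.1,
      SpecialLinearGroup.map (Int.castRingHom ℝ) (SpecialLinearGroup.transvection p.2 (1 : ℤ)) • q.2)
    with hT
  have hcover : {q : (SpecialLinearGroup (Fin n) ℝ ⧸ Λ) × (SpecialLinearGroup (Fin n) ℝ ⧸ Λ) |
      q.1 ≠ q.2} ⊆ B ∪ ⋃ p : P, (skewPairs Λ V₂ p.1.1 p.1.2 ∪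
        T p ⁻¹' skewPairs Λ V₂ p.1.2 p.1.1) := by
    intro q hq
    by_contra hcon
    simp only [Set.mem_union, Set.mem_iUnion, not_or, not_exists] at hcon
    obtain ⟨hqB, hcon⟩ := hcon
    obtain ⟨h, hh, e, -⟩ := hgood q hqB
    have h1 : h = 1 := by
      refine eq_one_of_diagDev_dominates hn h (hV₂ _ (hV _ hh).1).2.1 ?_ ?_
      · intro i j hij
        by_contra hlt
        exact (hcon ⟨(i, j), hij⟩).1 ⟨h, ⟨(hV _ hh).1, not_le.1 hlt⟩, e⟩
      · intro i j hij
        by_contra hlt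
        refine (hcon ⟨(i, j), hij⟩).2 ⟨_, ⟨(hV _ hh).2 i j hij, not_le.1 hlt⟩, ?_⟩
        simp only [hT, map_transvection, Int.cast_one]
        rw [mul_smul, mul_smul, inv_smul_smul, e]
    rw [h1, one_smul] at e
    exact hq e.symm
  have hterm : ∀ p : P, θ.real (skewPairs Λ V₂ p.1.1 p.1.2 ∪
        T p ⁻¹' skewPairs Λ V₂ p.1.2 p.1.1) ≤ 2 * (1 / K + 2 * δ) := by
    intro p
    refine (measureReal_union_le _ _).trans ?_
    have := (hθ (SpecialLinearGroup.transvection p.2 (1 : ℤ))).measureReal_preimage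
      (isOpen_skewPairs (Λ := Λ) hV₂o p.1.2 p.1.1).measurableSet.nullMeasurableSet
    rw [this]
    have h1 := hskew _ _ p.2
    have h2 := hskew _ _ p.2.symm
    linarith
  have hcard : (Fintype.card P : ℝ) ≤ n * n := by
    have : Fintype.card P ≤ n * n := (Fintype.card_subtype_le _).trans (by simp)
    exact_mod_cast this
  have hKδ : 0 ≤ 2 * (1 / K + 2 * δ) := by positivity
  calc θ.real {q | q.1 ≠ q.2} ≤ θ.real B + θ.real (⋃ p : P, (skewPairs Λ V₂ p.1.1 p.1.2 ∪
        T p ⁻¹' skewPairs Λ V₂ p.1.2 p.1.1)) :=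
        (measureReal_mono hcover).trans (measureReal_union_le _ _)
    _ ≤ 2 * δ + ∑ p : P, 2 * (1 / K + 2 * δ) :=
        add_le_add hB ((measureReal_iUnion_fintype_le _).trans
          (Finset.sum_le_sum fun p _ => hterm p))
    _ ≤ 2 * δ + (n * n) * (2 * (1 / K + 2 * δ)) := by
        rw [Finset.sum_const, Finset.card_univ, nsmul_eq_mul]
        gcongr
    _ = 2 * (n * n) / K + 2 * (2 * (n * n) + 1) * δ := by ring
    _ ≤ c / 2 + c / 2 := by
        refine add_le_add hK (le_of_eq ?_)
        rw [hδ]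
        field_simp
        ring
    _ = c := by ring

end Rigidity

section Bernoulli

variable {Γ I W Y : Type*} [MeasurableSpace W] [MeasurableSpace Y]

/-- Every measurable subset of `(I → W) × Y` is approximated by one depending on finitely many
coordinates in `I`. -/
theorem exists_cylinder_measureReal_symmDiff_lt (P : Measure ((I → W) × Y)) [IsFiniteMeasure P]
    {B : Set ((I → W) × Y)} (hB : MeasurableSet B) {ε : ℝ} (hε : 0 < ε) :
    ∃ (S : Finset I) (B' : Set ((S → W) × Y)), MeasurableSet B' ∧
      P.real (symmDiff B ((fun q => (S.restrict q.1, q.2)) ⁻¹' B')) < ε := by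
  classical
  set 𝒜 : Set (Set ((I → W) × Y)) := {A | ∃ (S : Finset I) (B' : Set ((S → W) × Y)),
    MeasurableSet B' ∧ A = (fun q => (S.restrict q.1, q.2)) ⁻¹' B'} with h𝒜
  have hr : ∀ {S T : Finset I} (h : S ⊆ T), Measurable fun q : (T → W) × Y =>
      (Finset.restrict₂ (π := fun _ => W) h q.1, q.2) := fun h =>
    (measurable_pi_lambda _ fun i =>
      (measurable_pi_apply _).comp measurable_fst).prodMk measurable_snd
  have halg : IsSetAlgebra 𝒜 := by
    refine ⟨⟨∅, ∅, .empty, rfl⟩, ?_, ?_⟩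
    · rintro _ ⟨S, B', hB', rfl⟩
      exact ⟨S, B'ᶜ, hB'.compl, rfl⟩
    · rintro _ _ ⟨S, B', hB', rfl⟩ ⟨T, B'', hB'', rfl⟩
      refine ⟨S ∪ T,
        (fun q => (Finset.restrict₂ (π := fun _ => W) Finset.subset_union_left q.1, q.2)) ⁻¹' B' ∪
        (fun q => (Finset.restrict₂ (π := fun _ => W) Finset.subset_union_right q.1, q.2)) ⁻¹' B'',
        ?_, rfl⟩
      refine MeasurableSet.union ?_ ?_
      · exact hB'.preimage (hr _)
      · exact hB''.preimage (hr _)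
  have hgen : (inferInstance : MeasurableSpace ((I → W) × Y)) =
      MeasurableSpace.generateFrom 𝒜 := by
    refine le_antisymm ?_ (MeasurableSpace.generateFrom_le ?_)
    · have h1 : @Measurable _ _ (MeasurableSpace.generateFrom 𝒜) _
          (Prod.fst : (I → W) × Y → I → W) := by
        refine @measurable_pi_lambda _ _ _ (MeasurableSpace.generateFrom 𝒜) _ _ fun i => ?_
        intro A hA
        refine MeasurableSpace.measurableSet_generateFrom ⟨{i},
          (fun q => q.1 ⟨i, Finset.mem_singleton_self i⟩) ⁻¹' A, ?_, rfl⟩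
        exact ((measurable_pi_apply _).comp measurable_fst) hA
      have h2 : @Measurable _ _ (MeasurableSpace.generateFrom 𝒜) _
          (Prod.snd : (I → W) × Y → Y) := by
        intro A hA
        exact MeasurableSpace.measurableSet_generateFrom ⟨∅, Prod.snd ⁻¹' A, measurable_snd hA, rfl⟩
      intro A hA
      have h3 : @Measurable _ _ (MeasurableSpace.generateFrom 𝒜) _
          (fun q : (I → W) × Y => (q.1, q.2)) := h1.prodMk h2
      exact h3 hA
    · rintro _ ⟨S, B', hB', rfl⟩
      exact (((Finset.measurable_restrict S).comp measurable_fst).prodMk measurable_snd) hB'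
  obtain ⟨_, ⟨S, B', hB', rfl⟩, hlt⟩ :=
    (Measure.MeasureDense.of_generateFrom_isSetAlgebra_finite (μ := P) halg hgen).approx B hB
      (measure_ne_top _ _) ε hε
  exact ⟨S, B', hB', (ENNReal.lt_ofReal_iff_toReal_lt (measure_ne_top _ _)).1 hlt⟩

/-- If all orbits are infinite, some group element moves a given finite set off itself. -/
theorem exists_forall_smul_notMem [Group Γ] [MulAction Γ I]
    (horb : ∀ i : I, (MulAction.orbit Γ i).Infinite) (S : Finset I) :
    ∃ γ : Γ, ∀ i ∈ S, γ • i ∉ S := by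
  classical
  by_contra! hcon
  choose t ht using fun q : I × I => em (∃ γ : Γ, γ • q.1 = q.2) |>.elim
    (fun ⟨γ, h⟩ => (⟨γ, fun _ => h⟩ : ∃ γ : Γ, (∃ γ : Γ, γ • q.1 = q.2) → γ • q.1 = q.2))
    (fun h => ⟨1, fun h' => absurd h' h⟩)
  obtain ⟨q, hq, hfin⟩ := Subgroup.exists_finiteIndex_of_leftCoset_cover
    (s := S ×ˢ S) (H := fun q : I × I => MulAction.stabilizer Γ q.1) (g := t) (by
      refine Set.eq_univ_of_forall fun γ => ?_
      obtain ⟨i, hi, hi'⟩ := hcon γ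
      refine Set.mem_iUnion₂.2 ⟨(i, γ • i), Finset.mk_mem_product hi hi', ?_⟩
      rw [mem_leftCoset_iff, SetLike.mem_coe, MulAction.mem_stabilizer_iff, mul_smul,
        inv_smul_eq_iff, ht (i, γ • i) ⟨γ, rfl⟩])
  refine horb q.1 ?_
  have : Finite (Γ ⧸ MulAction.stabilizer Γ q.1) := Subgroup.finite_quotient_of_finiteIndex
  exact Set.finite_coe_iff.1
    (Finite.of_equiv _ (MulAction.orbitEquivQuotientStabilizer Γ q.1).symm)

theorem measureReal_prod_eq_integral {X : Type*} [MeasurableSpace X] (Q : Measure X) (ν : Measure Y)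
    [IsProbabilityMeasure Q] [IsProbabilityMeasure ν] {D : Set (X × Y)} (hD : MeasurableSet D) :
    (Q.prod ν).real D = ∫ y, Q.real ((fun x => (x, y)) ⁻¹' D) ∂ν := by
  simp only [measureReal_def]
  rw [Measure.prod_apply_symm hD, integral_toReal]
  · exact (measurable_measure_prodMk_right hD).aemeasurable
  · exact .of_forall fun _ => measure_lt_top _ _

theorem measurable_measureReal_section {X : Type*} [MeasurableSpace X] (Q : Measure X)
    [IsProbabilityMeasure Q] {D : Set (X × Y)} (hD : MeasurableSet D) :
    Measurable fun y => Q.real ((fun x => (x, y)) ⁻¹' D) :=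
  (measurable_measure_prodMk_right hD).ennreal_toReal

/-- The skew action of `γ` on `(I → W) × Y`: the generalized Bernoulli shift on the first factor and
the given action on the second. -/
def bernoulliSkew (W : Type*) [Group Γ] [MulAction Γ I] [MulAction Γ Y] (γ : Γ)
    (q : (I → W) × Y) : (I → W) × Y :=
  (fun i => q.1 (γ⁻¹ • i), γ • q.2)

variable [Group Γ] [MulAction Γ I] [MulAction Γ Y] (κ : Measure W) [IsProbabilityMeasure κ]
  (ν : Measure Y) [IsProbabilityMeasure ν]

theorem measurePreserving_bernoulliShift (γ : Γ) :
    MeasurePreserving (fun (w : I → W) i => w (γ⁻¹ • i)) (Measure.infinitePi fun _ : I => κ)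
      (Measure.infinitePi fun _ : I => κ) :=
  ⟨by fun_prop, Measure.map_infinitePi_infinitePi_of_inj (P := fun _ : I => κ)
    (MulAction.injective γ⁻¹)⟩

theorem measurePreserving_bernoulliSkew {γ : Γ}
    (hγ : MeasurePreserving (fun y : Y => γ • y) ν ν) :
    MeasurePreserving (bernoulliSkew (I := I) W γ) ((Measure.infinitePi fun _ : I => κ).prod ν)
      ((Measure.infinitePi fun _ : I => κ).prod ν) :=
  (measurePreserving_bernoulliShift κ γ).prod hγ

theorem measureReal_cylinder_inter_shift {S : Finset I} {γ : Γ} (hγ : ∀ i ∈ S, γ⁻¹ • i ∉ S)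
    {A B : Set (S → W)} (hA : MeasurableSet A) (hB : MeasurableSet B) :
    (Measure.infinitePi fun _ : I => κ).real
        (S.restrict ⁻¹' A ∩ (fun w : I → W => S.restrict fun i => w (γ⁻¹ • i)) ⁻¹' B) =
      (Measure.infinitePi fun _ : I => κ).real (S.restrict ⁻¹' A) *
        (Measure.infinitePi fun _ : I => κ).real (S.restrict ⁻¹' B) := by
  classical
  have hind := ProbabilityTheory.iIndepFun_infinitePi (P := fun _ : I => κ)
    (X := fun _ w => w) (fun _ => measurable_id)
  have hdisj : Disjoint S (S.image fun i => γ⁻¹ • i) := by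
    rw [Finset.disjoint_right]
    intro i hi
    obtain ⟨j, hj, rfl⟩ := Finset.mem_image.1 hi
    exact hγ j hj
  have h2 := hind.indepFun_finset S (S.image fun i => γ⁻¹ • i) hdisj
    (fun i => measurable_pi_apply i)
  have h3 := h2.comp (φ := id) (ψ := fun (v : (S.image fun i => γ⁻¹ • i) → W) (i : S) =>
    v ⟨γ⁻¹ • (i : I), Finset.mem_image_of_mem _ i.2⟩) measurable_id (by fun_prop)
  have h4 := h3.measure_inter_preimage_eq_mul A B hA hB
  have h5 := (measurePreserving_bernoulliShift (I := I) κ γ).measureReal_preimage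
    (s := S.restrict ⁻¹' B) ((Finset.measurable_restrict S) hB).nullMeasurableSet
  rw [← h5]
  simp only [measureReal_def, ← ENNReal.toReal_mul]
  congr 1

/-- **Zero-one law**: a set invariant under the skew Bernoulli action with infinite orbits depends
almost surely only on the second coordinate. -/
theorem ae_measureReal_section_eq_zero_or_one (horb : ∀ i : I, (MulAction.orbit Γ i).Infinite)
    (hY : ∀ γ : Γ, MeasurePreserving (fun y : Y => γ • y) ν ν)
    {D : Set ((I → W) × Y)} (hD : MeasurableSet D)
    (hinv : ∀ γ : Γ, bernoulliSkew W γ ⁻¹' D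
      =ᵐ[(Measure.infinitePi fun _ : I => κ).prod ν] D) :
    ∀ᵐ y ∂ν, (Measure.infinitePi fun _ : I => κ).real ((fun w => (w, y)) ⁻¹' D) = 0 ∨
      (Measure.infinitePi fun _ : I => κ).real ((fun w => (w, y)) ⁻¹' D) = 1 := by
  classical
  set Q := Measure.infinitePi fun _ : I => κ with hQ
  set g : Y → ℝ := fun y => Q.real ((fun w => (w, y)) ⁻¹' D) with hg
  have hInt : ∀ {E : Set ((I → W) × Y)}, MeasurableSet E →
      Integrable (fun y => Q.real ((fun w => (w, y)) ⁻¹' E)) ν := fun hE =>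
    .of_bound (measurable_measureReal_section Q hE).aestronglyMeasurable 1
      (.of_forall fun y => by
        rw [Real.norm_of_nonneg measureReal_nonneg]; exact measureReal_le_one)
  have hInt2 : ∀ {E : Set ((I → W) × Y)}, MeasurableSet E →
      Integrable (fun y => Q.real ((fun w => (w, y)) ⁻¹' E) ^ 2) ν := fun hE =>
    .of_bound ((measurable_measureReal_section Q hE).pow_const 2).aestronglyMeasurable 1
      (.of_forall fun y => by
        rw [Real.norm_of_nonneg (sq_nonneg _)]
        exact pow_le_one₀ measureReal_nonneg measureReal_le_one)
  have hkey : ∀ ε > 0, ∫ y, g y ∂ν ≤ ∫ y, g y ^ 2 ∂ν + 4 * ε := by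
    intro ε hε
    obtain ⟨S, B, hB, hlt⟩ := exists_cylinder_measureReal_symmDiff_lt (Q.prod ν) hD hε
    obtain ⟨γ, hγ⟩ := exists_forall_smul_notMem horb S
    have hγ' : ∀ i ∈ S, γ⁻¹ • i ∉ S := fun i hi hi' => hγ _ hi' (by rwa [smul_inv_smul])
    set D' : Set ((I → W) × Y) := (fun q => (S.restrict q.1, q.2)) ⁻¹' B with hD'
    have hD'm : MeasurableSet D' := hB.preimage (by fun_prop)
    have hT := measurePreserving_bernoulliSkew (I := I) κ ν (hY γ)
    have hEm := hD.symmDiff hD'm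
    have h1 : (Q.prod ν).real D ≤ (Q.prod ν).real (D' ∩ bernoulliSkew W γ ⁻¹' D') + 2 * ε := by
      have e1 : (Q.prod ν).real D = (Q.prod ν).real (D ∩ bernoulliSkew W γ ⁻¹' D) := by
        refine measureReal_congr ?_
        have := (ae_eq_refl D).inter (hinv γ)
        rw [Set.inter_self] at this
        exact this.symm
      have e2 : D ∩ bernoulliSkew W γ ⁻¹' D ⊆ (D' ∩ bernoulliSkew W γ ⁻¹' D') ∪
          (symmDiff D D' ∪ bernoulliSkew W γ ⁻¹' symmDiff D D') := by
        rintro q ⟨hq1, hq2⟩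
        by_cases h1 : q ∈ D'
        · by_cases h2 : bernoulliSkew W γ q ∈ D'
          · exact Or.inl ⟨h1, h2⟩
          · exact Or.inr (Or.inr (Or.inl ⟨hq2, h2⟩))
        · exact Or.inr (Or.inl (Or.inl ⟨hq1, h1⟩))
      have e3 := hT.measureReal_preimage hEm.nullMeasurableSet
      rw [e1]
      refine (measureReal_mono e2).trans ((measureReal_union_le _ _).trans ?_)
      have := measureReal_union_le (μ := Q.prod ν) (symmDiff D D')
        (bernoulliSkew W γ ⁻¹' symmDiff D D')
      rw [e3] at this
      linarith
    set g' : Y → ℝ := fun y => Q.real ((fun w => (w, y)) ⁻¹' D') with hg'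
    have h2 : (Q.prod ν).real (D' ∩ bernoulliSkew W γ ⁻¹' D') = ∫ y, g' y * g' (γ • y) ∂ν := by
      rw [measureReal_prod_eq_integral Q ν (hD'm.inter (hT.measurable hD'm))]
      refine integral_congr_ae (.of_forall fun y => ?_)
      exact measureReal_cylinder_inter_shift κ hγ'
        (A := (fun v => (v, y)) ⁻¹' B) (B := (fun v => (v, γ • y)) ⁻¹' B)
        (hB.preimage (by fun_prop)) (hB.preimage (by fun_prop))
    have h3 : ∫ y, g' y * g' (γ • y) ∂ν ≤ ∫ y, g' y ^ 2 ∂ν := by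
      have hi := hInt2 hD'm
      have hi' : Integrable (fun y => g' (γ • y) ^ 2) ν :=
        (hY γ).integrable_comp_of_integrable (g := fun y => g' y ^ 2) hi
      have e : ∫ y, g' (γ • y) ^ 2 ∂ν = ∫ y, g' y ^ 2 ∂ν := by
        have := integral_map (μ := ν) (hY γ).measurable.aemeasurable
          (f := fun y => g' y ^ 2) (by rw [(hY γ).map_eq]; exact hi.aestronglyMeasurable)
        rw [(hY γ).map_eq] at this
        exact this.symm
      calc ∫ y, g' y * g' (γ • y) ∂ν ≤ ∫ y, (1 / 2 : ℝ) * (g' y ^ 2 + g' (γ • y) ^ 2) ∂ν := by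
            refine integral_mono_of_nonneg (.of_forall fun y =>
              mul_nonneg measureReal_nonneg measureReal_nonneg)
              ((hi.add hi').const_mul _) (.of_forall fun y => ?_)
            simp only
            nlinarith [sq_nonneg (g' y - g' (γ • y))]
        _ = ∫ y, g' y ^ 2 ∂ν := by
            rw [integral_const_mul, integral_add hi hi', e]
            ring
    have h4 : ∫ y, g' y ^ 2 ∂ν ≤ ∫ y, g y ^ 2 ∂ν + 2 * ε := by
      have e : ∫ y, Q.real ((fun w => (w, y)) ⁻¹' symmDiff D D') ∂ν < ε := by
        rw [← measureReal_prod_eq_integral Q ν hEm]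
        exact hlt
      calc ∫ y, g' y ^ 2 ∂ν ≤
          ∫ y, (g y ^ 2 + 2 * Q.real ((fun w => (w, y)) ⁻¹' symmDiff D D')) ∂ν := by
            refine integral_mono (hInt2 hD'm) ((hInt2 hD).add ((hInt hEm).const_mul 2)) fun y => ?_
            have hm : Measurable fun w : I → W => (w, y) := by fun_prop
            have h := abs_measureReal_sub_le_measureReal_symmDiff (μ := Q)
              (hm hD).nullMeasurableSet (hm hD'm).nullMeasurableSet
            have h' := abs_le.1 h
            have a0 : 0 ≤ g y := measureReal_nonneg
            have b0 : 0 ≤ g' y := measureReal_nonneg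
            have a1 : g y ≤ 1 := measureReal_le_one
            have b1 : g' y ≤ 1 := measureReal_le_one
            have hs : g' y - g y ≤ Q.real ((fun w => (w, y)) ⁻¹' symmDiff D D') := by
              have := h'.1
              change -Q.real ((fun w => (w, y)) ⁻¹' symmDiff D D') ≤ g y - g' y at this
              linarith
            have hs0 : 0 ≤ Q.real ((fun w => (w, y)) ⁻¹' symmDiff D D') := measureReal_nonneg
            simp only
            nlinarith
        _ = ∫ y, g y ^ 2 ∂ν + 2 * ∫ y, Q.real ((fun w => (w, y)) ⁻¹' symmDiff D D') ∂ν := by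
            rw [integral_add (hInt2 hD) ((hInt hEm).const_mul 2), integral_const_mul]
        _ ≤ _ := by linarith
    have h5 := measureReal_prod_eq_integral Q ν hD
    rw [← h5]
    linarith
  have hle : ∫ y, g y ∂ν ≤ ∫ y, g y ^ 2 ∂ν :=
    le_of_forall_pos_le_add fun ε hε => by
      have := hkey (ε / 4) (by positivity)
      linarith
  have hnn : 0 ≤ᵐ[ν] fun y => g y - g y ^ 2 := .of_forall fun y => by
    have a0 : 0 ≤ g y := measureReal_nonneg
    have a1 : g y ≤ 1 := measureReal_le_one
    simp only [Pi.zero_apply]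
    nlinarith
  have hz : ∫ y, (g y - g y ^ 2) ∂ν = 0 := by
    refine le_antisymm ?_ (integral_nonneg_of_ae hnn)
    rw [integral_sub (hInt hD) (hInt2 hD)]
    linarith
  filter_upwards [(integral_eq_zero_iff_of_nonneg_ae hnn ((hInt hD).sub (hInt2 hD))).1 hz]
    with y hy
  have : g y * (1 - g y) = 0 := by
    simp only [Pi.zero_apply] at hy
    linarith
  rcases mul_eq_zero.1 this with h | h
  · exact Or.inl h
  · exact Or.inr (by change g y = 1; linarith)

end Bernoulli

section Interpolation

variable {I X₀ Y : Type*} [MeasurableSpace X₀] [MeasurableSpace Y]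

theorem map_infinitePi_prodMk (μ₁ μ₂ : Measure X₀) [IsProbabilityMeasure μ₁]
    [IsProbabilityMeasure μ₂] :
    (Measure.infinitePi fun _ : I => μ₁.prod μ₂).map
        (fun w => (fun i => (w i).1, fun i => (w i).2)) =
      (Measure.infinitePi fun _ : I => μ₁).prod (Measure.infinitePi fun _ : I => μ₂) := by
  classical
  have hspan : ∀ (m : Measure (I → X₀)) [IsFiniteMeasure m], m.FiniteSpanningSetsIn
      (squareCylinders fun _ : I => {s : Set X₀ | MeasurableSet s}) := fun m _ =>
    ⟨fun _ => Set.univ, fun _ => ⟨∅, fun _ => Set.univ, by simp, by simp⟩,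
      fun _ => measure_lt_top _ _, Set.iUnion_const _⟩
  symm
  refine Measure.prod_eq_generateFrom generateFrom_squareCylinders generateFrom_squareCylinders
    (isPiSystem_squareCylinders (fun _ => MeasurableSpace.isPiSystem_measurableSet) (by simp))
    (isPiSystem_squareCylinders (fun _ => MeasurableSpace.isPiSystem_measurableSet) (by simp))
    (hspan _) (hspan _) ?_
  rintro _ ⟨S, s, hs, rfl⟩ _ ⟨T, t, ht, rfl⟩
  have hs' : ∀ i, MeasurableSet (s i) := fun i => hs i trivial
  have ht' : ∀ i, MeasurableSet (t i) := fun i => ht i trivial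
  set s' : I → Set X₀ := fun i => if i ∈ S then s i else Set.univ with hs'def
  set t' : I → Set X₀ := fun i => if i ∈ T then t i else Set.univ with ht'def
  have hs'm : ∀ i, MeasurableSet (s' i) := fun i => by
    simp only [hs'def]; split_ifs; exacts [hs' i, .univ]
  have ht'm : ∀ i, MeasurableSet (t' i) := fun i => by
    simp only [ht'def]; split_ifs; exacts [ht' i, .univ]
  have es : (S : Set I).pi s = ((S ∪ T : Finset I) : Set I).pi s' := by
    ext x
    simp only [Set.mem_pi, Finset.mem_coe, Finset.mem_union, hs'def]
    refine ⟨fun h i _ => ?_, fun h i hi => by simpa [hi] using h i (Or.inl hi)⟩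
    split_ifs with hi
    exacts [h i hi, trivial]
  have et : (T : Set I).pi t = ((S ∪ T : Finset I) : Set I).pi t' := by
    ext x
    simp only [Set.mem_pi, Finset.mem_coe, Finset.mem_union, ht'def]
    refine ⟨fun h i _ => ?_, fun h i hi => by simpa [hi] using h i (Or.inr hi)⟩
    split_ifs with hi
    exacts [h i hi, trivial]
  have hpre : (fun w : I → X₀ × X₀ => (fun i => (w i).1, fun i => (w i).2)) ⁻¹'
      ((((S ∪ T : Finset I) : Set I).pi s') ×ˢ (((S ∪ T : Finset I) : Set I).pi t')) =
      ((S ∪ T : Finset I) : Set I).pi fun i => s' i ×ˢ t' i := by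
    ext w
    simp only [Set.mem_preimage, Set.mem_prod, Set.mem_pi]
    exact ⟨fun h i hi => ⟨h.1 i hi, h.2 i hi⟩, fun h => ⟨fun i hi => (h i hi).1,
      fun i hi => (h i hi).2⟩⟩
  rw [es, et, Measure.map_apply (by fun_prop)
    ((MeasurableSet.pi (Finset.countable_toSet _) fun i _ => hs'm i).prod
      (MeasurableSet.pi (Finset.countable_toSet _) fun i _ => ht'm i)), hpre,
    Measure.infinitePi_pi _ fun i _ => (hs'm i).prod (ht'm i),
    Measure.infinitePi_pi _ fun i _ => hs'm i, Measure.infinitePi_pi _ fun i _ => ht'm i,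
    ← Finset.prod_mul_distrib]
  simp only [Measure.prod_prod]

/-- The point of the interpolation between `w.1.1` and `w.1.2` at time `k`: the switch from the
former to the latter takes place right after time `w.2`. -/
def interp (X₀ : Type*) (M k : ℕ) (w : (X₀ × X₀) × Fin (M + 1)) : X₀ :=
  if (w.2 : ℕ) < k then w.1.2 else w.1.1

/-- Two independent points of `X₀` together with an independent uniform switching time. -/
noncomputable def interpMeasure (μ₀ : Measure X₀) (M : ℕ) : Measure ((X₀ × X₀) × Fin (M + 1)) :=
  (μ₀.prod μ₀).prod (PMF.uniformOfFintype (Fin (M + 1))).toMeasure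

variable (μ₀ : Measure X₀) [IsProbabilityMeasure μ₀] (M : ℕ)

instance : IsProbabilityMeasure (interpMeasure μ₀ M) := by
  unfold interpMeasure
  infer_instance

@[fun_prop]
theorem measurable_interp (k : ℕ) : Measurable (interp X₀ M k) := by
  refine measurable_from_prod_countable_left fun u => ?_
  unfold interp
  dsimp only
  split_ifs
  exacts [measurable_snd, measurable_fst]

theorem interpMeasure_apply {A : Set ((X₀ × X₀) × Fin (M + 1))} (hA : MeasurableSet A) :
    interpMeasure μ₀ M A =
      ∑ u : Fin (M + 1), (μ₀.prod μ₀) ((fun a => (a, u)) ⁻¹' A) * ((M + 1 : ℕ) : ENNReal)⁻¹ := by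
  rw [interpMeasure, Measure.prod_apply_symm hA, lintegral_fintype]
  simp

theorem interpMeasure_zero_time :
    (interpMeasure μ₀ M).real {w | w.2 = 0} = 1 / (M + 1 : ℕ) := by
  have : {w : (X₀ × X₀) × Fin (M + 1) | w.2 = 0} = Set.univ ×ˢ {0} := by ext; simp
  rw [this, measureReal_def, interpMeasure, Measure.prod_prod,
    PMF.toMeasure_apply_singleton _ _ (measurableSet_singleton _)]
  simp only [measure_univ, one_mul, PMF.uniformOfFintype_apply, Fintype.card_fin,
    ENNReal.toReal_inv, ENNReal.toReal_natCast, one_div]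

theorem map_interp (k : ℕ) : (interpMeasure μ₀ M).map (interp X₀ M k) = μ₀ := by
  ext A hA
  rw [Measure.map_apply (by fun_prop) hA,
    interpMeasure_apply _ _ ((measurable_interp M k) hA)]
  have : ∀ u : Fin (M + 1),
      (μ₀.prod μ₀) ((fun a => (a, u)) ⁻¹' (interp X₀ M k ⁻¹' A)) = μ₀ A := by
    intro u
    by_cases h : (u : ℕ) < k
    · have : (fun a => (a, u)) ⁻¹' (interp X₀ M k ⁻¹' A) = Set.univ ×ˢ A := by
        ext; simp [interp, h]
      rw [this, Measure.prod_prod, measure_univ, one_mul]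
    · have : (fun a => (a, u)) ⁻¹' (interp X₀ M k ⁻¹' A) = A ×ˢ Set.univ := by
        ext; simp [interp, h]
      rw [this, Measure.prod_prod, measure_univ, mul_one]
  simp only [this, Finset.sum_const, Finset.card_univ, Fintype.card_fin, nsmul_eq_mul]
  rw [mul_comm, mul_assoc, ENNReal.inv_mul_cancel (by simp) (by finiteness), mul_one]

theorem map_interp_succ {k : ℕ} (hk : k < M + 1) :
    (interpMeasure μ₀ M).map (fun w => (interp X₀ M k w, interp X₀ M (k + 1) w)) =
      (interpMeasure μ₀ M).map (fun w => (interp X₀ M 0 w, interp X₀ M (0 + 1) w)) := by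
  have key : ∀ {k : ℕ} (hk : k < M + 1) {A : Set (X₀ × X₀)}, MeasurableSet A →
      (interpMeasure μ₀ M).map (fun w => (interp X₀ M k w, interp X₀ M (k + 1) w)) A =
      ∑ u : Fin (M + 1), (if u = ⟨k, hk⟩ then (μ₀.prod μ₀) A else
        μ₀ ((fun x => (x, x)) ⁻¹' A)) * ((M + 1 : ℕ) : ENNReal)⁻¹ := by
    intro k hk A hA
    have hm : Measurable fun w : (X₀ × X₀) × Fin (M + 1) =>
      (interp X₀ M k w, interp X₀ M (k + 1) w) := by fun_prop
    have hdm : MeasurableSet ((fun x : X₀ => (x, x)) ⁻¹' A) := hA.preimage (by fun_prop)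
    rw [Measure.map_apply hm hA, interpMeasure_apply _ _ (hm hA)]
    refine Finset.sum_congr rfl fun u _ => ?_
    congr 1
    split_ifs with h
    · subst h
      congr 1
      ext a
      simp [interp]
    · rcases lt_or_gt_of_ne (fun h' => h (Fin.ext h') : (u : ℕ) ≠ k) with h1 | h1
      · have : (fun a => (a, u)) ⁻¹'
            ((fun w => (interp X₀ M k w, interp X₀ M (k + 1) w)) ⁻¹' A) =
            Set.univ ×ˢ ((fun x => (x, x)) ⁻¹' A) := by
          ext; simp [interp, h1, h1.le]
        rw [this, Measure.prod_prod, measure_univ, one_mul]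
      · have : (fun a => (a, u)) ⁻¹'
            ((fun w => (interp X₀ M k w, interp X₀ M (k + 1) w)) ⁻¹' A) =
            ((fun x => (x, x)) ⁻¹' A) ×ˢ Set.univ := by
          ext; simp [interp, h1.not_gt, h1.not_ge]
        rw [this, Measure.prod_prod, measure_univ, mul_one]
  ext A hA
  rw [key hk hA, key (Nat.succ_pos M) hA]
  rw [← Equiv.sum_comp (Equiv.swap (⟨k, hk⟩ : Fin (M + 1)) ⟨0, Nat.succ_pos M⟩)]
  refine Finset.sum_congr rfl fun u _ => ?_
  congr 2
  rw [Equiv.swap_apply_eq_iff, Equiv.swap_apply_left]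

/-- Coordinatewise interpolation. -/
def interpPi (X₀ : Type*) (M k : ℕ) (w : I → (X₀ × X₀) × Fin (M + 1)) : I → X₀ :=
  fun i => interp X₀ M k (w i)

@[fun_prop]
theorem measurable_interpPi (k : ℕ) : Measurable (interpPi (I := I) X₀ M k) := by
  unfold interpPi
  fun_prop

theorem measurePreserving_interpPi (k : ℕ) :
    MeasurePreserving (interpPi X₀ M k) (Measure.infinitePi fun _ : I => interpMeasure μ₀ M)
      (Measure.infinitePi fun _ : I => μ₀) := by
  refine ⟨by fun_prop, ?_⟩
  have := Measure.infinitePi_map_pi (fun _ : I => interpMeasure μ₀ M)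
    (f := fun _ => interp X₀ M k) (fun _ => measurable_interp M k)
  simp only [map_interp] at this
  exact this

theorem map_interpPi_succ {k : ℕ} (hk : k < M + 1) :
    (Measure.infinitePi fun _ : I => interpMeasure μ₀ M).map
        (fun w => (interpPi X₀ M k w, interpPi X₀ M (k + 1) w)) =
      (Measure.infinitePi fun _ : I => interpMeasure μ₀ M).map
        (fun w => (interpPi X₀ M 0 w, interpPi X₀ M (0 + 1) w)) := by
  have key : ∀ k : ℕ, (Measure.infinitePi fun _ : I => interpMeasure μ₀ M).map
      (fun w => (interpPi X₀ M k w, interpPi X₀ M (k + 1) w)) =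
      ((Measure.infinitePi fun _ : I => interpMeasure μ₀ M).map
        (fun w i => (interp X₀ M k (w i), interp X₀ M (k + 1) (w i)))).map
        (fun w => (fun i => (w i).1, fun i => (w i).2)) := by
    intro k
    rw [Measure.map_map (by fun_prop) (by fun_prop)]
    rfl
  rw [key k, key 0]
  congr 1
  have h := fun k => Measure.infinitePi_map_pi (fun _ : I => interpMeasure μ₀ M)
    (f := fun _ w => (interp X₀ M k w, interp X₀ M (k + 1) w)) (fun _ => by fun_prop)
  rw [h k, h 0]
  simp only [map_interp_succ μ₀ M hk]

theorem map_interpPi_zero_last :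
    (Measure.infinitePi fun _ : I => interpMeasure μ₀ M).map
        (fun w => (interpPi X₀ M 0 w, interpPi X₀ M (M + 1) w)) =
      (Measure.infinitePi fun _ : I => μ₀).prod (Measure.infinitePi fun _ : I => μ₀) := by
  rw [← map_infinitePi_prodMk]
  have h := Measure.infinitePi_map_pi (fun _ : I => interpMeasure μ₀ M)
    (f := fun _ => Prod.fst) (fun _ => measurable_fst)
  have h1 : (interpMeasure μ₀ M).map Prod.fst = μ₀.prod μ₀ := by
    rw [interpMeasure, Measure.map_fst_prod, measure_univ, one_smul]
  simp only [h1] at h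
  rw [← h, Measure.map_map (by fun_prop) (by fun_prop)]
  congr 1
  funext w
  refine Prod.ext (funext fun i => ?_) (funext fun i => ?_)
  · simp [interpPi, interp]
  · simp [interpPi, interp, (Nat.lt_succ_iff.1 (w i).2.isLt)]

/-- One step of a fine interpolation rarely leaves a given measurable set. -/
theorem eventually_measureReal_interpPi_escape_le (ν : Measure Y) [IsProbabilityMeasure ν]
    {B : Set ((I → X₀) × Y)} (hB : MeasurableSet B) {ε : ℝ} (hε : 0 < ε) :
    ∀ᶠ M : ℕ in atTop, ((Measure.infinitePi fun _ : I => interpMeasure μ₀ M).prod ν).real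
      {q | (interpPi X₀ M 0 q.1, q.2) ∈ B ∧ (interpPi X₀ M 1 q.1, q.2) ∉ B} ≤ ε := by
  classical
  obtain ⟨S, B', hB', hlt⟩ := exists_cylinder_measureReal_symmDiff_lt
    ((Measure.infinitePi fun _ : I => μ₀).prod ν) hB (show 0 < ε / 4 by positivity)
  set D : Set ((I → X₀) × Y) := (fun q => (S.restrict q.1, q.2)) ⁻¹' B' with hD
  have hDm : MeasurableSet D := hB'.preimage (by fun_prop)
  obtain ⟨M₀, hM₀⟩ := exists_nat_gt ((S.card : ℝ) / (ε / 2))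
  filter_upwards [eventually_ge_atTop M₀] with M hM
  set P := (Measure.infinitePi fun _ : I => interpMeasure μ₀ M).prod ν with hP
  have hpres : ∀ k, P.real ((fun q => (interpPi X₀ M k q.1, q.2)) ⁻¹' symmDiff B D) < ε / 4 := by
    intro k
    have h := ((measurePreserving_interpPi (I := I) μ₀ M k).prod
      (MeasurePreserving.id ν)).measureReal_preimage (hB.symmDiff hDm).nullMeasurableSet
    exact h.trans_lt hlt
  have hzero : ∀ i, P.real {q | (q.1 i).2 = 0} = 1 / (M + 1 : ℕ) := by
    intro i
    have h1 : MeasurableSet {w : (X₀ × X₀) × Fin (M + 1) | w.2 = 0} :=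
      measurable_snd (measurableSet_singleton 0)
    have h2 := ((measurePreserving_eval_infinitePi (fun _ : I => interpMeasure μ₀ M) i).comp
      (measurePreserving_fst (ν := ν))).measureReal_preimage h1.nullMeasurableSet
    rw [interpMeasure_zero_time] at h2
    exact h2
  have hsub : {q : (I → (X₀ × X₀) × Fin (M + 1)) × Y |
      (interpPi X₀ M 0 q.1, q.2) ∈ B ∧ (interpPi X₀ M 1 q.1, q.2) ∉ B} ⊆
      ((fun q => (interpPi X₀ M 0 q.1, q.2)) ⁻¹' symmDiff B D ∪
        (fun q => (interpPi X₀ M 1 q.1, q.2)) ⁻¹' symmDiff B D) ∪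
        ⋃ i ∈ S, {q | (q.1 i).2 = 0} := by
    rintro q ⟨h0, h1⟩
    by_contra hcon
    simp only [Set.mem_union, Set.mem_preimage, Set.mem_iUnion, not_or, not_exists] at hcon
    obtain ⟨⟨hc0, hc1⟩, hc⟩ := hcon
    have d0 : (interpPi X₀ M 0 q.1, q.2) ∈ D := by
      by_contra h; exact hc0 (Or.inl ⟨h0, h⟩)
    have d1 : (interpPi X₀ M 1 q.1, q.2) ∉ D := fun h => hc1 (Or.inr ⟨h, h1⟩)
    refine d1 ?_
    have e : S.restrict (interpPi X₀ M 1 q.1) = S.restrict (interpPi X₀ M 0 q.1) := by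
      funext i
      have : (q.1 i).2 ≠ 0 := hc i i.2
      simp [interpPi, interp, this]
    change (S.restrict (interpPi X₀ M 1 q.1), q.2) ∈ B'
    rw [e]
    exact d0
  have hfin : P.real (⋃ i ∈ S, {q | (q.1 i).2 = 0}) ≤ S.card * (1 / (M + 1 : ℕ)) := by
    refine (measureReal_biUnion_finset_le _ _).trans ?_
    rw [Finset.sum_congr rfl fun i _ => hzero i, Finset.sum_const, nsmul_eq_mul]
  have hsmall : (S.card : ℝ) * (1 / (M + 1 : ℕ)) ≤ ε / 2 := by
    have hM' : (M₀ : ℝ) ≤ (M + 1 : ℕ) := by exact_mod_cast hM.trans (Nat.le_succ M)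
    have h0 : (0 : ℝ) < (M + 1 : ℕ) := by positivity
    rw [mul_one_div, div_le_iff₀ h0]
    rw [div_lt_iff₀ (by positivity)] at hM₀
    nlinarith
  have h := (measureReal_mono (μ := P) hsub).trans ((measureReal_union_le _ _).trans
    (add_le_add_left (measureReal_union_le _ _) _))
  have a0 := hpres 0
  have a1 := hpres 1
  linarith

end Interpolation

section Final

/-- A neighbourhood of the diagonal contains finitely many squares of sets covering almost all of
the space. -/
theorem exists_squares_subset_measureReal_compl_le {Z : Type*} [TopologicalSpace Z]
    [SecondCountableTopology Z] [MeasurableSpace Z] [OpensMeasurableSpace Z] (η : Measure Z)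
    [IsProbabilityMeasure η] {U : Set (Z × Z)} (hU : IsOpen U) (hdiag : ∀ z, (z, z) ∈ U) {δ : ℝ}
    (hδ : 0 < δ) :
    ∃ (O : ℕ → Set Z) (m : ℕ), (∀ i, MeasurableSet (O i) ∧ O i ×ˢ O i ⊆ U) ∧
      η.real (⋃ i ∈ Finset.range m, O i)ᶜ ≤ δ := by
  have h : ∀ z : Z, ∃ O : Set Z, IsOpen O ∧ z ∈ O ∧ O ×ˢ O ⊆ U := by
    intro z
    obtain ⟨A, B, hA, hB, hzA, hzB, hAB⟩ := isOpen_prod_iff.1 hU z z (hdiag z)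
    exact ⟨A ∩ B, hA.inter hB, ⟨hzA, hzB⟩,
      (Set.prod_mono Set.inter_subset_left Set.inter_subset_right).trans hAB⟩
  choose O hO hzO hOU using h
  obtain ⟨s, hs, hcov⟩ := TopologicalSpace.countable_cover_nhds
    (f := O) fun z => (hO z).mem_nhds (hzO z)
  have hne : s.Nonempty := by
    rw [Set.nonempty_iff_ne_empty]
    rintro rfl
    have hZ := nonempty_of_isProbabilityMeasure η
    simp only [Set.biUnion_empty] at hcov
    exact Set.empty_ne_univ hcov
  obtain ⟨f, rfl⟩ := hs.exists_eq_range hne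
  rw [Set.biUnion_range] at hcov
  have ht := tendsto_measure_iUnion_accumulate (μ := η) (f := fun i => O (f i))
  rw [hcov, measure_univ] at ht
  have ht' := (ENNReal.tendsto_toReal ENNReal.one_ne_top).comp ht
  obtain ⟨m, hm⟩ := (ht'.eventually (lt_mem_nhds
    (show 1 - δ < ENNReal.toReal 1 by simpa using hδ))).exists
  refine ⟨fun i => O (f i), m + 1, fun i => ⟨(hO _).measurableSet, hOU _⟩, ?_⟩
  rw [measureReal_compl (Finset.measurableSet_biUnion _ fun i _ => (hO _).measurableSet)]
  have e : Set.accumulate (fun i => O (f i)) m = ⋃ i ∈ Finset.range (m + 1), O (f i) := by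
    ext z
    simp [Set.accumulate_def]
  rw [← e, probReal_univ]
  change 1 - δ < η.real (Set.accumulate (fun i => O (f i)) m) at hm
  linarith

end Final

theorem no_quotient_map_from_Bernoulli_extension (n : ℕ) (hn : 2 ≤ n)
    -- Λ = the image of SL_n(ℤ) in SL_n(ℝ) under the entrywise inclusion
    (Λ : Subgroup (SpecialLinearGroup (Fin n) ℝ))
    (hΛ : Λ = (SpecialLinearGroup.map (Int.castRingHom ℝ) :
        SpecialLinearGroup (Fin n) ℤ →* SpecialLinearGroup (Fin n) ℝ).range)
    -- η = a Borel probability measure on G/Λ invariant under left translation by all of G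
    (η : Measure (SpecialLinearGroup (Fin n) ℝ ⧸ Λ)) (hη : IsProbabilityMeasure η)
    (hηinv : ∀ g : SpecialLinearGroup (Fin n) ℝ, Measure.map (fun z => g • z) η = η)
    -- a countable set I with an action of Γ = SL_n(ℤ) all of whose orbits are infinite
    (I : Type*) [Countable I] [MulAction (SpecialLinearGroup (Fin n) ℤ) I]
    (horb : ∀ i : I, (MulAction.orbit (SpecialLinearGroup (Fin n) ℤ) i).Infinite)
    -- a probability space (X₀, μ₀)
    (X₀ : Type*) [MeasurableSpace X₀] (μ₀ : Measure X₀) (hμ₀ : IsProbabilityMeasure μ₀)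
    -- μ = the product probability measure μ₀^{⊗I} on X = X₀^I,
    -- characterized by its values on measurable cylinder sets
    (μ : Measure (I → X₀)) (hμ : IsProbabilityMeasure μ)
    (hμprod : ∀ (s : Finset I) (B : I → Set X₀), (∀ i, MeasurableSet (B i)) →
      μ {x | ∀ i ∈ s, x i ∈ B i} = ∏ i ∈ s, μ₀ (B i))
    -- a probability space (Y, ν) with a measure-preserving Γ-action
    (Y : Type*) [MeasurableSpace Y] (ν : Measure Y) (hν : IsProbabilityMeasure ν)
    [MulAction (SpecialLinearGroup (Fin n) ℤ) Y]
    (hYmeas : ∀ γ : SpecialLinearGroup (Fin n) ℤ, Measurable (fun y : Y => γ • y))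
    (hYpres : ∀ γ : SpecialLinearGroup (Fin n) ℤ, Measure.map (fun y : Y => γ • y) ν = ν)
    -- p : X × Y → G/Λ a measurable quotient Γ-map:
    (p : (I → X₀) × Y → SpecialLinearGroup (Fin n) ℝ ⧸ Λ) (hpmeas : Measurable p)
    (hpquot : Measure.map p (μ.prod ν) = η)
    -- equivariance: Γ acts on X by the generalized Bernoulli shift (γ·x)_i = x_{γ⁻¹·i},
    -- and on G/Λ by left translation through the inclusion SL_n(ℤ) → SL_n(ℝ)
    (hpequiv : ∀ γ : SpecialLinearGroup (Fin n) ℤ,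
      ∀ᵐ q ∂(μ.prod ν), p (fun i => q.1 (γ⁻¹ • i), γ • q.2) =
        (SpecialLinearGroup.map (Int.castRingHom ℝ) γ) • p q) :
    -- conclusion: p depends a.e. only on the second coordinate
    ∀ᵐ q ∂((μ.prod μ).prod ν), p (q.1.1, q.2) = p (q.1.2, q.2) := by
  have := isTopologicalGroup_SL n
  have := secondCountableTopology_SL n
  have := opensMeasurableSpace_quotient Λ
  have hdiag := measurableSet_diagonal_SL_quotient hΛ
  obtain rfl : μ = Measure.infinitePi fun _ : I => μ₀ := by
    refine Measure.eq_infinitePi _ fun s t ht => ?_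
    have := hμprod s t ht
    exact this
  have hY : ∀ γ : SpecialLinearGroup (Fin n) ℤ, MeasurePreserving (fun y : Y => γ • y) ν ν :=
    fun γ => ⟨hYmeas γ, hYpres γ⟩
  set E : Set (((I → X₀) × (I → X₀)) × Y) := {q | p (q.1.1, q.2) = p (q.1.2, q.2)} with hE
  have hEm : MeasurableSet E := by
    have : Measurable fun q : ((I → X₀) × (I → X₀)) × Y => (p (q.1.1, q.2), p (q.1.2, q.2)) := by
      fun_prop
    exact this hdiag
  suffices hmain : ∀ c > 0, (((Measure.infinitePi fun _ : I => μ₀).prod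
      (Measure.infinitePi fun _ : I => μ₀)).prod ν).real Eᶜ ≤ c by
    have h0 := le_antisymm (le_of_forall_pos_le_add fun c hc => by
      rw [zero_add]; exact hmain c hc) measureReal_nonneg
    rw [measureReal_eq_zero_iff] at h0
    exact h0
  intro c hc
  obtain ⟨V, hVo, hV1, δ, hδ, hrigid⟩ := exists_nhds_measureReal_offDiagonal_le hΛ hn η hc
  obtain ⟨O, m, hO, hOη⟩ := exists_squares_subset_measureReal_compl_le η
    (isOpen_nearPairs Λ hVo) (fun z => ⟨1, hV1, (one_smul _ z).symm⟩) (half_pos hδ)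
  have hesc : ∀ᶠ M : ℕ in atTop, ∀ i ∈ Finset.range m,
      ((Measure.infinitePi fun _ : I => interpMeasure μ₀ M).prod ν).real
      {q | (interpPi X₀ M 0 q.1, q.2) ∈ p ⁻¹' O i ∧ (interpPi X₀ M 1 q.1, q.2) ∉ p ⁻¹' O i} ≤
        δ / 2 / (m + 1) :=
    (Finset.eventually_all _).2 fun i _ => eventually_measureReal_interpPi_escape_le μ₀ ν
      (hpmeas (hO i).1) (by positivity)
  obtain ⟨M, hM⟩ := hesc.exists
  set Q := Measure.infinitePi fun _ : I => interpMeasure μ₀ M with hQ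
  set z : ℕ → (I → (X₀ × X₀) × Fin (M + 1)) × Y →
      SpecialLinearGroup (Fin n) ℝ ⧸ Λ := fun k q => p (interpPi X₀ M k q.1, q.2)
    with hz
  have hxpres : ∀ k, MeasurePreserving
      (fun q : (I → (X₀ × X₀) × Fin (M + 1)) × Y => (interpPi X₀ M k q.1, q.2)) (Q.prod ν)
      ((Measure.infinitePi fun _ : I => μ₀).prod ν) := fun k =>
    (measurePreserving_interpPi μ₀ M k).prod (MeasurePreserving.id ν)
  have hzm : ∀ k, Measurable (z k) := fun k => hpmeas.comp (hxpres k).measurable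
  have hzpres : ∀ k, MeasurePreserving (z k) (Q.prod ν) η := fun k =>
    (⟨hpmeas, hpquot⟩ : MeasurePreserving p _ η).comp (hxpres k)
  have hzequiv : ∀ (k : ℕ) (γ : SpecialLinearGroup (Fin n) ℤ), ∀ᵐ q ∂(Q.prod ν),
      z k (bernoulliSkew _ γ q) = SpecialLinearGroup.map (Int.castRingHom ℝ) γ • z k q :=
    fun k γ => (hxpres k).quasiMeasurePreserving.ae (hpequiv γ)
  have hTpres : ∀ γ : SpecialLinearGroup (Fin n) ℤ, MeasurePreserving
      (bernoulliSkew (I := I) ((X₀ × X₀) × Fin (M + 1)) γ) (Q.prod ν) (Q.prod ν) := fun γ =>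
    measurePreserving_bernoulliSkew (interpMeasure μ₀ M) ν (hY γ)
  have hpair : Measurable fun q => (z 0 q, z 1 q) := (hzm 0).prodMk (hzm 1)
  have hoff : ((Q.prod ν).map fun q => (z 0 q, z 1 q)).real {q | q.1 ≠ q.2} ≤ c := by
    refine hrigid _ (Measure.isProbabilityMeasure_map hpair.aemeasurable) (fun γ => ?_) ?_ ?_
    · have hsm : Measurable fun q : (SpecialLinearGroup (Fin n) ℝ ⧸ Λ) ×
          (SpecialLinearGroup (Fin n) ℝ ⧸ Λ) => (SpecialLinearGroup.map (Int.castRingHom ℝ) γ • q.1,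
          SpecialLinearGroup.map (Int.castRingHom ℝ) γ • q.2) :=
        ((measurable_smul_quotient Λ _).comp measurable_fst).prodMk
          ((measurable_smul_quotient Λ _).comp measurable_snd)
      refine ⟨hsm, ?_⟩
      rw [Measure.map_map hsm hpair]
      conv_rhs => rw [← (hTpres γ).map_eq, Measure.map_map hpair (hTpres γ).measurable]
      refine Measure.map_congr ?_
      filter_upwards [hzequiv 0 γ, hzequiv 1 γ] with q h0 h1
      simp only [Function.comp_apply, h0, h1]
    · rw [Measure.map_map measurable_fst hpair]
      exact (hzpres 0).map_eq
    · rw [map_measureReal_apply hpair (isOpen_nearPairs Λ hVo).measurableSet.compl]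
      have hsub : (fun q => (z 0 q, z 1 q)) ⁻¹' (nearPairs Λ V)ᶜ ⊆
          z 0 ⁻¹' (⋃ i ∈ Finset.range m, O i)ᶜ ∪ ⋃ i ∈ Finset.range m,
            {q | (interpPi X₀ M 0 q.1, q.2) ∈ p ⁻¹' O i ∧
              (interpPi X₀ M 1 q.1, q.2) ∉ p ⁻¹' O i} := by
        intro q hq
        by_cases h : z 0 q ∈ ⋃ i ∈ Finset.range m, O i
        · obtain ⟨i, hi, h0⟩ := Set.mem_iUnion₂.1 h
          exact Or.inr (Set.mem_iUnion₂.2 ⟨i, hi, h0, fun h1 => hq ((hO i).2 ⟨h0, h1⟩)⟩)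
        · exact Or.inl h
      have hOm : MeasurableSet (⋃ i ∈ Finset.range m, O i)ᶜ :=
        (Finset.measurableSet_biUnion _ fun i _ => (hO i).1).compl
      have h1 := (hzpres 0).measureReal_preimage hOm.nullMeasurableSet
      have h2 : (m : ℝ) * (δ / 2 / (m + 1)) ≤ δ / 2 := by
        rw [← mul_div_assoc, div_le_iff₀ (by positivity)]
        nlinarith
      have h3 := (measureReal_biUnion_finset_le (μ := Q.prod ν) (Finset.range m) _).trans
        (Finset.sum_le_sum hM)
      rw [Finset.sum_const, Finset.card_range, nsmul_eq_mul] at h3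
      refine (measureReal_mono hsub).trans ((measureReal_union_le _ _).trans ?_)
      linarith
  set D : Set ((I → (X₀ × X₀) × Fin (M + 1)) × Y) := {q | z 0 q = z 1 q} with hD
  have hDm : MeasurableSet D := hpair hdiag
  have hDc : (Q.prod ν).real Dᶜ ≤ c := by
    have h := map_measureReal_apply (μ := Q.prod ν) hpair hdiag.compl
    exact h.symm.le.trans hoff
  have h01 := ae_measureReal_section_eq_zero_or_one (interpMeasure μ₀ M) ν horb hY hDm fun γ => by
    filter_upwards [hzequiv 0 γ, hzequiv 1 γ] with q h0 h1
    refine propext ?_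
    change z 0 (bernoulliSkew _ γ q) = z 1 (bernoulliSkew _ γ q) ↔ z 0 q = z 1 q
    rw [h0, h1]
    exact (MulAction.injective _).eq_iff
  refine le_trans ?_ hDc
  rw [measureReal_prod_eq_integral _ ν hEm.compl, measureReal_prod_eq_integral _ ν hDm.compl]
  have hInt : ∀ {X : Type _} [MeasurableSpace X] (R : Measure X) [IsProbabilityMeasure R]
      {A : Set (X × Y)}, MeasurableSet A →
      Integrable (fun y => R.real ((fun x => (x, y)) ⁻¹' A)) ν := fun R _ _ hA =>
    .of_bound (measurable_measureReal_section R hA).aestronglyMeasurable 1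
      (.of_forall fun y => by
        rw [Real.norm_of_nonneg measureReal_nonneg]; exact measureReal_le_one)
  refine integral_mono_ae (hInt _ hEm.compl) (hInt _ hDm.compl) ?_
  filter_upwards [h01] with y hy
  have hDy : MeasurableSet ((fun w => (w, y)) ⁻¹' D) := hDm.preimage (by fun_prop)
  have hEy : MeasurableSet ((fun x => (x, y)) ⁻¹' E) := hEm.preimage (by fun_prop)
  rcases hy with hy | hy
  · have h1 : Q.real ((fun w => (w, y)) ⁻¹' Dᶜ) = 1 := by
      rw [Set.preimage_compl, probReal_compl_eq_one_sub hDy, hy, sub_zero]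
    rw [h1]
    exact measureReal_le_one
  · refine le_trans (le_of_eq ?_) measureReal_nonneg
    have hstep : ∀ k < M + 1, ∀ᵐ w ∂Q, z k (w, y) = z (k + 1) (w, y) := by
      intro k hk
      have hm : ∀ k, Measurable fun w : I → (X₀ × X₀) × Fin (M + 1) =>
        (interpPi X₀ M k w, interpPi X₀ M (k + 1) w) := fun k => by fun_prop
      have h0 : ∀ᵐ x ∂(Q.map fun w => (interpPi X₀ M 0 w, interpPi X₀ M (0 + 1) w)),
          x ∈ (fun x => (x, y)) ⁻¹' E := by
        refine (ae_map_iff (p := fun x => x ∈ (fun x => (x, y)) ⁻¹' E)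
          (hm 0).aemeasurable hEy).2 ?_
        exact (prob_compl_eq_zero_iff hDy).2 (by
          rw [measureReal_def] at hy
          exact (ENNReal.toReal_eq_one_iff _).1 hy)
      rw [← map_interpPi_succ μ₀ M hk] at h0
      exact (ae_map_iff (p := fun x => x ∈ (fun x => (x, y)) ⁻¹' E)
        (hm k).aemeasurable hEy).1 h0
    have hall : ∀ᵐ w ∂Q, z 0 (w, y) = z (M + 1) (w, y) := by
      have : ∀ᵐ w ∂Q, ∀ k < M + 1, z k (w, y) = z (k + 1) (w, y) :=
        ae_all_iff.2 fun k => ae_all_iff.2 fun hk => hstep k hk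
      filter_upwards [this] with w hw
      have hk : ∀ k ≤ M + 1, z 0 (w, y) = z k (w, y) := by
        intro k
        induction k with
        | zero => exact fun _ => rfl
        | succ k ih => exact fun hk => (ih (by omega)).trans (hw k (by omega))
      exact hk _ le_rfl
    have hae : ∀ᵐ x ∂((Measure.infinitePi fun _ : I => μ₀).prod
        (Measure.infinitePi fun _ : I => μ₀)), x ∈ (fun x => (x, y)) ⁻¹' E := by
      rw [← map_interpPi_zero_last μ₀ M]
      exact (ae_map_iff (p := fun x => x ∈ (fun x => (x, y)) ⁻¹' E)
        (Measurable.aemeasurable (by fun_prop)) hEy).2 hall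
    rw [measureReal_eq_zero_iff]
    exact hae
end
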